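/- Let R be a principal ideal domain, P a finitely generated abelian group, L a lattice, σ ⊆ L_ℚ a strongly convex rational polyhedral cone, and let ψ: L → P make A = R[σ∩L] a P-graded R-algebra. Then every finitely generated P-graded A-module that is projective as an A-module is trivial, i.e., isomorphic as a P-graded A-module to F ⊗_R A for some P-graded R-module F that is finitely generated projective over R. -/

import Mathlib

open scoped TensorProduct

universe u

/-! ### Properties of commutative (additive) monoids -/

/-- `Q` is cancellative: `a + x = a + y → x = y`. -/
def IsCancellativeAddMonoid (Q : Type*) [AddCommMonoid Q] : Prop :=
  ∀ a x y : Q, a + x = a + y → x = y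

/-- `Q` is torsion-free: `n • x = n • y` for some `n > 0` implies `x = y`. -/
def IsTorsionFreeAddMonoid (Q : Type*) [AddCommMonoid Q] : Prop :=
  ∀ n : ℕ, 0 < n → ∀ x y : Q, n • x = n • y → x = y

/-- `Q` is seminormal: an element `x = a - b` of the Grothendieck group with
`2x, 3x ∈ Q` lies in `Q` (stated elementwise via representatives). -/
def IsSeminormalAddMonoid (Q : Type*) [AddCommMonoid Q] : Prop :=
  ∀ a b : Q, (∃ y : Q, a + a = b + b + y) → (∃ z : Q, a + a + a = b + b + b + z) →
    ∃ w : Q, a = b + w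

/-- `Q` is normal: an element `x = a - b` of the Grothendieck group with
`n • x ∈ Q` for some `n > 0` lies in `Q` (stated elementwise via representatives). -/
def IsNormalAddMonoid (Q : Type*) [AddCommMonoid Q] : Prop :=
  ∀ a b : Q, (∃ n : ℕ, 0 < n ∧ ∃ y : Q, n • a = n • b + y) → ∃ w : Q, a = b + w

/-- `Q` has no nontrivial unit: `x + y = 0 → x = 0`. -/
def HasNoNontrivialAddUnits (Q : Type*) [AddCommMonoid Q] : Prop :=
  ∀ x y : Q, x + y = 0 → x = 0

/-! ### Freeness/extension conditions on rings -/

/-- Every (not necessarily finitely generated) projective `R`-module is free. -/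
def AllProjectiveFree (R : Type u) [CommRing R] : Prop :=
  ∀ (M : Type u) [AddCommGroup M] [Module R M], Module.Projective R M → Module.Free R M

/-- Every finitely generated projective `B`-module is free. -/
def AllFGProjectiveFree (B : Type u) [CommRing B] : Prop :=
  ∀ (M : Type u) [AddCommGroup M] [Module B M],
    Module.Finite B M → Module.Projective B M → Module.Free B M

/-- Every finitely generated projective `B`-module is extended from `R`, i.e. of the form
`B ⊗_R F` for a finitely generated projective `R`-module `F`. -/
def AllFGProjectiveExtended (R B : Type u) [CommRing R] [CommRing B] [Algebra R B] : Prop :=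
  ∀ (M : Type u) [AddCommGroup M] [Module B M],
    Module.Finite B M → Module.Projective B M →
    ∃ (F : Type u) (_ : AddCommGroup F) (_ : Module R F),
      Module.Finite R F ∧ Module.Projective R F ∧ Nonempty (M ≃ₗ[B] B ⊗[R] F)

/-- Condition (†): every projective `R`-module is free and every finitely generated
projective module over the group algebra `R[Q]` of a torsion-free abelian group `Q`
is extended from `R`. -/
def CondDagger (R : Type u) [CommRing R] : Prop :=
  AllProjectiveFree R ∧
  ∀ (Q : Type u) [AddCommGroup Q], IsTorsionFreeAddMonoid Q →
    AllFGProjectiveExtended R (AddMonoidAlgebra R Q)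

/-- Condition (††): every projective `R`-module is free and every finitely generated
projective module over `R[Q × ℤ^n]` is extended from `R`, whenever `Q` is torsion-free,
seminormal, cancellative and has no nontrivial unit. -/
def CondDaggerDagger (R : Type u) [CommRing R] : Prop :=
  AllProjectiveFree R ∧
  ∀ (n : ℕ) (Q : Type u) [AddCommMonoid Q],
    IsCancellativeAddMonoid Q → IsTorsionFreeAddMonoid Q → IsSeminormalAddMonoid Q →
    HasNoNontrivialAddUnits Q →
    AllFGProjectiveExtended R (AddMonoidAlgebra R (Q × (Fin n → ℤ)))

/-! ### Gradings -/

/-- A map `f` is degree-preserving for the gradings `ℳ`, `𝒩`. -/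
def MapsGraded {P M N : Type*} {R : Type*} [Semiring R] [AddCommMonoid M] [AddCommMonoid N]
    [Module R M] [Module R N] (f : M → N)
    (ℳ : P → Submodule R M) (𝒩 : P → Submodule R N) : Prop :=
  ∀ c : P, ∀ m ∈ ℳ c, f m ∈ 𝒩 c

/-- `𝒜` is a `P`-grading of the `R`-algebra `A`:
`A = ⊕_{a ∈ P} A_a`, `A_a · A_b ⊆ A_{a+b}`, `1 ∈ A_0`. -/
structure IsGradedRing {R A P : Type*} [CommRing R] [Ring A] [Algebra R A]
    [AddCommGroup P] [DecidableEq P] (𝒜 : P → Submodule R A) : Prop where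
  is_internal : DirectSum.IsInternal 𝒜
  one_mem : (1 : A) ∈ 𝒜 0
  mul_mem : ∀ {a b : P} {x y : A}, x ∈ 𝒜 a → y ∈ 𝒜 b → x * y ∈ 𝒜 (a + b)

/-- `ℳ` is a `P`-grading of the `A`-module `M`, compatible with the grading `𝒜` of `A`:
`M = ⊕_{a ∈ P} M_a` and `A_a • M_b ⊆ M_{a+b}`. -/
structure IsGradedModule {R A P M : Type*} [CommRing R] [Ring A] [Algebra R A]
    [AddCommGroup P] [DecidableEq P] [AddCommGroup M] [Module R M] [Module A M]
    [IsScalarTower R A M] (𝒜 : P → Submodule R A) (ℳ : P → Submodule R M) : Prop where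
  is_internal : DirectSum.IsInternal ℳ
  smul_mem : ∀ {a b : P} {x : A} {m : M}, x ∈ 𝒜 a → m ∈ ℳ b → x • m ∈ ℳ (a + b)

/-- The natural `P`-grading on `B ⊗[R] F`: `(B ⊗ F)_c = ⊕_{a+b=c} B_a ⊗ F_b`. -/
noncomputable def tensorGrading {R B F P : Type*} [CommRing R] [CommRing B] [Algebra R B]
    [AddCommGroup P] [AddCommGroup F] [Module R F]
    (ℬ : P → Submodule R B) (ℱ : P → Submodule R F) : P → Submodule R (B ⊗[R] F) :=
  fun c => Submodule.span R
    {z | ∃ a b : P, a + b = c ∧ ∃ x ∈ ℬ a, ∃ f ∈ ℱ b, z = x ⊗ₜ[R] f}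

/-- A `P`-graded `A`-module `(M, ℳ)` is (equivariantly) extended from `R`, i.e. trivial:
it is isomorphic, as a `P`-graded `A`-module, to `A ⊗_R F` for some `P`-graded `R`-module
`F` which is finitely generated and projective over `R`. -/
def IsGradedExtendedFrom (R : Type u) {A P : Type u} [CommRing R] [CommRing A]
    [Algebra R A] [AddCommGroup P] [DecidableEq P] (𝒜 : P → Submodule R A)
    (M : Type u) [AddCommGroup M] [Module R M] [Module A M] [IsScalarTower R A M]
    (ℳ : P → Submodule R M) : Prop :=
  ∃ (F : Type u) (_ : AddCommGroup F) (_ : Module R F) (ℱ : P → Submodule R F),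
    DirectSum.IsInternal ℱ ∧ Module.Finite R F ∧ Module.Projective R F ∧
    ∃ e : M ≃ₗ[A] A ⊗[R] F,
      MapsGraded (⇑e) ℳ (tensorGrading 𝒜 ℱ) ∧ MapsGraded (⇑e.symm) (tensorGrading 𝒜 ℱ) ℳ

/-! ### Monoid algebras, cones and faces -/

/-- The grading of a monoid algebra `R[Λ]` induced by a degree function `deg : Λ → P`:
the piece of degree `p` is spanned by the monomials `e_s` with `deg s = p`. -/
noncomputable def monAlgGrading (R : Type*) [CommRing R] {Λ P : Type*} [AddCommMonoid Λ]
    (deg : Λ → P) : P → Submodule R (AddMonoidAlgebra R Λ) :=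
  fun p => Submodule.span R {x | ∃ s : Λ, deg s = p ∧ x = AddMonoidAlgebra.single s 1}

/-- The lattice points `σ ∩ L` of the rational polyhedral cone
`σ = ⋂ᵢ (l i)⁻¹(ℚ≥0)` in `L ⊗ ℚ`. -/
def coneLatticePoints {L : Type*} [AddCommGroup L] {q : ℕ} (l : Fin q → L →+ ℚ) :
    AddSubmonoid L where
  carrier := {m | ∀ i, 0 ≤ l i m}
  zero_mem' := fun i => by simp
  add_mem' := by
    intro a b ha hb i
    rw [map_add]
    exact add_nonneg (ha i) (hb i)

/-- The lattice points `τ ∩ L` of the face `τ = σ ∩ l'⁻¹(0)` of the cone `σ`. -/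
def faceLatticePoints {L : Type*} [AddCommGroup L] {q : ℕ} (l : Fin q → L →+ ℚ)
    (l' : L →+ ℚ) : AddSubmonoid L where
  carrier := {m | (∀ i, 0 ≤ l i m) ∧ l' m = 0}
  zero_mem' := ⟨fun i => by simp, by simp⟩
  add_mem' := by
    intro a b ha hb
    refine ⟨fun i => ?_, ?_⟩
    · rw [map_add]; exact add_nonneg (ha.1 i) (hb.1 i)
    · rw [map_add, ha.2, hb.2, add_zero]

/-- The submonoid of elements of a submonoid `S ⊆ L` killed by `ψ : L →+ P`
(the "invariant" part of `S`). -/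
def kerSubmonoidIn {L P : Type*} [AddCommMonoid L] [AddCommMonoid P]
    (S : AddSubmonoid L) (ψ : L →+ P) : AddSubmonoid L where
  carrier := {m | m ∈ S ∧ ψ m = 0}
  zero_mem' := ⟨S.zero_mem, map_zero ψ⟩
  add_mem' := by
    intro a b ha hb
    exact ⟨S.add_mem ha.1 hb.1, by rw [map_add, ha.2, hb.2, add_zero]⟩

/-- The kernel submonoid `{q ∈ Q | u q = 0}` of a monoid homomorphism `u : Q →+ P`. -/
def kerSubmonoid {Q P : Type*} [AddCommMonoid Q] [AddCommMonoid P] (u : Q →+ P) :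
    AddSubmonoid Q where
  carrier := {q | u q = 0}
  zero_mem' := map_zero u
  add_mem' := by
    intro a b ha hb
    simp only [Set.mem_setOf_eq] at *
    rw [map_add, ha, hb, add_zero]

/-- `S` spans `L ⊗ ℚ`: a positive multiple of every lattice element is a difference of
elements of `S` (this expresses that the cone is "strongly convex", i.e. spans `L_ℚ`). -/
def SpansLattice {L : Type*} [AddCommGroup L] (S : AddSubmonoid L) : Prop :=
  ∀ m : L, ∃ n : ℕ, 0 < n ∧ ∃ x ∈ S, ∃ y ∈ S, (n : ℤ) • m = x - y

namespace GradedMatrix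

open Matrix

section Basic

theorem mem_of_eq {P A : Type*} [AddGroup A] {𝒜 : P → AddSubgroup A} {a b : P} {x : A}
    (hx : x ∈ 𝒜 a) (h : a = b) : x ∈ 𝒜 b := h ▸ hx

variable {P A B ι κ μ : Type*} [AddCommGroup P] [CommRing A] [CommRing B]

/-- Entry `(i, j)` of `M` is homogeneous of degree `p i - q j`. -/
def IsHom (𝒜 : P → AddSubgroup A) (p : ι → P) (q : κ → P) (M : Matrix ι κ A) : Prop :=
  ∀ i j, M i j ∈ 𝒜 (p i - q j)

variable {𝒜 : P → AddSubgroup A} {ℬ : P → AddSubgroup B} {p : ι → P} {q : κ → P} {r : μ → P}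

theorem mul_mem_of_eq [SetLike.GradedMonoid 𝒜] {a b c : P} {x y : A} (hx : x ∈ 𝒜 a)
    (hy : y ∈ 𝒜 b) (h : a + b = c) : x * y ∈ 𝒜 c := h ▸ SetLike.mul_mem_graded hx hy

theorem pow_mem_zero [SetLike.GradedMonoid 𝒜] {x : A} (hx : x ∈ 𝒜 0) (n : ℕ) :
    x ^ n ∈ 𝒜 0 := mem_of_eq (SetLike.pow_mem_graded n hx) (smul_zero n)

theorem prod_mem [SetLike.GradedMonoid 𝒜] (s : Finset ι) (g : ι → A) (d : ι → P)
    (h : ∀ i ∈ s, g i ∈ 𝒜 (d i)) : ∏ i ∈ s, g i ∈ 𝒜 (∑ i ∈ s, d i) := by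
  classical
  induction s using Finset.induction_on with
  | empty => simpa using SetLike.one_mem_graded 𝒜
  | insert a s ha ih =>
    rw [Finset.prod_insert ha, Finset.sum_insert ha]
    exact SetLike.mul_mem_graded (h a (by simp)) (ih fun i hi => h i (by simp [hi]))

namespace IsHom

theorem congr_weights {M : Matrix ι κ A} (h : IsHom 𝒜 p q M) {p' : ι → P} {q' : κ → P}
    (hpq : ∀ i j, p i - q j = p' i - q' j) : IsHom 𝒜 p' q' M :=
  fun i j => mem_of_eq (h i j) (hpq i j)

theorem mul [SetLike.GradedMonoid 𝒜] [Fintype κ] {M : Matrix ι κ A} {N : Matrix κ μ A}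
    (hM : IsHom 𝒜 p q M) (hN : IsHom 𝒜 q r N) : IsHom 𝒜 p r (M * N) := fun i j => by
  rw [Matrix.mul_apply]
  exact sum_mem fun k _ => mul_mem_of_eq (hM i k) (hN k j) (by abel)

theorem add {M N : Matrix ι κ A} (hM : IsHom 𝒜 p q M) (hN : IsHom 𝒜 p q N) :
    IsHom 𝒜 p q (M + N) := fun i j => add_mem (hM i j) (hN i j)

theorem sub {M N : Matrix ι κ A} (hM : IsHom 𝒜 p q M) (hN : IsHom 𝒜 p q N) :
    IsHom 𝒜 p q (M - N) := fun i j => sub_mem (hM i j) (hN i j)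

theorem neg {M : Matrix ι κ A} (hM : IsHom 𝒜 p q M) :
    IsHom 𝒜 p q (-M) := fun i j => neg_mem (hM i j)

theorem one [SetLike.GradedMonoid 𝒜] [DecidableEq ι] : IsHom 𝒜 p p (1 : Matrix ι ι A) :=
  fun i j => by
    rw [Matrix.one_apply]
    split_ifs with h
    · subst h; simpa using SetLike.one_mem_graded 𝒜
    · exact zero_mem _

theorem smul [SetLike.GradedMonoid 𝒜] {M : Matrix ι κ A} (hM : IsHom 𝒜 p q M) {c : A} {d : P}
    (hc : c ∈ 𝒜 d) : IsHom 𝒜 (fun i => p i + d) q (c • M) := fun i j =>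
  mul_mem_of_eq hc (hM i j) (by dsimp only; abel)

theorem smul_zero [SetLike.GradedMonoid 𝒜] {M : Matrix ι κ A} (hM : IsHom 𝒜 p q M) {c : A}
    (hc : c ∈ 𝒜 0) : IsHom 𝒜 p q (c • M) := fun i j =>
  mul_mem_of_eq hc (hM i j) (by abel)

theorem map {M : Matrix ι κ A} (hM : IsHom 𝒜 p q M) (f : A →+* B)
    (hf : ∀ c, ∀ a ∈ 𝒜 c, f a ∈ ℬ c) : IsHom ℬ p q (M.map f) := fun i j => hf _ _ (hM i j)

theorem det [SetLike.GradedMonoid 𝒜] [Fintype ι] [DecidableEq ι] {p q : ι → P}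
    {M : Matrix ι ι A} (hM : IsHom 𝒜 p q M) : M.det ∈ 𝒜 (∑ i, p i - ∑ i, q i) := by
  rw [Matrix.det_apply]
  refine sum_mem fun σ _ => ?_
  have h : ∏ i, M (σ i) i ∈ 𝒜 (∑ i, p i - ∑ i, q i) := by
    refine mem_of_eq (prod_mem _ _ (fun i => p (σ i) - q i) fun i _ => hM _ _) ?_
    rw [Finset.sum_sub_distrib, Equiv.sum_comp σ p]
  rcases Int.units_eq_one_or (Equiv.Perm.sign σ) with hs | hs <;> simp [hs, h]

theorem adjugate [SetLike.GradedMonoid 𝒜] [Fintype ι] [DecidableEq ι] {p q : ι → P}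
    {M : Matrix ι ι A} (hM : IsHom 𝒜 p q M) :
    IsHom 𝒜 (fun i => q i + (∑ k, p k - ∑ k, q k)) p M.adjugate := fun i j => by
  rw [Matrix.adjugate_apply]
  have : IsHom 𝒜 (Function.update p j (q i)) q (M.updateRow j (Pi.single i 1)) := by
    intro k l
    by_cases hk : k = j
    · subst hk
      by_cases hl : l = i
      · subst hl; simpa using SetLike.one_mem_graded 𝒜
      · simp [hl]
    · simpa [hk] using hM k l
  refine mem_of_eq this.det ?_
  rw [Finset.sum_update_of_mem (Finset.mem_univ j),
    ← Finset.sum_sdiff (Finset.subset_univ {j}) (f := p), Finset.sum_singleton]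
  dsimp only
  abel

end IsHom

variable (𝒜) in
/-- Graded equivalence of (idempotent) matrices: `e = U V` and `f = V U` with `U`, `V`
homogeneous. -/
def GEquiv [Fintype ι] [Fintype κ] (p : ι → P) (e : Matrix ι ι A) (q : κ → P)
    (f : Matrix κ κ A) : Prop :=
  ∃ (U : Matrix ι κ A) (V : Matrix κ ι A), IsHom 𝒜 p q U ∧ IsHom 𝒜 q p V ∧ U * V = e ∧ V * U = f

namespace GEquiv

variable [Fintype ι] [Fintype κ] [Fintype μ] {e : Matrix ι ι A} {f : Matrix κ κ A}
  {g : Matrix μ μ A}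

theorem symm (h : GEquiv 𝒜 p e q f) : GEquiv 𝒜 q f p e := by
  obtain ⟨U, V, hU, hV, h1, h2⟩ := h
  exact ⟨V, U, hV, hU, h2, h1⟩

theorem refl (he : IsHom 𝒜 p p e) (hee : e * e = e) : GEquiv 𝒜 p e p e :=
  ⟨e, e, he, he, hee, hee⟩

theorem trans [SetLike.GradedMonoid 𝒜] (he : e * e = e) (hg : g * g = g)
    (h : GEquiv 𝒜 p e q f) (h' : GEquiv 𝒜 q f r g) : GEquiv 𝒜 p e r g := by
  obtain ⟨U, V, hU, hV, h1, h2⟩ := h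
  obtain ⟨U', V', hU', hV', h1', h2'⟩ := h'
  refine ⟨U * U', V' * V, hU.mul hU', hV'.mul hV, ?_, ?_⟩
  · calc U * U' * (V' * V) = U * (U' * V') * V := by simp only [Matrix.mul_assoc]
      _ = (U * V) * (U * V) := by rw [h1', ← h2]; simp only [Matrix.mul_assoc]
      _ = e := by rw [h1, he]
  · calc V' * V * (U * U') = V' * (V * U) * U' := by simp only [Matrix.mul_assoc]
      _ = (V' * U') * (V' * U') := by rw [h2, ← h1']; simp only [Matrix.mul_assoc]
      _ = g := by rw [h2', hg]

theorem map (h : GEquiv 𝒜 p e q f) (φ : A →+* B) (hφ : ∀ c, ∀ a ∈ 𝒜 c, φ a ∈ ℬ c) :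
    GEquiv ℬ p (e.map φ) q (f.map φ) := by
  obtain ⟨U, V, hU, hV, h1, h2⟩ := h
  refine ⟨U.map φ, V.map φ, hU.map φ hφ, hV.map φ hφ, ?_, ?_⟩
  · rw [← h1, Matrix.map_mul]
  · rw [← h2, Matrix.map_mul]

end GEquiv

variable (𝒜) in
/-- The homogeneous idempotent `e` defines a graded free module. -/
def GTriv [Fintype ι] (p : ι → P) (e : Matrix ι ι A) : Prop :=
  ∃ (n : ℕ) (w : Fin n → P), GEquiv 𝒜 p e w 1

namespace GTriv

variable [Fintype ι] [Fintype κ] {e : Matrix ι ι A} {f : Matrix κ κ A}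

theorem map (h : GTriv 𝒜 p e) (φ : A →+* B) (hφ : ∀ c, ∀ a ∈ 𝒜 c, φ a ∈ ℬ c) :
    GTriv ℬ p (e.map φ) := by
  obtain ⟨n, w, h⟩ := h
  refine ⟨n, w, ?_⟩
  simpa using h.map φ hφ

theorem of_gequiv [SetLike.GradedMonoid 𝒜] (he : e * e = e) (h : GEquiv 𝒜 p e q f)
    (hf : GTriv 𝒜 q f) : GTriv 𝒜 p e := by
  obtain ⟨n, w, h'⟩ := hf
  exact ⟨n, w, h.trans he (one_mul 1) h'⟩

theorem of_one [DecidableEq κ] (h : GEquiv 𝒜 p e q 1) :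
    GTriv 𝒜 p e := by
  obtain ⟨U, V, hU, hV, h1, h2⟩ := h
  let E := Fintype.equivFin κ
  refine ⟨Fintype.card κ, q ∘ E.symm, U.submatrix id E.symm, V.submatrix E.symm id,
    fun i j => hU _ _, fun i j => hV _ _, ?_, ?_⟩
  · rw [Matrix.submatrix_mul_equiv, h1, Matrix.submatrix_id_id]
  · rw [← Matrix.submatrix_mul _ _ _ _ _ Function.bijective_id, h2, Matrix.submatrix_one_equiv]

end GTriv

variable (𝒜) in
/-- All homogeneous idempotent matrices define graded free modules. -/
def AllTriv : Prop :=
  ∀ (n : ℕ) (p : Fin n → P) (e : Matrix (Fin n) (Fin n) A), IsHom 𝒜 p p e → e * e = e →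
    GTriv 𝒜 p e

theorem AllTriv.gTriv [SetLike.GradedMonoid 𝒜] (h : AllTriv 𝒜) [Fintype ι] {e : Matrix ι ι A}
    (he : IsHom 𝒜 p p e) (hee : e * e = e) : GTriv 𝒜 p e := by
  classical
  let E := Fintype.equivFin ι
  have h1 : IsHom 𝒜 (p ∘ E.symm) (p ∘ E.symm) (e.submatrix E.symm E.symm) := fun i j => he _ _
  have h2 : e.submatrix E.symm E.symm * e.submatrix E.symm E.symm = e.submatrix E.symm E.symm := by
    rw [Matrix.submatrix_mul_equiv, hee]
  refine GTriv.of_gequiv hee ?_ (h _ _ _ h1 h2)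
  refine ⟨e.submatrix id E.symm, e.submatrix E.symm id, fun i j => he _ _, fun i j => he _ _, ?_, ?_⟩
  · rw [Matrix.submatrix_mul_equiv, hee, Matrix.submatrix_id_id]
  · rw [← Matrix.submatrix_mul _ _ _ _ _ Function.bijective_id, hee]

/-- Transport of triviality along a graded isomorphism. -/
theorem AllTriv.of_ringEquiv (h : AllTriv 𝒜) (φ : A ≃+* B)
    (hφ : ∀ c, ∀ a ∈ 𝒜 c, φ a ∈ ℬ c) (hφ' : ∀ c, ∀ b ∈ ℬ c, φ.symm b ∈ 𝒜 c) : AllTriv ℬ := by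
  intro n p e he hee
  have := (h n p (e.map φ.symm) (he.map (φ.symm : B →+* A) hφ')
    (by rw [← Matrix.map_mul, hee])).map (φ : A →+* B) hφ
  simpa [Matrix.map_map, Function.comp_def] using this

end Basic

end GradedMatrix

namespace GradedMatrix

open Matrix Polynomial

section PolyGrading

variable {P A : Type*} [AddCommGroup P] [CommRing A]

/-- The grading of `A[X]` extending `𝒜` for which `X` has degree `x`. -/
def polyGr (𝒜 : P → AddSubgroup A) (x : P) (c : P) : AddSubgroup A[X] where
  carrier := {f | ∀ n, f.coeff n ∈ 𝒜 (c - n • x)}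
  zero_mem' := fun n => by simp
  add_mem' := fun hf hg n => by rw [coeff_add]; exact add_mem (hf n) (hg n)
  neg_mem' := fun hf n => by rw [coeff_neg]; exact neg_mem (hf n)

variable {𝒜 : P → AddSubgroup A} {x : P}

theorem monomial_mem {c d : P} {a : A} (n : ℕ) (ha : a ∈ 𝒜 c) (h : c + n • x = d) :
    monomial n a ∈ polyGr 𝒜 x d := fun k => by
  rw [coeff_monomial]
  split_ifs with hk
  · subst hk; exact mem_of_eq ha (by rw [← h]; abel)
  · exact zero_mem _

theorem C_mem {c : P} {a : A} (ha : a ∈ 𝒜 c) : C a ∈ polyGr 𝒜 x c :=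
  monomial_mem 0 ha (by simp)

instance [SetLike.GradedMonoid 𝒜] : SetLike.GradedMonoid (polyGr 𝒜 x) where
  one_mem := C_mem (SetLike.one_mem_graded 𝒜)
  mul_mem := fun a b f g hf hg n => by
    rw [coeff_mul]
    refine sum_mem fun kl hkl => mul_mem_of_eq (hf _) (hg _) ?_
    rw [← Finset.HasAntidiagonal.mem_antidiagonal.mp hkl, add_smul]
    abel

theorem X_pow_mem [SetLike.GradedMonoid 𝒜] (n : ℕ) :
    (X ^ n : A[X]) ∈ polyGr 𝒜 x (n • x) := by
  rw [← monomial_one_right_eq_X_pow]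
  exact monomial_mem n (SetLike.one_mem_graded 𝒜) (by simp)

theorem coeff_zero_mem {c : P} {f : A[X]} (hf : f ∈ polyGr 𝒜 x c) : f.coeff 0 ∈ 𝒜 c := by
  simpa using hf 0

theorem comp_C_mul_X_mem [SetLike.GradedMonoid 𝒜] {a : A} (ha : a ∈ 𝒜 0) {c : P} {f : A[X]}
    (hf : f ∈ polyGr 𝒜 x c) : f.comp (C a * X) ∈ polyGr 𝒜 x c := fun n => by
  rw [comp_C_mul_X_coeff]
  exact mul_mem_of_eq (hf n) (pow_mem_zero ha n) (by abel)

variable (𝒜 x) in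
/-- Monic and homogeneous polynomials. -/
def HMonic (d : A[X]) : Prop := d.Monic ∧ d ∈ polyGr 𝒜 x (d.natDegree • x)

theorem exists_div [Nontrivial A] [SetLike.GradedMonoid 𝒜] {d : A[X]} (hd : HMonic 𝒜 x d) {c : P} (g : A[X])
    (hg : g ∈ polyGr 𝒜 x c) : ∃ q ∈ polyGr 𝒜 x (c - d.natDegree • x), ∃ r ∈ polyGr 𝒜 x c,
      r + d * q = g ∧ r.degree < d.degree := by
  induction hn : g.degree using WellFoundedLT.induction generalizing g with
  | ind m ih =>
    by_cases hlt : g.degree < d.degree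
    · exact ⟨0, zero_mem _, g, hg, by simp, hlt⟩
    push Not at hlt
    have hg0 : g ≠ 0 := by
      rintro rfl
      exact hd.1.ne_zero (by simpa using hlt)
    have hwf := div_wf_lemma ⟨hlt, hg0⟩ hd.1
    have hnat : d.natDegree ≤ g.natDegree := natDegree_le_natDegree hlt
    have hmono : C g.leadingCoeff * X ^ (g.natDegree - d.natDegree) ∈
        polyGr 𝒜 x (c - d.natDegree • x) := by
      rw [C_mul_X_pow_eq_monomial]
      refine monomial_mem _ (hg _) ?_
      have : g.natDegree • x = (g.natDegree - d.natDegree) • x + d.natDegree • x := by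
        rw [← add_smul, Nat.sub_add_cancel hnat]
      rw [this]; abel
    obtain ⟨q, hq, r, hr, h1, h2⟩ := ih _ (hn ▸ hwf)
      (g - d * (C g.leadingCoeff * X ^ (g.natDegree - d.natDegree)))
      (sub_mem hg (mul_mem_of_eq hd.2 hmono (by abel))) rfl
    refine ⟨q + C g.leadingCoeff * X ^ (g.natDegree - d.natDegree), add_mem hq hmono, r, hr,
      ?_, h2⟩
    rw [mul_add, ← add_assoc, h1]
    abel

theorem divByMonic_mem [SetLike.GradedMonoid 𝒜] {d : A[X]} (hd : HMonic 𝒜 x d) {c : P} {g : A[X]}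
    (hg : g ∈ polyGr 𝒜 x c) : g /ₘ d ∈ polyGr 𝒜 x (c - d.natDegree • x) := by
  cases subsingleton_or_nontrivial A
  · rw [Subsingleton.elim (g /ₘ d) 0]; exact zero_mem _
  obtain ⟨q, hq, r, hr, h1, h2⟩ := exists_div hd g hg
  rwa [(div_modByMonic_unique q r hd.1 ⟨h1, h2⟩).1]

theorem modByMonic_mem [SetLike.GradedMonoid 𝒜] {d : A[X]} (hd : HMonic 𝒜 x d) {c : P} {g : A[X]}
    (hg : g ∈ polyGr 𝒜 x c) : g %ₘ d ∈ polyGr 𝒜 x c := by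
  cases subsingleton_or_nontrivial A
  · rw [Subsingleton.elim (g %ₘ d) 0]; exact zero_mem _
  obtain ⟨q, hq, r, hr, h1, h2⟩ := exists_div hd g hg
  rwa [(div_modByMonic_unique q r hd.1 ⟨h1, h2⟩).2]

theorem HMonic.mul [SetLike.GradedMonoid 𝒜] {d d' : A[X]} (hd : HMonic 𝒜 x d)
    (hd' : HMonic 𝒜 x d') : HMonic 𝒜 x (d * d') :=
  ⟨hd.1.mul hd'.1, mul_mem_of_eq hd.2 hd'.2 (by rw [hd.1.natDegree_mul hd'.1, add_smul])⟩

theorem HMonic.X [SetLike.GradedMonoid 𝒜] [Nontrivial A] : HMonic 𝒜 x (X : A[X]) :=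
  ⟨monic_X, by simpa using X_pow_mem (𝒜 := 𝒜) (x := x) 1⟩

theorem HMonic.one [SetLike.GradedMonoid 𝒜] : HMonic 𝒜 x (1 : A[X]) :=
  ⟨monic_one, by simpa using SetLike.one_mem_graded (polyGr 𝒜 x)⟩

theorem HMonic.X_pow [SetLike.GradedMonoid 𝒜] [Nontrivial A] (n : ℕ) :
    HMonic 𝒜 x (Polynomial.X ^ n : A[X]) :=
  ⟨monic_X_pow n, by simpa using X_pow_mem (𝒜 := 𝒜) (x := x) n⟩

end PolyGrading

section Local

variable {P A : Type*} [AddCommGroup P] [CommRing A]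

/-- Homogeneous elements outside of the proper ideal `𝔍` are invertible, with homogeneous
inverse. -/
structure IsGradedLocal (𝒜 : P → AddSubgroup A) (𝔍 : Ideal A) : Prop where
  ne_top : 𝔍 ≠ ⊤
  exists_inv : ∀ c, ∀ a ∈ 𝒜 c, a ∉ 𝔍 → ∃ b ∈ 𝒜 (-c), a * b = 1

/-- Reduction of polynomials modulo an ideal of the coefficient ring. -/
noncomputable abbrev red (𝔍 : Ideal A) : A[X] →+* (A ⧸ 𝔍)[X] := mapRingHom (Ideal.Quotient.mk 𝔍)

variable {𝒜 : P → AddSubgroup A} {x : P} {𝔍 : Ideal A}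

theorem red_coeff (f : A[X]) (n : ℕ) : (red 𝔍 f).coeff n = Ideal.Quotient.mk 𝔍 (f.coeff n) := by
  simp [red]

theorem Monic.red {d : A[X]} (hd : d.Monic) : (red 𝔍 d).Monic := hd.map _

theorem IsGradedLocal.exists_monic [SetLike.GradedMonoid 𝒜] (h : IsGradedLocal 𝒜 𝔍) {c : P}
    {g : A[X]} (hg : g ∈ polyGr 𝒜 x c) (h0 : red 𝔍 g ≠ 0) :
    ∃ b ∈ 𝒜 ((red 𝔍 g).natDegree • x - c), ∃ d, HMonic 𝒜 x d ∧
      d.natDegree = (red 𝔍 g).natDegree ∧ red 𝔍 d = red 𝔍 (C b * g) := by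
  have := Ideal.Quotient.nontrivial_iff.mpr h.ne_top
  have : Nontrivial A := (Ideal.Quotient.mk 𝔍).domain_nontrivial
  set N := (red 𝔍 g).natDegree with hN
  have hlead : g.coeff N ∉ 𝔍 := fun hmem => by
    have : (red 𝔍 g).leadingCoeff = 0 := by
      rw [Polynomial.leadingCoeff, ← hN, red_coeff]
      exact Ideal.Quotient.eq_zero_iff_mem.mpr hmem
    exact h0 (leadingCoeff_eq_zero.mp this)
  obtain ⟨b, hb, hb1⟩ := h.exists_inv _ _ (hg N) hlead
  have hcoeff : ∀ n, (∑ k ∈ Finset.range (N + 1), monomial k (b * g.coeff k)).coeff n =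
      if n ≤ N then b * g.coeff n else 0 := fun n => by
    simp only [finsetSum_coeff, coeff_monomial]
    rw [Finset.sum_ite_eq' (Finset.range (N + 1)) n (fun k => b * g.coeff k)]
    simp
  set d := ∑ k ∈ Finset.range (N + 1), monomial k (b * g.coeff k) with hd
  have hdN : d.natDegree ≤ N := by
    rw [natDegree_le_iff_coeff_eq_zero]
    intro n hn
    rw [hcoeff, if_neg (by lia)]
  have hdN1 : d.coeff N = 1 := by rw [hcoeff, if_pos le_rfl, mul_comm, hb1]
  have hdm : d.Monic := monic_of_natDegree_le_of_coeff_eq_one N hdN hdN1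
  have hdN' : d.natDegree = N := natDegree_eq_of_le_of_coeff_ne_zero hdN (by simp [hdN1])
  refine ⟨b, mem_of_eq hb (by abel), d, ⟨hdm, ?_⟩, hdN', ?_⟩
  · rw [hdN']
    intro n
    rw [hcoeff]
    split_ifs
    · exact mul_mem_of_eq hb (hg n) (by abel)
    · exact zero_mem _
  · ext n
    rw [red_coeff, red_coeff, hcoeff, coeff_C_mul]
    split_ifs with hn
    · rfl
    · have : (red 𝔍 g).coeff n = 0 := coeff_eq_zero_of_natDegree_lt (by lia)
      rw [red_coeff] at this
      rw [map_mul, this, map_zero, mul_zero]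

theorem IsGradedLocal.exists_gcd [SetLike.GradedMonoid 𝒜] (h : IsGradedLocal 𝒜 𝔍) {ι : Type*}
    [Fintype ι] {p : ι → P} {w : P} {y : ι → A[X]} (hy : ∀ i, y i ∈ polyGr 𝒜 x (p i - w))
    (hy0 : ∃ i, red 𝔍 (y i) ≠ 0) :
    ∃ (d : A[X]) (a z : ι → A[X]), HMonic 𝒜 x d ∧
      (∀ i, a i ∈ polyGr 𝒜 x (w + d.natDegree • x - p i)) ∧
      (∀ i, z i ∈ polyGr 𝒜 x (p i - (w + d.natDegree • x))) ∧
      red 𝔍 (∑ i, a i * y i) = red 𝔍 d ∧ ∀ i, red 𝔍 (y i) = red 𝔍 (z i * d) := by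
  classical
  have := Ideal.Quotient.nontrivial_iff.mpr h.ne_top
  have : Nontrivial A := (Ideal.Quotient.mk 𝔍).domain_nontrivial
  let good : ℕ → Prop := fun N => ∃ (d : A[X]) (a : ι → A[X]), d.natDegree = N ∧ HMonic 𝒜 x d ∧
      (∀ i, a i ∈ polyGr 𝒜 x (w + d.natDegree • x - p i)) ∧
      red 𝔍 (∑ i, a i * y i) = red 𝔍 d
  have key : ∀ (c : P) (g : A[X]) (a : ι → A[X]), g ∈ polyGr 𝒜 x c →
      (∀ i, a i ∈ polyGr 𝒜 x (c - (p i - w))) → red 𝔍 (∑ i, a i * y i) = red 𝔍 g →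
      red 𝔍 g ≠ 0 → good (red 𝔍 g).natDegree := by
    intro c g a hg ha hag hg0
    obtain ⟨b, hb, d, hd, hdN, hdb⟩ := h.exists_monic hg hg0
    refine ⟨d, fun i => C b * a i, hdN, hd, fun i => ?_, ?_⟩
    · exact mul_mem_of_eq (C_mem hb) (ha i) (by rw [hdN]; abel)
    · rw [hdb, map_mul, ← hag, ← map_mul, Finset.mul_sum]
      simp only [mul_assoc]
  have hex : ∃ N, good N := by
    obtain ⟨i, hi⟩ := hy0
    refine ⟨_, key _ (y i) (Pi.single i 1) (hy i) (fun j => ?_) ?_ hi⟩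
    · by_cases hj : j = i
      · subst hj; simpa using SetLike.one_mem_graded (polyGr 𝒜 x)
      · simp [hj]
    · simp [Pi.single_apply]
  obtain ⟨d, a, hdN, hd, ha, had⟩ := Nat.find_spec hex
  refine ⟨d, a, fun i => y i /ₘ d, hd, ha, fun i => ?_, had, fun i => ?_⟩
  · exact mem_of_eq (divByMonic_mem hd (hy i)) (by abel)
  · have hdiv := modByMonic_add_div (y i) d
    suffices hr : red 𝔍 (y i %ₘ d) = 0 by
      rw [← hdiv, map_add, hr, zero_add, mul_comm]
    by_contra hr
    have hgood := key (p i - w) (y i %ₘ d) (fun j => (Pi.single i 1 : ι → A[X]) j - (y i /ₘ d) * a j)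
      (modByMonic_mem hd (hy i)) (fun j => ?_) ?_ hr
    · refine Nat.find_min hex ?_ hgood
      rw [← hdN]
      refine natDegree_lt_natDegree hr ?_
      have h1 : (red 𝔍 (y i %ₘ d)).degree ≤ (y i %ₘ d).degree := degree_map_le
      have := h1.trans_lt (degree_modByMonic_lt (y i) hd.1)
      exact this
    · refine sub_mem ?_ (mul_mem_of_eq (divByMonic_mem hd (hy i)) (ha j) (by abel))
      by_cases hj : j = i
      · subst hj; simpa using SetLike.one_mem_graded (polyGr 𝒜 x)
      · simp [hj]
    · have : ∑ j, ((Pi.single i 1 : ι → A[X]) j - y i /ₘ d * a j) * y j =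
          y i - y i /ₘ d * ∑ j, a j * y j := by
        simp only [sub_mul, Finset.sum_sub_distrib, Finset.mul_sum, mul_assoc]
        simp [Pi.single_apply]
      rw [this, map_sub, map_mul, had, ← map_mul, ← map_sub, mul_comm,
        ← modByMonic_eq_sub_mul_div]

end Local

section Hermite

variable {P A : Type*} [AddCommGroup P] [CommRing A]

theorem smul_left_cancel_of_monic {ι κ : Type*} {f : A[X]} (hf : f.Monic) {M N : Matrix ι κ A[X]}
    (h : f • M = f • N) : M = N := by
  ext1 i j
  have := congrFun (congrFun h i) j
  simp only [Matrix.smul_apply, smul_eq_mul] at this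
  exact hf.isRegular.left this

theorem map_smul_matrix {B ι κ : Type*} [CommRing B] (φ : A →+* B) (c : A) (M : Matrix ι κ A) :
    (c • M).map φ = φ c • M.map φ := by
  ext i j
  simp

variable {𝒜 : P → AddSubgroup A} {x : P} {𝔍 : Ideal A}

variable (𝒜 x 𝔍) in
/-- Existence of a graded Hermite decomposition `U ≡ u T` with `u` left invertible modulo `𝔍` and
`T` square dividing a homogeneous monic polynomial. -/
def HasHermite {ι : Type*} [Fintype ι] (p : ι → P) (κ : Type*) [Fintype κ] [DecidableEq κ] :
    Prop :=
  ∀ (w : κ → P) (U : Matrix ι κ A[X]) (V : Matrix κ ι (A ⧸ 𝔍)[X]) (f : (A ⧸ 𝔍)[X]),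
    IsHom (polyGr 𝒜 x) p w U → f.Monic → V * U.map (red 𝔍) = f • 1 →
    ∃ (w' : κ → P) (u : Matrix ι κ A[X]) (v : Matrix κ ι A[X]) (T T' : Matrix κ κ A[X]) (G : A[X]),
      IsHom (polyGr 𝒜 x) p w' u ∧ IsHom (polyGr 𝒜 x) w' p v ∧ IsHom (polyGr 𝒜 x) w' w T ∧
      IsHom (polyGr 𝒜 x) (fun i => w i + G.natDegree • x) w' T' ∧ HMonic 𝒜 x G ∧
      v.map (red 𝔍) * u.map (red 𝔍) = 1 ∧ U.map (red 𝔍) = u.map (red 𝔍) * T.map (red 𝔍) ∧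
      T * T' = G • 1 ∧ T' * T = G • 1

variable {ι : Type*} [Fintype ι] {p : ι → P}

theorem HasHermite.of_isEmpty [SetLike.GradedMonoid 𝒜] {κ : Type*} [Fintype κ] [DecidableEq κ]
    [IsEmpty κ] : HasHermite 𝒜 x 𝔍 p κ := fun w U V f hU hf hVU =>
  ⟨w, U, 0, 0, 0, 1, hU, fun i => isEmptyElim i, fun i => isEmptyElim i, fun i => isEmptyElim i,
    HMonic.one, by ext i; exact isEmptyElim i, by ext i j; exact isEmptyElim j,
    by ext i; exact isEmptyElim i, by ext i; exact isEmptyElim i⟩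

theorem HasHermite.of_equiv {κ κ' : Type*} [Fintype κ] [DecidableEq κ]
    [Fintype κ'] [DecidableEq κ'] (E : κ ≃ κ') (h : HasHermite 𝒜 x 𝔍 p κ) :
    HasHermite 𝒜 x 𝔍 p κ' := by
  intro w U V f hU hf hVU
  obtain ⟨w', u, v, T, T', G, hu, hv, hT, hT', hG, h1, h2, h3, h4⟩ :=
    h (w ∘ E) (U.submatrix id E) (V.submatrix E id) f (fun i j => hU _ _) hf (by
      rw [← Matrix.submatrix_map, ← Matrix.submatrix_mul _ _ _ _ _ Function.bijective_id, hVU]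
      ext i j
      simp [Matrix.one_apply])
  refine ⟨w' ∘ E.symm, u.submatrix id E.symm, v.submatrix E.symm id, T.submatrix E.symm E.symm,
    T'.submatrix E.symm E.symm, G, fun i j => hu _ _, fun i j => hv _ _,
    fun i j => by simpa using hT (E.symm i) (E.symm j),
    fun i j => by simpa using hT' (E.symm i) (E.symm j), hG, ?_, ?_, ?_, ?_⟩
  · rw [← Matrix.submatrix_map, ← Matrix.submatrix_map,
      ← Matrix.submatrix_mul _ _ _ _ _ Function.bijective_id, h1, Matrix.submatrix_one_equiv]
  · rw [← Matrix.submatrix_map, ← Matrix.submatrix_map, Matrix.submatrix_mul_equiv, ← h2]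
    ext i j
    simp
  · rw [Matrix.submatrix_mul_equiv, h3]
    ext i j
    simp [Matrix.one_apply]
  · rw [Matrix.submatrix_mul_equiv, h4]
    ext i j
    simp [Matrix.one_apply]

theorem HasHermite.step [SetLike.GradedMonoid 𝒜] (hloc : IsGradedLocal 𝒜 𝔍) {κ : Type*} [Fintype κ]
    [DecidableEq κ] (h : HasHermite 𝒜 x 𝔍 p κ) : HasHermite 𝒜 x 𝔍 p (Fin 1 ⊕ κ) := by
  classical
  have := Ideal.Quotient.nontrivial_iff.mpr hloc.ne_top
  intro w U V f hU hf hVU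
  obtain ⟨y, Ur, rfl⟩ : ∃ y Ur, U = fromCols y Ur := ⟨_, _, (fromCols_toCols U).symm⟩
  obtain ⟨V1, V2, rfl⟩ : ∃ y Ur, V = fromRows y Ur := ⟨_, _, (fromRows_toRows V).symm⟩
  set w0 := w (Sum.inl 0) with hw0
  have hy : ∀ i, y i 0 ∈ polyGr 𝒜 x (p i - w0) := fun i => hU i (Sum.inl 0)
  have hUr : IsHom (polyGr 𝒜 x) p (w ∘ Sum.inr) Ur := fun i j => hU i (Sum.inr j)
  have hmapU : (fromCols y Ur).map (red 𝔍) = fromCols (y.map (red 𝔍)) (Ur.map (red 𝔍)) := by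
    ext i (j | j) <;> rfl
  rw [hmapU, fromRows_mul_fromCols, ← fromBlocks_one, fromBlocks_smul, fromBlocks_inj] at hVU
  obtain ⟨hV1y, -, hV2y, hV2U⟩ := hVU
  have hy0 : ∃ i, red 𝔍 (y i 0) ≠ 0 := by
    by_contra hcon
    push Not at hcon
    have : y.map (red 𝔍) = 0 := by
      ext1 i j
      rw [Subsingleton.elim j 0]
      exact hcon i
    rw [this, Matrix.mul_zero] at hV1y
    have := congrFun (congrFun hV1y 0) 0
    simp only [Matrix.zero_apply, Matrix.smul_apply, Matrix.one_apply_eq, smul_eq_mul,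
      mul_one] at this
    exact hf.ne_zero this.symm
  obtain ⟨d, a', z', hd, ha', hz', had', hyz'⟩ := hloc.exists_gcd hy hy0
  set N := d.natDegree
  let a : Matrix (Fin 1) ι A[X] := of fun _ j => a' j
  let z : Matrix ι (Fin 1) A[X] := of fun i _ => z' i
  have ha : IsHom (polyGr 𝒜 x) (fun _ => w0 + N • x) p a := fun _ j => ha' j
  have hz : IsHom (polyGr 𝒜 x) p (fun _ => w0 + N • x) z := fun i _ => hz' i
  have had : a.map (red 𝔍) * y.map (red 𝔍) = red 𝔍 d • 1 := by
    ext1 i j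
    rw [Subsingleton.elim i 0, Subsingleton.elim j 0, Matrix.mul_apply]
    simpa [a] using had'
  have hyz : y.map (red 𝔍) = red 𝔍 d • z.map (red 𝔍) := by
    ext1 i j
    rw [Subsingleton.elim j 0]
    simpa [z, mul_comm] using hyz' i
  have hdm : (red 𝔍 d).Monic := Monic.red hd.1
  have haz : a.map (red 𝔍) * z.map (red 𝔍) = 1 := by
    refine smul_left_cancel_of_monic hdm ?_
    rw [← had, hyz, Matrix.mul_smul]
  have hV2z : V2 * z.map (red 𝔍) = 0 := by
    refine smul_left_cancel_of_monic hdm ?_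
    rw [← Matrix.mul_smul, ← hyz, hV2y, smul_zero, smul_zero]
  set az : Matrix ι ι A[X] := 1 - z * a with haz_def
  have hazH : IsHom (polyGr 𝒜 x) p p az := IsHom.one.sub (hz.mul ha)
  have hazmap : az.map (red 𝔍) = 1 - z.map (red 𝔍) * a.map (red 𝔍) := by
    rw [haz_def, Matrix.map_sub _ (map_sub _), Matrix.map_mul,
      Matrix.map_one _ (map_zero _) (map_one _)]
  have haaz : a.map (red 𝔍) * az.map (red 𝔍) = 0 := by
    rw [hazmap, Matrix.mul_sub, ← Matrix.mul_assoc, haz]; simp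
  have hazz : az.map (red 𝔍) * z.map (red 𝔍) = 0 := by
    rw [hazmap, Matrix.sub_mul, Matrix.mul_assoc, haz]; simp
  obtain ⟨w', u', v', T, T', G, hu', hv', hT, hT', hG, h1, h2, h3, h4⟩ :=
    h (w ∘ Sum.inr) (az * Ur) V2 f (hazH.mul hUr) hf (by
      rw [Matrix.map_mul, hazmap, Matrix.sub_mul, Matrix.mul_sub, Matrix.one_mul, hV2U,
        Matrix.mul_assoc (z.map _), ← Matrix.mul_assoc V2, hV2z]; simp)
  rw [Matrix.map_mul] at h2
  have hmapu' : a.map (red 𝔍) * u'.map (red 𝔍) = 0 := by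
    refine smul_left_cancel_of_monic (Monic.red hG.1 : (red 𝔍 G).Monic) ?_
    have h3' : T.map (red 𝔍) * T'.map (red 𝔍) = red 𝔍 G • 1 := by
      rw [← Matrix.map_mul, h3, map_smul_matrix, Matrix.map_one _ (map_zero _) (map_one _)]
    rw [smul_zero, ← Matrix.mul_one (a.map _ * u'.map _), ← Matrix.mul_smul, ← h3',
      Matrix.mul_assoc, ← Matrix.mul_assoc (u'.map _), ← h2, ← Matrix.mul_assoc,
      ← Matrix.mul_assoc, haaz]
    simp
  have hmapu : (fromCols z u').map (red 𝔍) = fromCols (z.map (red 𝔍)) (u'.map (red 𝔍)) := by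
    ext i (j | j) <;> rfl
  have hdG : (d * G).natDegree = N + G.natDegree := hd.1.natDegree_mul hG.1
  refine ⟨Sum.elim (fun _ => w0 + N • x) w', fromCols z u', fromRows a (v' * az),
    fromBlocks (d • 1) (a * Ur) 0 T, fromBlocks (G • 1) (-(a * Ur * T')) 0 (d • T'), d * G,
    ?_, ?_, ?_, ?_, hd.mul hG, ?_, ?_, ?_, ?_⟩
  · rintro i (j | j)
    · exact hz i j
    · exact hu' i j
  · rintro (i | i) j
    · exact ha i j
    · exact hv'.mul hazH i j
  · rintro (i | i) (j | j)
    · rw [Subsingleton.elim i 0, Subsingleton.elim j 0]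
      simpa [← hw0] using hd.2
    · exact ha.mul hUr i j
    · exact zero_mem _
    · exact hT i j
  · rintro (i | i) (j | j)
    · rw [Subsingleton.elim i 0, Subsingleton.elim j 0]
      simp only [fromBlocks_apply₁₁, Matrix.smul_apply, Matrix.one_apply_eq, smul_eq_mul, mul_one,
        Sum.elim_inl, ← hw0]
      exact mem_of_eq hG.2 (by rw [hdG, add_smul]; abel)
    · rw [Subsingleton.elim i 0]
      have := (((ha.mul hUr).congr_weights (p' := fun _ => w0 + (d * G).natDegree • x)
        (q' := fun i => (w ∘ Sum.inr) i + G.natDegree • x) (fun i j => by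
          rw [hdG, add_smul]; abel)).mul hT').neg 0 j
      exact this
    · exact zero_mem _
    · refine mul_mem_of_eq hd.2 (hT' i j) ?_
      simp only [Function.comp, Sum.elim_inr, hdG, add_smul]
      abel
  · have hmapv : (fromRows a (v' * az)).map (red 𝔍) =
        fromRows (a.map (red 𝔍)) (v'.map (red 𝔍) * az.map (red 𝔍)) := by
      rw [← Matrix.map_mul]; ext (j | j) i <;> rfl
    rw [hmapu, hmapv, fromRows_mul_fromCols, haz, hmapu', Matrix.mul_assoc, hazz, Matrix.mul_zero,
      Matrix.mul_assoc, hazmap, Matrix.sub_mul, Matrix.one_mul, Matrix.mul_assoc (z.map _),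
      hmapu', Matrix.mul_zero, sub_zero, h1, fromBlocks_one]
  · have hmapT : (fromBlocks (d • (1 : Matrix (Fin 1) (Fin 1) A[X])) (a * Ur) 0 T).map (red 𝔍) =
        fromBlocks (red 𝔍 d • 1) (a.map (red 𝔍) * Ur.map (red 𝔍)) 0 (T.map (red 𝔍)) := by
      rw [fromBlocks_map, map_smul_matrix, Matrix.map_one _ (map_zero _) (map_one _),
        Matrix.map_mul, Matrix.map_zero _ (map_zero _)]
    rw [hmapU, hmapu, hmapT, fromCols_mul_fromBlocks, ← h2, hazmap, Matrix.sub_mul,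
      Matrix.mul_smul, Matrix.mul_one, ← hyz, Matrix.mul_assoc]
    simp
  · rw [fromBlocks_multiply, ← fromBlocks_one, fromBlocks_smul, fromBlocks_inj]
    refine ⟨by simp [mul_smul, smul_comm G d], ?_, by simp, ?_⟩
    · simp
    · simp [h3, mul_smul]
  · rw [fromBlocks_multiply, ← fromBlocks_one, fromBlocks_smul, fromBlocks_inj]
    refine ⟨by simp [mul_smul], ?_, by simp, ?_⟩
    · rw [Matrix.neg_mul, Matrix.mul_assoc, h4]
      simp
    · simp [h4, mul_smul]

theorem hasHermite [SetLike.GradedMonoid 𝒜] (hloc : IsGradedLocal 𝒜 𝔍) (n : ℕ) :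
    HasHermite 𝒜 x 𝔍 p (Fin n) := by
  induction n with
  | zero => exact HasHermite.of_isEmpty
  | succ n ih => exact (ih.step hloc).of_equiv ((Equiv.sumComm _ _).trans finSumFinEquiv)

end Hermite

section Nakayama

variable {P A : Type*} [AddCommGroup P] [CommRing A] {𝒜 : P → AddSubgroup A} {x : P} {𝔍 : Ideal A}

theorem IsGradedLocal.exists_add_apply_eq [SetLike.GradedMonoid 𝒜] (hloc : IsGradedLocal 𝒜 𝔍)
    {κ : Type*} [Fintype κ] [DecidableEq κ] {ω : κ → P} {m : ℕ}
    (Ψ : (κ → A[X]) →ₗ[A] (κ → A[X]))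
    (hΨ : ∀ c S, (∀ i, S i ∈ polyGr 𝒜 x (ω i - c)) → ∀ i, Ψ S i ∈ polyGr 𝒜 x (ω i - c))
    (hred : ∀ S i, red 𝔍 (Ψ S i) = 0) (hdeg : ∀ S i, (Ψ S i).degree < m) {c : P} {η : κ → A[X]}
    (hη : ∀ i, η i ∈ polyGr 𝒜 x (ω i - c)) (hηd : ∀ i, (η i).degree < m) :
    ∃ S : κ → A[X], (∀ i, S i ∈ polyGr 𝒜 x (ω i - c)) ∧ (∀ i, red 𝔍 (S i) = red 𝔍 (η i)) ∧
      S + Ψ S = η := by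
  have := Ideal.Quotient.nontrivial_iff.mpr hloc.ne_top
  let E : κ × Fin m → κ → A[X] := fun b => Pi.single b.1 (monomial (b.2 : ℕ) 1)
  let Ω : κ × Fin m → P := fun b => ω b.1 - (b.2 : ℕ) • x
  let N : Matrix (κ × Fin m) (κ × Fin m) A := of fun a b => (Ψ (E b) a.1).coeff a.2
  have hE : ∀ b i, E b i ∈ polyGr 𝒜 x (ω i - Ω b) := fun b i => by
    by_cases hi : i = b.1
    · subst hi
      simp only [E, Pi.single_eq_same]
      exact monomial_mem _ (SetLike.one_mem_graded 𝒜) (by simp only [Ω]; abel)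
    · simp [E, hi]
  have hN : IsHom 𝒜 Ω Ω N := fun a b => mem_of_eq (hΨ _ _ (hE b) a.1 a.2) (by
    simp only [Ω]; abel)
  have hNJ : N.map (Ideal.Quotient.mk 𝔍) = 0 := by
    ext a b
    have := congrArg (fun f => f.coeff a.2) (hred (E b) a.1)
    simp only [red_coeff, coeff_zero] at this
    exact this
  have h1N : IsHom 𝒜 Ω Ω (1 + N) := IsHom.one.add hN
  have hdet0 : (1 + N).det ∈ 𝒜 0 := by simpa using h1N.det
  have hdet1 : Ideal.Quotient.mk 𝔍 (1 + N).det = 1 := by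
    rw [RingHom.map_det, map_add, RingHom.mapMatrix_apply, RingHom.mapMatrix_apply, hNJ, add_zero,
      Matrix.map_one _ (map_zero _) (map_one _), det_one]
  obtain ⟨b, hb, hb1⟩ := hloc.exists_inv 0 _ hdet0 (fun hmem => by
    rw [Ideal.Quotient.eq_zero_iff_mem.mpr hmem] at hdet1
    exact zero_ne_one hdet1)
  rw [neg_zero] at hb
  let s : κ × Fin m → A := b • ((1 + N).adjugate *ᵥ fun a => (η a.1).coeff a.2)
  have hs : (1 + N) *ᵥ s = fun a => (η a.1).coeff a.2 := by
    simp only [s]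
    rw [mulVec_smul, mulVec_mulVec, mul_adjugate, smul_mulVec, one_mulVec, smul_smul, mul_comm,
      hb1, one_smul]
  have hsmem : ∀ a, s a ∈ 𝒜 (Ω a - c) := fun a => by
    refine mul_mem_of_eq hb (sum_mem fun d _ => mul_mem_of_eq (h1N.adjugate a d) (hη _ _) ?_)
      (zero_add _)
    simp only [Ω]
    abel
  let S : κ → A[X] := ∑ a, s a • E a
  have hScoeff : ∀ i k (hk : k < m), (S i).coeff k = s (i, ⟨k, hk⟩) := fun i k hk => by
    simp only [S, Finset.sum_apply, Pi.smul_apply, finsetSum_coeff, coeff_smul]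
    rw [Finset.sum_eq_single (i, ⟨k, hk⟩)]
    · simp [E]
    · rintro ⟨i', k'⟩ - hne
      simp only [E, Pi.single_apply]
      split_ifs with h
      · rw [coeff_monomial, if_neg, smul_zero]
        rintro rfl
        exact hne (by rw [h])
      · simp
    · simp
  have hSdeg : ∀ i, (S i).degree < m := fun i => by
    rw [← mem_degreeLT]
    simp only [S, Finset.sum_apply, Pi.smul_apply]
    refine sum_mem fun a _ => Submodule.smul_mem _ _ ?_
    simp only [E, Pi.single_apply]
    split_ifs
    · rw [mem_degreeLT]
      exact (degree_monomial_le _ _).trans_lt (by exact_mod_cast a.2.2)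
    · exact zero_mem _
  have hΨS : Ψ S = ∑ a, s a • Ψ (E a) := by simp [S]
  have heq : S + Ψ S = η := by
    ext i k
    by_cases hk : k < m
    · have := congrFun hs (i, ⟨k, hk⟩)
      rw [add_mulVec, one_mulVec] at this
      simp only [Pi.add_apply] at this
      rw [← this, Pi.add_apply, coeff_add, hScoeff i k hk, hΨS]
      congr 1
      simp only [Finset.sum_apply, Pi.smul_apply, finsetSum_coeff, coeff_smul, mulVec, dotProduct,
        smul_eq_mul, N, of_apply]
      exact Finset.sum_congr rfl fun _ _ => mul_comm _ _
    · have hmk : (m : WithBot ℕ) ≤ k := by exact_mod_cast not_lt.mp hk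
      rw [Pi.add_apply, coeff_add, coeff_eq_zero_of_degree_lt ((hSdeg i).trans_le hmk),
        coeff_eq_zero_of_degree_lt ((hdeg S i).trans_le hmk),
        coeff_eq_zero_of_degree_lt ((hηd i).trans_le hmk), add_zero]
  refine ⟨S, fun i => ?_, fun i => ?_, heq⟩
  · simp only [S, Finset.sum_apply, Pi.smul_apply, smul_eq_C_mul]
    exact sum_mem fun a _ => mul_mem_of_eq (C_mem (hsmem a)) (hE a i) (by abel)
  · rw [← heq, Pi.add_apply, map_add, hred, add_zero]

theorem IsGradedLocal.exists_matrix_add_apply_eq_one [SetLike.GradedMonoid 𝒜]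
    (hloc : IsGradedLocal 𝒜 𝔍)
    {κ : Type*} [Fintype κ] [DecidableEq κ] {ω : κ → P} {m : ℕ} (hm : 0 < m)
    (Ψ : (κ → A[X]) →ₗ[A] (κ → A[X]))
    (hΨ : ∀ c S, (∀ i, S i ∈ polyGr 𝒜 x (ω i - c)) → ∀ i, Ψ S i ∈ polyGr 𝒜 x (ω i - c))
    (hred : ∀ S i, red 𝔍 (Ψ S i) = 0) (hdeg : ∀ S i, (Ψ S i).degree < m) :
    ∃ S : Matrix κ κ A[X], IsHom (polyGr 𝒜 x) ω ω S ∧ S.map (red 𝔍) = 1 ∧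
      ∀ i j, S i j + Ψ (fun k => S k j) i = (1 : Matrix κ κ A[X]) i j := by
  have h1 : IsHom (polyGr 𝒜 x) ω ω (1 : Matrix κ κ A[X]) := IsHom.one
  have := fun j => hloc.exists_add_apply_eq Ψ hΨ hred hdeg (c := ω j)
    (η := fun i => (1 : Matrix κ κ A[X]) i j) (fun i => h1 i j) (fun i => by
      rw [Matrix.one_apply]
      have h0 : (0 : WithBot ℕ) < m := by exact_mod_cast hm
      split_ifs
      · exact degree_one_le.trans_lt h0
      · rw [degree_zero]; exact bot_lt_iff_ne_bot.mpr (by simp))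
  choose S hS hSred hSeq using this
  refine ⟨of fun i j => S j i, fun i j => hS j i, ?_, fun i j => congrFun (hSeq j) i⟩
  ext1 i j
  have := hSred j i
  rw [Matrix.map_apply, of_apply, this, Matrix.one_apply, Matrix.one_apply]
  split_ifs <;> simp

end Nakayama

section Horrocks

variable {P A : Type*} [AddCommGroup P] [CommRing A] {𝒜 : P → AddSubgroup A} {x : P} {𝔍 : Ideal A}

theorem add_divByMonic (f g d : A[X]) : (f + g) /ₘ d = f /ₘ d + g /ₘ d := by
  by_cases hd : d.Monic
  · nontriviality A
    refine (div_modByMonic_unique _ (f %ₘ d + g %ₘ d) hd ⟨?_, ?_⟩).1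
    · conv_rhs => rw [← modByMonic_add_div f d, ← modByMonic_add_div g d]
      ring
    · exact (degree_add_le _ _).trans_lt
        (max_lt (degree_modByMonic_lt f hd) (degree_modByMonic_lt g hd))
  · simp [divByMonic_eq_of_not_monic _ hd]

theorem smul_divByMonic (c : A) (f d : A[X]) : (c • f) /ₘ d = c • (f /ₘ d) := by
  by_cases hd : d.Monic
  · nontriviality A
    refine (div_modByMonic_unique _ (c • (f %ₘ d)) hd ⟨?_, ?_⟩).1
    · conv_rhs => rw [← modByMonic_add_div f d]
      rw [smul_add, mul_smul_comm]
    · exact (degree_smul_le _ _).trans_lt (degree_modByMonic_lt f hd)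
  · simp [divByMonic_eq_of_not_monic _ hd]

/-- Division by `d` as a linear map. -/
noncomputable def divLin (d : A[X]) : A[X] →ₗ[A] A[X] where
  toFun f := f /ₘ d
  map_add' f g := add_divByMonic f g d
  map_smul' c f := smul_divByMonic c f d

theorem red_divByMonic {d g : A[X]} (hd : d.Monic) (hg : red 𝔍 g = 0) : red 𝔍 (g /ₘ d) = 0 := by
  have := map_divByMonic (p := g) (Ideal.Quotient.mk 𝔍) hd
  change red 𝔍 (g /ₘ d) = red 𝔍 g /ₘ _ at this
  rw [this, hg, zero_divByMonic]

theorem red_modByMonic {d g : A[X]} (hd : d.Monic) (hg : red 𝔍 g = 0) : red 𝔍 (g %ₘ d) = 0 := by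
  have := map_modByMonic (p := g) (Ideal.Quotient.mk 𝔍) hd
  change red 𝔍 (g %ₘ d) = red 𝔍 g %ₘ _ at this
  rw [this, hg, zero_modByMonic]

theorem monic_det_of_degree_lt [Nontrivial A] {κ : Type*} [Fintype κ] [DecidableEq κ] {f : A[X]}
    (hf : f.Monic) {M : Matrix κ κ A[X]} (hM : ∀ i j, (M i j).degree < f.degree) :
    (f • 1 + M).det.Monic ∧ (f • 1 + M).det.natDegree = Fintype.card κ * f.natDegree := by
  have hent : ∀ i j, ((f • 1 + M : Matrix κ κ A[X]) i j).natDegree ≤ f.natDegree := fun i j => by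
    refine natDegree_le_natDegree ?_
    rw [Matrix.add_apply, Matrix.smul_apply, Matrix.one_apply]
    refine (degree_add_le _ _).trans (max_le ?_ (hM i j).le)
    split_ifs <;> simp
  have hcoeff : ∀ i j, ((f • 1 + M : Matrix κ κ A[X]) i j).coeff f.natDegree =
      (1 : Matrix κ κ A) i j := fun i j => by
    rw [Matrix.add_apply, coeff_add, Matrix.smul_apply, Matrix.one_apply, Matrix.one_apply,
      coeff_eq_zero_of_degree_lt (p := M i j), add_zero]
    · split_ifs
      · simp [hf.coeff_natDegree]
      · simp
    · rw [← degree_eq_natDegree hf.ne_zero]; exact hM i j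
  have hle : (f • 1 + M).det.natDegree ≤ Fintype.card κ * f.natDegree := by
    rw [det_apply]
    refine natDegree_sum_le_of_forall_le _ _ fun σ _ => ?_
    refine (natDegree_smul_le _ _).trans ((natDegree_prod_le _ _).trans ?_)
    refine (Finset.sum_le_card_nsmul _ _ _ fun i _ => hent _ _).trans ?_
    simp
  have hc : (f • 1 + M).det.coeff (Fintype.card κ * f.natDegree) = 1 := by
    rw [det_apply, finsetSum_coeff]
    rw [← det_one (n := κ) (R := A), det_apply]
    refine Finset.sum_congr rfl fun σ _ => ?_
    have : (∏ i, (f • 1 + M : Matrix κ κ A[X]) (σ i) i).coeff (Fintype.card κ * f.natDegree) =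
        ∏ i, (1 : Matrix κ κ A) (σ i) i := by
      have := coeff_prod_of_natDegree_le Finset.univ
        (fun i => (f • 1 + M : Matrix κ κ A[X]) (σ i) i) f.natDegree (fun i _ => hent _ _)
      rw [Finset.card_univ] at this
      rw [this]
      exact Finset.prod_congr rfl fun i _ => hcoeff _ _
    rcases Int.units_eq_one_or (Equiv.Perm.sign σ) with hs | hs
    · rw [hs, one_smul, one_smul, this]
    · rw [hs, Units.neg_smul, one_smul, Units.neg_smul, one_smul, coeff_neg, this]
  exact ⟨monic_of_natDegree_le_of_coeff_eq_one _ hle hc,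
    natDegree_eq_of_le_of_coeff_ne_zero hle (by simp [hc])⟩

theorem IsHom.mulVec [SetLike.GradedMonoid 𝒜] {ι κ : Type*} [Fintype κ] {p : ι → P} {q : κ → P}
    {M : Matrix ι κ A} (hM : IsHom 𝒜 p q M) {c : P} {S : κ → A} (hS : ∀ k, S k ∈ 𝒜 (q k - c))
    (i : ι) : (M *ᵥ S) i ∈ 𝒜 (p i - c) :=
  sum_mem fun k _ => mul_mem_of_eq (hM i k) (hS k) (by abel)

theorem red_mulVec {ι κ : Type*} [Fintype κ] {M : Matrix ι κ A[X]} (hM : M.map (red 𝔍) = 0)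
    (S : κ → A[X]) (i : ι) : red 𝔍 ((M *ᵥ S) i) = 0 := by
  rw [Matrix.mulVec, dotProduct, map_sum]
  refine Finset.sum_eq_zero fun k _ => ?_
  have : red 𝔍 (M i k) = 0 := congrFun (congrFun hM i) k
  rw [map_mul, this, zero_mul]

/-- Graded version of Horrocks' theorem over a graded local ring. -/
theorem IsGradedLocal.gTriv [SetLike.GradedMonoid 𝒜] (hloc : IsGradedLocal 𝒜 𝔍) {ι : Type*}
    [Fintype ι] {p : ι → P} {e : Matrix ι ι A[X]}
    (he : IsHom (polyGr 𝒜 x) p p e) (hee : e * e = e) {n : ℕ} {w : Fin n → P} {f : A[X]}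
    (hf : HMonic 𝒜 x f) {U : Matrix ι (Fin n) A[X]} {V : Matrix (Fin n) ι A[X]}
    (hU : IsHom (polyGr 𝒜 x) p w U) (hV : IsHom (polyGr 𝒜 x) (fun i => w i + f.natDegree • x) p V)
    (hUV : U * V = f • e) (hVU : V * U = f • 1) : GTriv (polyGr 𝒜 x) p e := by
  classical
  have := Ideal.Quotient.nontrivial_iff.mpr hloc.ne_top
  have : Nontrivial A := (Ideal.Quotient.mk 𝔍).domain_nontrivial
  set D := f.natDegree with hD
  have heU : e * U = U := smul_left_cancel_of_monic hf.1 (by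
    rw [← Matrix.smul_mul, ← hUV, Matrix.mul_assoc, hVU]; simp)
  have hVe : V * e = V := smul_left_cancel_of_monic hf.1 (by
    rw [← Matrix.mul_smul, ← hUV, ← Matrix.mul_assoc, hVU]; simp)
  have hfm : (red 𝔍 f).Monic := Monic.red hf.1
  have hVU' : V.map (red 𝔍) * U.map (red 𝔍) = red 𝔍 f • 1 := by
    rw [← Matrix.map_mul, hVU, map_smul_matrix, Matrix.map_one _ (map_zero _) (map_one _)]
  obtain ⟨w', u, v, T, T0, G0, hu, hv, hT, hT0, hG0, hvu, hUuT, hTT0, hT0T⟩ :=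
    hasHermite hloc n w U (V.map (red 𝔍)) (red 𝔍 f) hU hfm hVU'
  -- enlarge `G` so that it has positive degree
  obtain ⟨T', G, hT', hG, hGpos, hTT', hT'T⟩ : ∃ (T' : Matrix (Fin n) (Fin n) A[X]) (G : A[X]),
      IsHom (polyGr 𝒜 x) (fun i => w i + G.natDegree • x) w' T' ∧ HMonic 𝒜 x G ∧
      0 < G.natDegree ∧ T * T' = G • 1 ∧ T' * T = G • 1 := by
    have hdeg : (X * G0).natDegree = 1 + G0.natDegree := by
      rw [monic_X.natDegree_mul hG0.1, natDegree_X]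
    refine ⟨(X : A[X]) • T0, X * G0, fun i j => ?_, HMonic.X.mul hG0, by lia, ?_, ?_⟩
    · refine mul_mem_of_eq HMonic.X.2 (hT0 i j) ?_
      rw [hdeg, natDegree_X, add_smul]
      dsimp only
      abel
    · rw [Matrix.mul_smul, hTT0, mul_smul]
    · rw [Matrix.smul_mul, hT0T, mul_smul]
  have hGm : (red 𝔍 G).Monic := Monic.red hG.1
  have hee' : e.map (red 𝔍) * e.map (red 𝔍) = e.map (red 𝔍) := by rw [← Matrix.map_mul, hee]
  have heU' : e.map (red 𝔍) * U.map (red 𝔍) = U.map (red 𝔍) := by rw [← Matrix.map_mul, heU]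
  have hUV' : U.map (red 𝔍) * V.map (red 𝔍) = red 𝔍 f • e.map (red 𝔍) := by
    rw [← Matrix.map_mul, hUV, map_smul_matrix]
  have hTT'' : T.map (red 𝔍) * T'.map (red 𝔍) = red 𝔍 G • 1 := by
    rw [← Matrix.map_mul, hTT', map_smul_matrix, Matrix.map_one _ (map_zero _) (map_one _)]
  have huG : U.map (red 𝔍) * T'.map (red 𝔍) = red 𝔍 G • u.map (red 𝔍) := by
    rw [hUuT, Matrix.mul_assoc, hTT'']; simp
  have heu : e.map (red 𝔍) * u.map (red 𝔍) = u.map (red 𝔍) :=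
    smul_left_cancel_of_monic hGm (by
      rw [← Matrix.mul_smul, ← huG, ← Matrix.mul_assoc, heU'])
  set v' := v * e with hv'_def
  have hv' : IsHom (polyGr 𝒜 x) w' p v' := hv.mul he
  have hv'e : v' * e = v' := by rw [hv'_def, Matrix.mul_assoc, hee]
  have hv'u : v'.map (red 𝔍) * u.map (red 𝔍) = 1 := by
    rw [hv'_def, Matrix.map_mul, Matrix.mul_assoc, heu, hvu]
  have hTV : T.map (red 𝔍) * V.map (red 𝔍) = red 𝔍 f • v'.map (red 𝔍) := by
    rw [hv'_def, Matrix.map_mul, ← Matrix.mul_smul, ← hUV', hUuT, Matrix.mul_assoc (u.map _),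
      ← Matrix.mul_assoc (v.map _), hvu, Matrix.one_mul]
  have huv' : u.map (red 𝔍) * v'.map (red 𝔍) = e.map (red 𝔍) :=
    smul_left_cancel_of_monic hfm (by
      rw [← Matrix.mul_smul, ← hTV, ← hUV', hUuT, Matrix.mul_assoc])
  set Y := T * V with hY_def
  have hY : IsHom (polyGr 𝒜 x) (fun i => w' i + D • x) p Y :=
    (hT.congr_weights (p' := fun i => w' i + D • x) (q' := fun i => w i + D • x)
      (fun i j => by abel)).mul hV
  have hYe : Y * e = Y := by rw [hY_def, Matrix.mul_assoc, hVe]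
  have hYUT : Y * (U * T') = (f * G) • 1 := by
    rw [hY_def, Matrix.mul_assoc, ← Matrix.mul_assoc V, hVU, Matrix.smul_mul, Matrix.one_mul,
      Matrix.mul_smul, hTT', mul_smul]
  have hUTY : U * T' * Y = (G * f) • e := by
    rw [hY_def, Matrix.mul_assoc, ← Matrix.mul_assoc T', hT'T, Matrix.smul_mul, Matrix.one_mul,
      Matrix.mul_smul, hUV, mul_smul]
  set j1 := Y * u - f • 1 with hj1_def
  have hj1 : IsHom (polyGr 𝒜 x) (fun i => w' i + D • x) w' j1 := by
    refine (hY.mul hu).sub ?_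
    exact IsHom.one.smul hf.2
  have hj1red : j1.map (red 𝔍) = 0 := by
    rw [hj1_def, Matrix.map_sub _ (map_sub _), Matrix.map_mul, hY_def, Matrix.map_mul, hTV,
      map_smul_matrix, Matrix.map_one _ (map_zero _) (map_one _), Matrix.smul_mul, hv'u, sub_self]
  have hfG : HMonic 𝒜 x (f * G) := hf.mul hG
  have hdfG : (f * G).natDegree = D + G.natDegree := hf.1.natDegree_mul hG.1
  obtain ⟨S, hS, hSred, hSeq⟩ := hloc.exists_matrix_add_apply_eq_one (ω := w') hGpos
    (LinearMap.pi fun i => divLin f ∘ₗ modByMonicHom (f * G) ∘ₗ LinearMap.proj i ∘ₗ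
      (mulVecLin j1).restrictScalars A)
    (fun c S hS i => mem_of_eq (divByMonic_mem hf (modByMonic_mem hfG (hj1.mulVec hS i)))
      (by rw [← hD]; abel))
    (fun S i => red_divByMonic hf.1 (red_modByMonic hfG.1 (red_mulVec hj1red S i)))
    (fun S i => by
      change (((j1 *ᵥ S) i) %ₘ (f * G) /ₘ f).degree < _
      rw [degree_lt_iff_coeff_zero]
      intro k hk
      refine coeff_eq_zero_of_natDegree_lt ?_
      have h1 := natDegree_modByMonic_lt ((j1 *ᵥ S) i) hfG.1 (fun h1 => by
        rw [h1, natDegree_one] at hdfG; lia)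
      rw [natDegree_divByMonic _ hf.1]
      lia)
  set q : Matrix (Fin n) (Fin n) A[X] := (j1 * S).map (· /ₘ (f * G)) with hq_def
  set ρ : Matrix (Fin n) (Fin n) A[X] := (j1 * S).map (· %ₘ (f * G)) with hρ_def
  set a : Matrix (Fin n) (Fin n) A[X] := ρ.map (· /ₘ f) with ha_def
  set ρ' : Matrix (Fin n) (Fin n) A[X] := ρ.map (· %ₘ f) with hρ'_def
  have hj1S : j1 * S = (f * G) • q + ρ := by
    ext1 i j
    simp only [Matrix.add_apply, Matrix.smul_apply, hq_def, hρ_def, Matrix.map_apply, smul_eq_mul]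
    rw [add_comm, modByMonic_add_div]
  have hρ : ρ = f • a + ρ' := by
    ext1 i j
    simp only [Matrix.add_apply, Matrix.smul_apply, ha_def, hρ'_def, Matrix.map_apply,
      smul_eq_mul]
    rw [add_comm, modByMonic_add_div]
  have hSa : S + a = 1 := by ext1 i j; exact hSeq i j
  have hj1S_hom : IsHom (polyGr 𝒜 x) (fun i => w' i + D • x) w' (j1 * S) := hj1.mul hS
  have hρhom : IsHom (polyGr 𝒜 x) (fun i => w' i + D • x) w' ρ := fun i j =>
    modByMonic_mem hfG (hj1S_hom i j)
  have hρ'hom : IsHom (polyGr 𝒜 x) (fun i => w' i + D • x) w' ρ' := fun i j =>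
    modByMonic_mem hf (hρhom i j)
  have hqhom : IsHom (polyGr 𝒜 x) w' (fun i => w' i + G.natDegree • x) q := fun i j =>
    mem_of_eq (divByMonic_mem hfG (hj1S_hom i j)) (by
      rw [hdfG, add_smul]; dsimp only; abel)
  have hqred : q.map (red 𝔍) = 0 := by
    ext1 i j
    exact red_divByMonic hfG.1 (red_mulVec hj1red (fun k => S k j) i)
  set Q := f • 1 + ρ' with hQ_def
  have hQhom : IsHom (polyGr 𝒜 x) (fun i => w' i + D • x) w' Q := (IsHom.one.smul hf.2).add hρ'hom
  set C0 := u * S - U * T' * q with hC0_def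
  have hC0 : IsHom (polyGr 𝒜 x) p w' C0 := by
    have hUT' := (hU.congr_weights (p' := fun i => p i + G.natDegree • x)
      (q' := fun i => w i + G.natDegree • x) (fun i j => by abel)).mul hT'
    exact (hu.mul hS).sub ((hUT'.mul hqhom).congr_weights fun i j => by abel)
  have hYC : Y * C0 = Q := by
    rw [hC0_def, Matrix.mul_sub, ← Matrix.mul_assoc, ← Matrix.mul_assoc, hYUT, Matrix.smul_mul,
      Matrix.one_mul, hQ_def]
    have h1 : Y * u = j1 + f • 1 := by rw [hj1_def]; abel
    rw [h1, Matrix.add_mul, Matrix.smul_mul, Matrix.one_mul, hj1S, hρ, ← hSa, smul_add]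
    abel
  have hC0red : C0.map (red 𝔍) = u.map (red 𝔍) := by
    rw [hC0_def, Matrix.map_sub _ (map_sub _), Matrix.map_mul, Matrix.map_mul, hSred, hqred]
    simp
  obtain ⟨hQm, hQdeg⟩ := monic_det_of_degree_lt hf.1 (M := ρ')
    (fun i j => degree_modByMonic_lt _ hf.1)
  rw [Fintype.card_fin, ← hQ_def, ← hD] at hQdeg
  rw [← hQ_def] at hQm
  set b := e * C0 with hb_def
  have hb : IsHom (polyGr 𝒜 x) p w' b := he.mul hC0
  have heb : e * b = b := by rw [hb_def, ← Matrix.mul_assoc, hee]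
  have hYb : Y * b = Q := by rw [hb_def, ← Matrix.mul_assoc, hYe, hYC]
  have hbred : b.map (red 𝔍) = u.map (red 𝔍) := by
    rw [hb_def, Matrix.map_mul, hC0red, heu]
  set δ := X * Q.det with hδ_def
  have hsum : ∑ i, (w' i + D • x) - ∑ i, w' i = (n * D) • x := by
    rw [Finset.sum_add_distrib, Finset.sum_const, Finset.card_univ, Fintype.card_fin, smul_smul]
    abel
  have hδ : HMonic 𝒜 x δ := by
    refine HMonic.X.mul ⟨hQm, ?_⟩
    rw [hQdeg, ← hsum]
    exact hQhom.det
  have hδdeg : δ.natDegree = n * D + 1 := by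
    rw [hδ_def, monic_X.natDegree_mul hQm, natDegree_X, hQdeg, add_comm]
  set Lm := (X : A[X]) • (Q.adjugate * Y) with hLm_def
  have hLm : IsHom (polyGr 𝒜 x) (fun i => w' i + δ.natDegree • x) p Lm := by
    have h1 := hQhom.adjugate
    rw [hsum] at h1
    have h2 := (h1.congr_weights (p' := fun i => w' i + (n * D) • x) (q' := fun i => w' i + D • x)
      (fun i j => by abel)).mul hY
    refine (h2.smul HMonic.X.2).congr_weights fun i j => ?_
    rw [hδdeg, add_smul, natDegree_X]
    abel
  have hbL : b * Lm = δ • e := by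
    have hGf : (G * f) • b = U * T' * Q := by
      rw [← hYC, ← Matrix.mul_assoc, hUTY, Matrix.smul_mul, hb_def]
    refine smul_left_cancel_of_monic (hG.1.mul hf.1) ?_
    calc (G * f) • (b * Lm) = X • (((G * f) • b) * Q.adjugate * Y) := by
          simp only [hLm_def, Matrix.mul_smul, Matrix.smul_mul, ← Matrix.mul_assoc]
          rw [smul_comm]
      _ = X • (Q.det • (U * T' * Y)) := by
          rw [hGf, Matrix.mul_assoc (U * T'), mul_adjugate, Matrix.mul_smul, Matrix.mul_one,
            Matrix.smul_mul]
      _ = (G * f) • δ • e := by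
          rw [hUTY, hδ_def]
          simp only [smul_smul]
          congr 1
          ring
  set j := e - b * v' with hj_def
  have hj : IsHom (polyGr 𝒜 x) p p j := he.sub (hb.mul hv')
  have hej : e * j = j := by rw [hj_def, Matrix.mul_sub, hee, ← Matrix.mul_assoc, heb]
  have hjred : j.map (red 𝔍) = 0 := by
    rw [hj_def, Matrix.map_sub _ (map_sub _), Matrix.map_mul, hbred, huv', sub_self]
  obtain ⟨S2, hS2, -, hS2eq⟩ := hloc.exists_matrix_add_apply_eq_one (ω := p)
    (m := δ.natDegree) (by lia)
    (-LinearMap.pi fun i => modByMonicHom δ ∘ₗ LinearMap.proj i ∘ₗ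
      (mulVecLin j).restrictScalars A)
    (fun c S hS i => neg_mem (modByMonic_mem hδ (hj.mulVec hS i)))
    (fun S i => by
      have := red_modByMonic (𝔍 := 𝔍) hδ.1 (red_mulVec hjred S i)
      exact (map_neg _ _).trans (by rw [neg_eq_zero]; exact this))
    (fun S i => by
      change (-((j *ᵥ S) i %ₘ δ)).degree < _
      rw [degree_neg, ← degree_eq_natDegree hδ.1.ne_zero]
      exact degree_modByMonic_lt _ hδ.1)
  set q2 : Matrix ι ι A[X] := (j * S2).map (· /ₘ δ) with hq2_def
  set ρ2 : Matrix ι ι A[X] := (j * S2).map (· %ₘ δ) with hρ2_def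
  have hjS2 : j * S2 = δ • q2 + ρ2 := by
    ext1 i k
    simp only [Matrix.add_apply, Matrix.smul_apply, hq2_def, hρ2_def, Matrix.map_apply,
      smul_eq_mul]
    rw [add_comm, modByMonic_add_div]
  have hS2ρ : S2 - ρ2 = 1 := by
    ext1 i k
    rw [sub_eq_add_neg]
    exact hS2eq i k
  have hjS2hom : IsHom (polyGr 𝒜 x) p p (j * S2) := hj.mul hS2
  have hq2 : IsHom (polyGr 𝒜 x) p (fun i => p i + δ.natDegree • x) q2 := fun i k =>
    mem_of_eq (divByMonic_mem hδ (hjS2hom i k)) (by dsimp only; abel)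
  set V' := v' * S2 + Lm * q2 with hV'_def
  have hV' : IsHom (polyGr 𝒜 x) w' p V' := by
    refine (hv'.mul hS2).add (((hLm.congr_weights (p' := w')
      (q' := fun i => p i - δ.natDegree • x) (fun i k => by abel)).mul (hq2.congr_weights
      (p' := fun i => p i - δ.natDegree • x) (q' := p) (fun i k => by abel))))
  have hbV' : b * V' = e := by
    have h1 : e * ρ2 = j * S2 - δ • (e * q2) := by
      have : ρ2 = j * S2 - δ • q2 := by rw [hjS2]; abel
      rw [this, Matrix.mul_sub, ← Matrix.mul_assoc, hej, Matrix.mul_smul]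
    have h2 : b * v' = e - j := by rw [hj_def]; abel
    rw [hV'_def, Matrix.mul_add, ← Matrix.mul_assoc b v' S2, ← Matrix.mul_assoc b Lm q2, hbL, h2, Matrix.sub_mul,
      Matrix.smul_mul]
    calc e * S2 - j * S2 + δ • (e * q2) = e * S2 - (j * S2 - δ • (e * q2)) := by abel
      _ = e * (S2 - ρ2) := by rw [← h1, Matrix.mul_sub]
      _ = e := by rw [hS2ρ, Matrix.mul_one]
  have hV'b : V' * b = 1 := by
    refine smul_left_cancel_of_monic hQm ?_
    have h1 : Q * (V' * b) = Q := by
      rw [← hYb, Matrix.mul_assoc Y b, ← Matrix.mul_assoc b, hbV', heb]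
    have h2 := congrArg (Q.adjugate * ·) h1
    simp only [← Matrix.mul_assoc, adjugate_mul] at h2
    rw [Matrix.mul_assoc, Matrix.smul_mul, Matrix.one_mul] at h2
    exact h2
  exact ⟨n, w', b, V', hb, hV', hbV', hV'b⟩

end Horrocks

section Quillen

variable {P A : Type*} [AddCommGroup P] [CommRing A] {𝒜 : P → AddSubgroup A} {x : P}
  {ι κ : Type*}

/-- The substitution `X ↦ aX`. -/
noncomputable def scaleHom (a : A) : A[X] →+* A[X] := compRingHom (C a * X)

theorem scaleHom_apply (a : A) (f : A[X]) : scaleHom a f = f.comp (C a * X) := rfl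

theorem scaleHom_mem [SetLike.GradedMonoid 𝒜] {a : A} (ha : a ∈ 𝒜 0) (c : P) (f : A[X])
    (hf : f ∈ polyGr 𝒜 x c) : scaleHom a f ∈ polyGr 𝒜 x c :=
  comp_C_mul_X_mem ha hf

theorem exists_scaleHom_sub [SetLike.GradedMonoid 𝒜] {s a b c : A} (ha : a ∈ 𝒜 0)
    (hb : b ∈ 𝒜 0) (hc : c ∈ 𝒜 0) (h : a - b = s * c) {d : P} {f : A[X]}
    (hf : f ∈ polyGr 𝒜 x d) :
    ∃ k ∈ polyGr 𝒜 x d, scaleHom a f - scaleHom b f = C s * k := by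
  have key : ∀ n : ℕ, ∃ g ∈ 𝒜 0, a ^ n - b ^ n = s * g := fun n => by
    refine ⟨c * ∑ i ∈ Finset.range n, a ^ i * b ^ (n - 1 - i), ?_, ?_⟩
    · refine mul_mem_of_eq hc (sum_mem fun i _ => mul_mem_of_eq (pow_mem_zero ha _)
        (pow_mem_zero hb _) (add_zero 0)) (add_zero 0)
    · rw [← mul_assoc, ← h, mul_comm, (Commute.all a b).geom_sum₂_mul]
  choose g hg0 hg using key
  refine ⟨∑ n ∈ f.support, monomial n (f.coeff n * g n), ?_, ?_⟩
  · exact sum_mem fun n _ => monomial_mem n (mul_mem_of_eq (hf n) (hg0 n) (add_zero _)) (by abel)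
  · ext n
    rw [coeff_sub, scaleHom_apply, scaleHom_apply, comp_C_mul_X_coeff, comp_C_mul_X_coeff,
      coeff_C_mul, finsetSum_coeff, ← mul_sub, hg]
    simp only [coeff_monomial, Finset.sum_ite_eq', mem_support_iff]
    split_ifs with h0
    · ring
    · simp [notMem_support_iff.mp h0]

theorem exists_matrix_scaleHom_sub [SetLike.GradedMonoid 𝒜] {s a b c : A} (ha : a ∈ 𝒜 0)
    (hb : b ∈ 𝒜 0) (hc : c ∈ 𝒜 0) (h : a - b = s * c) {p : ι → P} {q : κ → P}
    {M : Matrix ι κ A[X]} (hM : IsHom (polyGr 𝒜 x) p q M) :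
    ∃ K, IsHom (polyGr 𝒜 x) p q K ∧
      M.map (scaleHom a) = M.map (scaleHom b) + (C s : A[X]) • K := by
  choose K hK hK' using fun i j => exists_scaleHom_sub ha hb hc h (hM i j)
  refine ⟨Matrix.of K, hK, ?_⟩
  ext1 i j
  simp only [Matrix.map_apply, Matrix.add_apply, Matrix.smul_apply, Matrix.of_apply, smul_eq_mul]
  rw [← hK']
  ring

theorem map_scaleHom_smul (a s : A) (M : Matrix ι κ A[X]) :
    ((C s : A[X]) • M).map (scaleHom a) = (C s : A[X]) • M.map (scaleHom a) := by
  ext1 i j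
  simp [scaleHom_apply]

/-- If `e` becomes trivial after inverting `s`, then `e(aX)` and `e(bX)` are equivalent as
soon as `s` divides `a - b`. -/
theorem gequiv_scaleHom [IsDomain A] [SetLike.GradedMonoid 𝒜] [Fintype ι] [Fintype κ]
    [DecidableEq κ] {s a b c : A}
    (ha : a ∈ 𝒜 0) (hb : b ∈ 𝒜 0) (hc : c ∈ 𝒜 0) (h : a - b = s * c) {p : ι → P} {w : κ → P}
    {e : Matrix ι ι A[X]} (he : IsHom (polyGr 𝒜 x) p p e) (hee : e * e = e)
    {U : Matrix ι κ A[X]} {V : Matrix κ ι A[X]} (hU : IsHom (polyGr 𝒜 x) p w U)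
    (hV : IsHom (polyGr 𝒜 x) w p V) (hUV : U * V = (C s : A[X]) • e)
    (hVU : V * U = (C s : A[X]) • 1) :
    GEquiv (polyGr 𝒜 x) p (e.map (scaleHom a)) p (e.map (scaleHom b)) := by
  by_cases hs : s = 0
  · have hab : a = b := by rw [← sub_eq_zero, h, hs, zero_mul]
    subst hab
    exact GEquiv.refl (he.map _ (scaleHom_mem ha)) (by rw [← Matrix.map_mul, hee])
  have hcan : ∀ M N : Matrix ι ι A[X], (C s : A[X]) • M = (C s : A[X]) • N → M = N := by
    intro M N hMN
    ext1 i j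
    have := congrFun (congrFun hMN i) j
    exact mul_left_cancel₀ (C_ne_zero.mpr hs) this
  have aux : ∀ a b c : A, a ∈ 𝒜 0 → b ∈ 𝒜 0 → c ∈ 𝒜 0 → a - b = s * c →
      ∃ φ, IsHom (polyGr 𝒜 x) p p φ ∧
        (C s : A[X]) • φ = U.map (scaleHom a) * V.map (scaleHom b) := by
    intro a b c ha hb hc h
    obtain ⟨K, hK, hK'⟩ := exists_matrix_scaleHom_sub ha hb hc h hU
    refine ⟨e.map (scaleHom b) + K * V.map (scaleHom b), (he.map _ (scaleHom_mem hb)).add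
      (hK.mul (hV.map _ (scaleHom_mem hb))), ?_⟩
    rw [hK', Matrix.add_mul, ← Matrix.map_mul, hUV, map_scaleHom_smul, smul_add, Matrix.smul_mul]
  obtain ⟨φ, hφ, hφ'⟩ := aux a b c ha hb hc h
  obtain ⟨χ, hχ, hχ'⟩ := aux b a (-c) hb ha (neg_mem hc) (by rw [mul_neg, ← h]; ring)
  have hmul : ∀ a b : A, U.map (scaleHom a) * V.map (scaleHom b) *
      (U.map (scaleHom b) * V.map (scaleHom a)) = (C s : A[X]) • (C s : A[X]) •
        e.map (scaleHom a) := by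
    intro a b
    have h1 : V.map (scaleHom b) * U.map (scaleHom b) = (C s : A[X]) • 1 := by
      rw [← Matrix.map_mul, hVU, map_scaleHom_smul]
      simp
    rw [Matrix.mul_assoc, ← Matrix.mul_assoc (V.map _), h1, Matrix.smul_mul, Matrix.one_mul,
      Matrix.mul_smul, ← Matrix.map_mul, hUV, map_scaleHom_smul]
  refine ⟨φ, χ, hφ, hχ, ?_, ?_⟩
  · apply hcan
    apply hcan
    rw [← hmul a b, ← hφ', ← hχ', Matrix.smul_mul, Matrix.mul_smul]
  · apply hcan
    apply hcan
    rw [← hmul b a, ← hφ', ← hχ', Matrix.smul_mul, Matrix.mul_smul]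

variable (𝒜) in
/-- The degree zero subring. -/
def zeroSubring [SetLike.GradedMonoid 𝒜] : Subring A where
  __ := 𝒜 0
  one_mem' := SetLike.one_mem_graded 𝒜
  mul_mem' := fun ha hb => mul_mem_of_eq ha hb (add_zero 0)

variable (𝒜 x) in
/-- The set of degree zero elements after whose inversion `e` becomes trivial. -/
def trivSet [SetLike.GradedMonoid 𝒜] [Fintype ι] (p : ι → P) (e : Matrix ι ι A[X]) :
    Set (zeroSubring 𝒜) :=
  {s | ∃ (n : ℕ) (w : Fin n → P) (U : Matrix ι (Fin n) A[X]) (V : Matrix (Fin n) ι A[X]),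
    IsHom (polyGr 𝒜 x) p w U ∧ IsHom (polyGr 𝒜 x) w p V ∧ U * V = (C (s : A) : A[X]) • e ∧
      V * U = (C (s : A) : A[X]) • 1}

/-- Graded Quillen patching. -/
theorem gequiv_of_span_trivSet [IsDomain A] [SetLike.GradedMonoid 𝒜] [Fintype ι] {p : ι → P}
    {e : Matrix ι ι A[X]} (he : IsHom (polyGr 𝒜 x) p p e) (hee : e * e = e)
    (h : Ideal.span (trivSet 𝒜 x p e) = ⊤) :
    GEquiv (polyGr 𝒜 x) p e p (e.map (scaleHom 0)) := by
  have hidem : ∀ a, e.map (scaleHom a) * e.map (scaleHom a) = e.map (scaleHom a) := fun a => by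
    rw [← Matrix.map_mul, hee]
  have key : ∀ c ∈ Ideal.span (trivSet 𝒜 x p e), ∀ a ∈ 𝒜 0,
      GEquiv (polyGr 𝒜 x) p (e.map (scaleHom (a + c))) p (e.map (scaleHom a)) := by
    intro c hc
    induction hc using Submodule.closure_induction with
    | zero =>
      intro a ha
      simpa using GEquiv.refl (he.map _ (scaleHom_mem ha)) (hidem a)
    | add c d _ _ hc hd =>
      intro a ha
      have := (hd (a + c) (add_mem ha c.2)).trans (hidem _) (hidem _) (hc a ha)
      simpa [add_assoc] using this
    | smul_mem r s hs =>
      intro a ha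
      obtain ⟨n, w, U, V, hU, hV, hUV, hVU⟩ := hs
      refine gequiv_scaleHom (c := (r : A)) (s := (s : A)) (add_mem ha (r • s).2) ha r.2 ?_ he hee
        hU hV hUV hVU
      simp [mul_comm]
  have := key 1 (h ▸ Submodule.mem_top) 0 (zero_mem _)
  have h1 : scaleHom (1 : A) = RingHom.id _ := by
    ext <;> simp [scaleHom_apply]
  simpa [h1] using this

end Quillen

section Localization

variable {P A : Type*} [AddCommGroup P] [CommRing A]

/-- The grading of a localization at elements of degree zero. -/
def locGr (𝒜 : P → AddSubgroup A) [SetLike.GradedMonoid 𝒜] (B : Type*) [CommRing B]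
    [Algebra A B] (S : Submonoid A) (c : P) : AddSubgroup B where
  carrier := {z | ∃ s ∈ S, s ∈ 𝒜 0 ∧ ∃ a ∈ 𝒜 c, algebraMap A B s * z = algebraMap A B a}
  zero_mem' := ⟨1, S.one_mem, SetLike.one_mem_graded 𝒜, 0, zero_mem _, by simp⟩
  add_mem' := by
    rintro z z' ⟨s, hs, hs0, a, ha, h⟩ ⟨s', hs', hs0', a', ha', h'⟩
    refine ⟨s * s', S.mul_mem hs hs', mul_mem_of_eq hs0 hs0' (add_zero 0), s' * a + s * a',
      add_mem (mul_mem_of_eq hs0' ha (zero_add c)) (mul_mem_of_eq hs0 ha' (zero_add c)), ?_⟩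
    rw [map_add, map_mul, map_mul, map_mul, ← h, ← h']
    ring
  neg_mem' := by
    rintro z ⟨s, hs, hs0, a, ha, h⟩
    exact ⟨s, hs, hs0, -a, neg_mem ha, by rw [mul_neg, h, map_neg]⟩

variable {𝒜 : P → AddSubgroup A} [SetLike.GradedMonoid 𝒜] {B : Type*} [CommRing B] [Algebra A B]
  {S : Submonoid A} {x : P}

theorem algebraMap_mem_locGr {c : P} {a : A} (ha : a ∈ 𝒜 c) : algebraMap A B a ∈ locGr 𝒜 B S c :=
  ⟨1, S.one_mem, SetLike.one_mem_graded 𝒜, a, ha, by simp⟩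

instance : SetLike.GradedMonoid (locGr 𝒜 B S) where
  one_mem := by
    rw [← map_one (algebraMap A B)]
    exact algebraMap_mem_locGr (SetLike.one_mem_graded 𝒜)
  mul_mem := by
    rintro i j z z' ⟨s, hs, hs0, a, ha, h⟩ ⟨s', hs', hs0', a', ha', h'⟩
    refine ⟨s * s', S.mul_mem hs hs', mul_mem_of_eq hs0 hs0' (add_zero 0), a * a',
      SetLike.mul_mem_graded ha ha', ?_⟩
    rw [map_mul, map_mul, ← h, ← h']
    ring

theorem map_mem_polyGr_locGr (c : P) (f : A[X]) (hf : f ∈ polyGr 𝒜 x c) :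
    mapRingHom (algebraMap A B) f ∈ polyGr (locGr 𝒜 B S) x c := fun n => by
  rw [coe_mapRingHom, coeff_map]
  exact algebraMap_mem_locGr (hf n)

theorem exists_common_denom {γ : Type*} (t : Finset γ) (z : γ → B) (d : γ → P)
    (h : ∀ i ∈ t, z i ∈ locGr 𝒜 B S (d i)) :
    ∃ s ∈ S, s ∈ 𝒜 0 ∧ ∀ i ∈ t, ∃ a ∈ 𝒜 (d i), algebraMap A B s * z i = algebraMap A B a := by
  classical
  induction t using Finset.induction_on with
  | empty => exact ⟨1, S.one_mem, SetLike.one_mem_graded 𝒜, by simp⟩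
  | insert i t hi ih =>
    obtain ⟨s, hs, hs0, H⟩ := ih fun i hi => h i (by simp [hi])
    obtain ⟨s', hs', hs0', a, ha, h'⟩ := h i (by simp)
    refine ⟨s * s', S.mul_mem hs hs', mul_mem_of_eq hs0 hs0' (add_zero 0), fun j hj => ?_⟩
    rcases Finset.mem_insert.mp hj with rfl | hj
    · refine ⟨s * a, mul_mem_of_eq hs0 ha (zero_add _), ?_⟩
      rw [map_mul, map_mul, mul_assoc, h']
    · obtain ⟨b, hb, hb'⟩ := H j hj
      refine ⟨s' * b, mul_mem_of_eq hs0' hb (zero_add _), ?_⟩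
      rw [map_mul, map_mul, ← hb']
      ring

theorem exists_matrix_lift {ι κ : Type*} [Fintype ι] [Fintype κ] {p : ι → P} {q : κ → P}
    {M : Matrix ι κ B[X]} (hM : IsHom (polyGr (locGr 𝒜 B S) x) p q M) :
    ∃ s ∈ S, s ∈ 𝒜 0 ∧ ∃ N : Matrix ι κ A[X], IsHom (polyGr 𝒜 x) p q N ∧
      N.map (mapRingHom (algebraMap A B)) = (C (algebraMap A B s) : B[X]) • M := by
  classical
  let D := (Finset.univ.sup fun ij : ι × κ => (M ij.1 ij.2).natDegree) + 1
  obtain ⟨s, hs, hs0, H⟩ := exists_common_denom (𝒜 := 𝒜) (S := S)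
    (t := (Finset.univ : Finset (ι × κ)) ×ˢ Finset.range D)
    (fun k => (M k.1.1 k.1.2).coeff k.2) (fun k => p k.1.1 - q k.1.2 - k.2 • x)
    (fun k _ => hM _ _ _)
  have H' : ∀ i j, ∀ n, ∃ a ∈ 𝒜 (p i - q j - n • x), algebraMap A B s * (M i j).coeff n =
      algebraMap A B a := by
    intro i j n
    by_cases hn : n < D
    · exact H ((i, j), n) (by simp [hn])
    · refine ⟨0, zero_mem _, ?_⟩
      have : (M i j).natDegree ≤ Finset.univ.sup fun ij : ι × κ => (M ij.1 ij.2).natDegree :=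
        Finset.le_sup (f := fun ij : ι × κ => (M ij.1 ij.2).natDegree) (Finset.mem_univ (i, j))
      rw [coeff_eq_zero_of_natDegree_lt (by lia)]
      simp
  choose a ha ha' using H'
  refine ⟨s, hs, hs0, Matrix.of fun i j => ∑ n ∈ Finset.range D, monomial n (a i j n), fun i j => ?_, ?_⟩
  · rw [Matrix.of_apply]
    exact sum_mem fun n _ => monomial_mem n (ha i j n) (by abel)
  · ext i j n
    have h : (M i j).natDegree ≤ Finset.univ.sup fun ij : ι × κ => (M ij.1 ij.2).natDegree :=
      Finset.le_sup (f := fun ij : ι × κ => (M ij.1 ij.2).natDegree) (Finset.mem_univ (i, j))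
    simp only [Matrix.map_apply, Matrix.of_apply, coe_mapRingHom, coeff_map, finsetSum_coeff, coeff_monomial,
      Finset.sum_ite_eq', Finset.mem_range, Matrix.smul_apply, smul_eq_mul, coeff_C_mul]
    split_ifs with hn
    · exact (ha' i j n).symm
    · rw [coeff_eq_zero_of_natDegree_lt (by lia)]
      simp

end Localization

section Horrocks

variable {P A : Type*} [AddCommGroup P] [CommRing A]

/-- A projection to the degree zero part, compatible with homogeneous multiplication. -/
def HasZeroProj (𝒜 : P → AddSubgroup A) : Prop :=
  ∃ π : A →+ A, (∀ a ∈ 𝒜 0, π a = a) ∧ (∀ a, π a ∈ 𝒜 0) ∧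
    ∀ c, ∀ a ∈ 𝒜 c, ∀ b, ∃ b' ∈ 𝒜 (-c), π (a * b) = a * b'

variable {𝒜 : P → AddSubgroup A} [SetLike.GradedMonoid 𝒜] {x : P}

theorem exists_isGradedLocal (hπ : HasZeroProj 𝒜) (𝔪 : Ideal (zeroSubring 𝒜)) [𝔪.IsPrime]
    (B : Type*) [CommRing B] [Algebra A B]
    (S : Submonoid A) (hS : ∀ a, a ∈ S ↔ ∃ h : a ∈ 𝒜 0, (⟨a, h⟩ : zeroSubring 𝒜) ∉ 𝔪)
    [IsLocalization S B] (hinj : Function.Injective (algebraMap A B)) :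
    ∃ 𝔍 : Ideal B, IsGradedLocal (locGr 𝒜 B S) 𝔍 := by
  obtain ⟨π, hπ1, hπ0, hπmul⟩ := hπ
  let 𝔞 : Ideal A :=
    { carrier := {a | ∀ b, (⟨π (a * b), hπ0 _⟩ : zeroSubring 𝒜) ∈ 𝔪}
      zero_mem' := fun b => by
        convert 𝔪.zero_mem
        simp
      add_mem' := fun {a a'} ha ha' b => by
        convert 𝔪.add_mem (ha b) (ha' b)
        exact Subtype.ext (by simp [add_mul])
      smul_mem' := fun c a ha b => by
        rw [show c • a * b = a * (c * b) by rw [smul_eq_mul]; ring]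
        exact ha (c * b) }
  have h𝔞 : ∀ s ∈ S, s ∉ 𝔞 := by
    intro s hs hs'
    obtain ⟨h0, h1⟩ := (hS s).mp hs
    apply h1
    have h2 := hs' 1
    simp only [mul_one, hπ1 s h0] at h2
    exact h2
  refine ⟨𝔞.map (algebraMap A B), ?_, ?_⟩
  · intro h
    have h1 : (1 : B) ∈ 𝔞.map (algebraMap A B) := h ▸ Submodule.mem_top
    rw [IsLocalization.mem_map_algebraMap_iff S B] at h1
    obtain ⟨⟨a, s⟩, h1⟩ := h1
    rw [one_mul] at h1
    exact h𝔞 s s.2 (hinj h1 ▸ a.2)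
  · rintro c z ⟨s, hs, hs0, a, ha, h⟩ hz
    have ha' : a ∉ 𝔞 := fun ha' => hz ((IsLocalization.mem_map_algebraMap_iff S B).mpr
      ⟨⟨⟨a, ha'⟩, ⟨s, hs⟩⟩, by rw [mul_comm, h]⟩)
    have ha2 : ∃ b, (⟨π (a * b), hπ0 _⟩ : zeroSubring 𝒜) ∉ 𝔪 := by
      by_contra! h
      exact ha' h
    obtain ⟨b, hb⟩ := ha2
    obtain ⟨b', hb', hab⟩ := hπmul c a ha b
    have hmem : a * b' ∈ S := (hS _).mpr ⟨hab ▸ hπ0 _, by simpa only [hab] using hb⟩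
    have hmem0 : a * b' ∈ 𝒜 0 := ((hS _).mp hmem).1
    let u := IsLocalization.mk' B (s * b') (⟨a * b', hmem⟩ : S)
    have hu : algebraMap A B (a * b') * u = algebraMap A B (s * b') :=
      IsLocalization.mk'_spec' B (s * b') (⟨a * b', hmem⟩ : S)
    refine ⟨u, ⟨a * b', hmem, hmem0, s * b', mul_mem_of_eq hs0 hb' (zero_add _), hu⟩, ?_⟩
    have hunit := (IsLocalization.map_units B (⟨s, hs⟩ : S)).mul
      (IsLocalization.map_units B (⟨a * b', hmem⟩ : S))
    refine hunit.mul_left_cancel ?_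
    calc algebraMap A B s * algebraMap A B (a * b') * (z * u)
        = (algebraMap A B s * z) * (algebraMap A B (a * b') * u) := by ring
      _ = algebraMap A B s * algebraMap A B (a * b') * 1 := by
        rw [hu, h, map_mul, map_mul]
        ring

theorem map_C_smul {B : Type*} [CommRing B] {ι κ : Type*} (φ : A →+* B) (f : A[X])
    (M : Matrix ι κ A[X]) : (f • M).map (mapRingHom φ) =
      (mapRingHom φ f) • M.map (mapRingHom φ) := by
  ext1 i j
  simp

/-- Graded version of the affine Horrocks theorem. -/
theorem gTriv_of_monic [IsDomain A] (hπ : HasZeroProj 𝒜) {ι : Type*}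
    [Fintype ι] {p : ι → P} {e : Matrix ι ι A[X]}
    (he : IsHom (polyGr 𝒜 x) p p e) (hee : e * e = e) {n : ℕ} {w : Fin n → P} {f : A[X]}
    (hf : HMonic 𝒜 x f) {U : Matrix ι (Fin n) A[X]} {V : Matrix (Fin n) ι A[X]}
    (hU : IsHom (polyGr 𝒜 x) p w U) (hV : IsHom (polyGr 𝒜 x) (fun i => w i + f.natDegree • x) p V)
    (hUV : U * V = f • e) (hVU : V * U = f • 1) (h0 : GTriv 𝒜 p (e.map constantCoeff)) :
    GTriv (polyGr 𝒜 x) p e := by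
  have h1 : GTriv (polyGr 𝒜 x) p (e.map (scaleHom 0)) := by
    have := h0.map (C : A →+* A[X]) (ℬ := polyGr 𝒜 x) fun c a ha => C_mem ha
    convert this using 1
    ext1 i j
    simp [scaleHom_apply, coeff_zero_eq_eval_zero]
  refine GTriv.of_gequiv hee (gequiv_of_span_trivSet he hee ?_) h1
  by_contra hne
  obtain ⟨𝔪, hm, hle⟩ := Ideal.exists_le_maximal _ hne
  let S : Submonoid A := 𝔪.primeCompl.map (zeroSubring 𝒜).subtype
  have hS : ∀ a, a ∈ S ↔ ∃ h : a ∈ 𝒜 0, (⟨a, h⟩ : zeroSubring 𝒜) ∉ 𝔪 := by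
    intro a
    constructor
    · rintro ⟨b, hb, rfl⟩
      exact ⟨b.2, hb⟩
    · rintro ⟨h, h'⟩
      exact ⟨⟨a, h⟩, h', rfl⟩
  have hS0 : S ≤ nonZeroDivisors A := by
    intro s hs
    obtain ⟨h, h'⟩ := (hS s).mp hs
    refine mem_nonZeroDivisors_of_ne_zero fun h0 => h' ?_
    subst h0
    exact 𝔪.zero_mem
  let B := Localization S
  have hinj : Function.Injective (algebraMap A B) := IsLocalization.injective B hS0
  obtain ⟨𝔍, h𝔍⟩ := exists_isGradedLocal hπ 𝔪 B S hS hinj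
  have : Nontrivial B := hinj.nontrivial
  let φ := mapRingHom (algebraMap A B)
  have hφinj : Function.Injective φ := map_injective _ hinj
  have hφ : ∀ c, ∀ g ∈ polyGr 𝒜 x c, φ g ∈ polyGr (locGr 𝒜 B S) x c := map_mem_polyGr_locGr
  have hfd : (φ f).natDegree = f.natDegree := hf.1.natDegree_map _
  have hφf : HMonic (locGr 𝒜 B S) x (φ f) := ⟨hf.1.map _, by rw [hfd]; exact hφ _ _ hf.2⟩
  obtain ⟨k, w', U', V', hU', hV', hUV', hVU'⟩ := h𝔍.gTriv (he.map φ hφ)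
    (by rw [← Matrix.map_mul, hee]) hφf (hU.map φ hφ) (by rw [hfd]; exact hV.map φ hφ)
    (by rw [← Matrix.map_mul, hUV, map_C_smul]) (by rw [← Matrix.map_mul, hVU, map_C_smul]; simp [φ])
  obtain ⟨s, hs, hs0, U₁, hU₁, hsU⟩ := exists_matrix_lift hU'
  obtain ⟨t, ht, ht0, V₁, hV₁, htV⟩ := exists_matrix_lift hV'
  have hst0 : s * t ∈ 𝒜 0 := mul_mem_of_eq hs0 ht0 (add_zero 0)
  have hmap : mapRingHom (algebraMap A B) (C (s * t)) = C (algebraMap A B s) * C (algebraMap A B t) := by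
    simp
  have hmem : (⟨s * t, hst0⟩ : zeroSubring 𝒜) ∈ trivSet 𝒜 x p e := by
    refine ⟨k, w', U₁, V₁, hU₁, hV₁, ?_, ?_⟩
    · apply Matrix.map_injective hφinj
      change (U₁ * V₁).map (mapRingHom (algebraMap A B)) =
        ((C (s * t) : A[X]) • e).map (mapRingHom (algebraMap A B))
      rw [Matrix.map_mul, map_C_smul, hmap, hsU, htV, Matrix.smul_mul, Matrix.mul_smul, hUV',
        smul_smul]
    · apply Matrix.map_injective hφinj
      change (V₁ * U₁).map (mapRingHom (algebraMap A B)) =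
        ((C (s * t) : A[X]) • (1 : Matrix _ _ A[X])).map (mapRingHom (algebraMap A B))
      rw [Matrix.map_mul, map_C_smul, hmap, hsU, htV, Matrix.smul_mul, Matrix.mul_smul, hVU',
        smul_smul, mul_comm]
      simp
  obtain ⟨_, h⟩ := (hS _).mp (S.mul_mem hs ht)
  exact h (hle (Ideal.subset_span hmem))

end Horrocks

end GradedMatrix

namespace GradedMatrix

open Polynomial

section PID

variable {R : Type*} [CommRing R] [IsDomain R]

variable (R) in
/-- Monic polynomials with trailing coefficient one. -/
def bimonic : Submonoid R[X] where
  carrier := {f | f.Monic ∧ f.trailingCoeff = 1}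
  one_mem' := ⟨monic_one, by simp [trailingCoeff]⟩
  mul_mem' := fun hf hg => ⟨hf.1.mul hg.1, by rw [trailingCoeff_mul, hf.2, hg.2, one_mul]⟩

theorem bimonic_le : bimonic R ≤ nonZeroDivisors R[X] := fun _ hf =>
  mem_nonZeroDivisors_of_ne_zero hf.1.ne_zero

theorem exists_bimonic_lift {k : Type*} [Field k] {φ : R →+* k} (hφ : Function.Surjective φ)
    {G : k[X]} (hG : G ∈ bimonic k) : ∃ F ∈ bimonic R, F.map φ = G := by
  classical
  let σ : k → R := fun y => if y = 0 then 0 else if y = 1 then 1 else Function.surjInv hφ y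
  have hσ : ∀ y, φ (σ y) = y := by
    intro y
    simp only [σ]
    split_ifs with h1 h2
    · simp [h1]
    · simp [h2]
    · exact Function.surjInv_eq hφ y
  have hσ0 : ∀ y, σ y = 0 ↔ y = 0 := fun y => by
    constructor
    · intro h
      rw [← hσ y, h, map_zero]
    · rintro rfl
      simp [σ]
  have hσ1 : σ 1 = 1 := by simp [σ]
  let F : R[X] := ∑ n ∈ G.support, monomial n (σ (G.coeff n))
  have hF : ∀ n, F.coeff n = σ (G.coeff n) := by
    intro n
    simp only [F, finsetSum_coeff, coeff_monomial, Finset.sum_ite_eq', mem_support_iff]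
    split_ifs with h
    · rfl
    · rw [eq_comm, hσ0]
      exact not_not.mp h
  have hsupp : F.support = G.support := by
    ext n
    simp [hF, hσ0]
  have hFG : F.map φ = G := by
    ext n
    rw [coeff_map, hF, hσ]
  have hG0 := hG.1.ne_zero
  have hF0 : F ≠ 0 := by
    intro h
    rw [h, Polynomial.map_zero] at hFG
    exact hG0 hFG.symm
  refine ⟨F, ⟨?_, ?_⟩, hFG⟩
  · have : F.natDegree = G.natDegree := by
      rw [natDegree_eq_support_max' hF0, natDegree_eq_support_max' hG0]
      simp only [hsupp]
    rw [Monic, leadingCoeff, this, hF]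
    exact (congrArg σ hG.1).trans hσ1
  · have : F.natTrailingDegree = G.natTrailingDegree := by
      rw [natTrailingDegree_eq_support_min' hF0, natTrailingDegree_eq_support_min' hG0]
      simp only [hsupp]
    rw [trailingCoeff, this, hF]
    exact (congrArg σ hG.2).trans hσ1

theorem exists_mul_mem_bimonic {k : Type*} [Field k] {g : k[X]} (hg : g ≠ 0) :
    ∃ h, g * h ∈ bimonic k := by
  have h1 := leadingCoeff_ne_zero.mpr hg
  have h2 : g.trailingCoeff ≠ 0 := trailingCoeff_nonzero_iff_nonzero.mpr hg
  set t := g.leadingCoeff / g.trailingCoeff with ht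
  have ht0 : t ≠ 0 := div_ne_zero h1 h2
  have htr : (X + C t).trailingCoeff = t := by
    rw [trailingCoeff, (natTrailingDegree_eq_zero).mpr (Or.inr (by simpa using ht0))]
    simp
  refine ⟨C g.leadingCoeff⁻¹ * (X + C t), ?_, ?_⟩
  · rw [Monic, leadingCoeff_mul, leadingCoeff_mul, leadingCoeff_C, leadingCoeff_X_add_C]
    field_simp
  · rw [trailingCoeff_mul, trailingCoeff_mul, htr, ht]
    simp only [trailingCoeff, natTrailingDegree_C, coeff_C_zero]
    simp only [trailingCoeff] at h2
    field_simp

theorem isPrincipal_of_disjoint_bimonic [IsPrincipalIdealRing R] (𝔭 : Ideal R[X]) [𝔭.IsPrime]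
    (hdis : ∀ f ∈ bimonic R, f ∉ 𝔭) : 𝔭.IsPrincipal := by
  by_cases h0 : 𝔭 = ⊥
  · exact h0 ▸ bot_isPrincipal
  obtain ⟨g, hg, hgp⟩ := Ideal.IsPrime.exists_mem_prime_of_ne_bot ‹_› h0
  by_cases hC : ∃ r : R, r ≠ 0 ∧ C r ∈ 𝔭
  · obtain ⟨r, hr0, hr⟩ := hC
    let 𝔮 : Ideal R := 𝔭.comap C
    have h𝔮 : 𝔮.IsPrime := Ideal.comap_isPrime C 𝔭
    have h𝔮0 : 𝔮 ≠ ⊥ := fun h => hr0 (by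
      have : r ∈ 𝔮 := hr
      rwa [h, Ideal.mem_bot] at this)
    have hmax : 𝔮.IsMaximal := h𝔮.isMaximal h𝔮0
    let _ : Field (R ⧸ 𝔮) := Ideal.Quotient.field 𝔮
    have hle : 𝔮.map C ≤ 𝔭 := Ideal.map_comap_le
    have hge : 𝔭 ≤ 𝔮.map C := by
      intro f hf
      by_contra hne
      have hf0 : f.map (Ideal.Quotient.mk 𝔮) ≠ 0 := by
        intro h
        apply hne
        rw [Ideal.mem_map_C_iff]
        intro n
        rw [← Ideal.Quotient.eq_zero_iff_mem, ← coeff_map, h, coeff_zero]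
      obtain ⟨h, hh⟩ := exists_mul_mem_bimonic hf0
      obtain ⟨h', rfl⟩ := map_surjective _ Ideal.Quotient.mk_surjective h
      obtain ⟨F, hF, hF'⟩ := exists_bimonic_lift Ideal.Quotient.mk_surjective hh
      apply hdis F hF
      have : F - f * h' ∈ 𝔭 := by
        apply hle
        rw [Ideal.mem_map_C_iff]
        intro n
        rw [← Ideal.Quotient.eq_zero_iff_mem, ← coeff_map, Polynomial.map_sub, hF',
          Polynomial.map_mul, sub_self, coeff_zero]
      simpa using 𝔭.add_mem this (𝔭.mul_mem_right h' hf)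
    rw [le_antisymm hge hle]
    obtain ⟨π, hπ⟩ := (IsPrincipalIdealRing.principal 𝔮).principal
    refine ⟨⟨C π, ?_⟩⟩
    rw [hπ, Ideal.submodule_span_eq, Ideal.map_span, Set.image_singleton, Ideal.submodule_span_eq]
  · push Not at hC
    let K := FractionRing R
    let _ : Algebra R[X] K[X] := Polynomial.algebra R K
    have hgd : g.natDegree ≠ 0 := by
      intro h
      rw [eq_C_of_natDegree_eq_zero h] at hg
      refine hC (g.coeff 0) (fun h1 => hgp.ne_zero ?_) hg
      rw [eq_C_of_natDegree_eq_zero h, h1, C_0]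
    have hprim : g.IsPrimitive := hgp.irreducible.isPrimitive hgd
    have hirr : Irreducible (g.map (algebraMap R K)) :=
      (hprim.irreducible_iff_irreducible_map_fraction_map).mp hgp.irreducible
    refine ⟨⟨g, le_antisymm (fun f hf => ?_) ?_⟩⟩
    · rw [Ideal.submodule_span_eq, Ideal.mem_span_singleton]
      by_contra hdvd
      have h1 : ¬ g.map (algebraMap R K) ∣ f.map (algebraMap R K) := fun h =>
        hdvd (hprim.dvd_of_fraction_map_dvd_fraction_map h)
      obtain ⟨a, b, hab⟩ := (hirr.coprime_iff_not_dvd).mpr h1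
      have h1 : (1 : K[X]) ∈ 𝔭.map (algebraMap R[X] K[X]) := by
        rw [← hab]
        exact Ideal.add_mem _ (Ideal.mul_mem_left _ _ (Ideal.mem_map_of_mem _ hg))
          (Ideal.mul_mem_left _ _ (Ideal.mem_map_of_mem _ hf))
      have := Polynomial.isLocalization (nonZeroDivisors R) K
      rw [IsLocalization.mem_map_algebraMap_iff ((nonZeroDivisors R).map C)] at h1
      obtain ⟨⟨y, ⟨_, s, hs, rfl⟩⟩, h1⟩ := h1
      rw [one_mul] at h1
      refine hC s (nonZeroDivisors.ne_zero hs) ?_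
      have h2 : C s = (y : R[X]) := map_injective (algebraMap R K) (IsFractionRing.injective R K) h1
      rw [h2]
      exact y.2
    · rw [Ideal.submodule_span_eq, Ideal.span_singleton_le_iff_mem]
      exact hg

theorem isPrincipalIdealRing_bimonic [IsPrincipalIdealRing R] (D : Type*) [CommRing D]
    [Algebra R[X] D] [IsLocalization (bimonic R) D] : IsPrincipalIdealRing D := by
  refine IsPrincipalIdealRing.of_prime fun 𝔮 h𝔮 => ?_
  have h1 : (𝔮.under R[X]).IsPrime := Ideal.comap_isPrime (algebraMap R[X] D) 𝔮
  have h2 : (𝔮.under R[X]).IsPrincipal := by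
    refine isPrincipal_of_disjoint_bimonic _ fun f hf hf' => h𝔮.ne_top ?_
    exact 𝔮.eq_top_of_isUnit_mem hf' (IsLocalization.map_units D (⟨f, hf⟩ : bimonic R))
  rw [← IsLocalization.map_under (bimonic R) D 𝔮]
  obtain ⟨a, ha⟩ := h2.principal
  refine ⟨⟨algebraMap R[X] D a, ?_⟩⟩
  rw [ha, Ideal.submodule_span_eq, Ideal.map_span, Set.image_singleton, Ideal.submodule_span_eq]

end PID

end GradedMatrix

namespace GradedMatrix

open Matrix Polynomial

section Laurent

/-- The trivial grading. -/
def trivGr (A : Type*) [CommRing A] : PUnit.{1} → AddSubgroup A := fun _ => ⊤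

variable {A B : Type*} [CommRing A] [CommRing B] {ι κ : Type*}

theorem mem_trivGr {c : PUnit} (a : A) : a ∈ trivGr A c := trivial

instance : SetLike.GradedMonoid (trivGr A) where
  one_mem := trivial
  mul_mem := fun _ _ _ _ _ _ => trivial

theorem IsHom.trivial {p : ι → PUnit} {q : κ → PUnit} (M : Matrix ι κ A) :
    IsHom (trivGr A) p q M := fun _ _ => mem_trivGr _

theorem mem_polyGr_trivGr {x c : PUnit} (f : A[X]) : f ∈ polyGr (trivGr A) x c :=
  fun _ => mem_trivGr _

theorem IsHom.poly_trivial {p : ι → PUnit} {q : κ → PUnit} {x : PUnit} (M : Matrix ι κ A[X]) :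
    IsHom (polyGr (trivGr A) x) p q M := fun _ _ => mem_polyGr_trivGr _

theorem hasZeroProj_trivGr : HasZeroProj (trivGr A) :=
  ⟨AddMonoidHom.id A, fun _ _ => rfl, fun _ => trivial, fun _ _ _ b => ⟨b, trivial, rfl⟩⟩

theorem exists_away_lift [Algebra A[X] B] [IsLocalization.Away (X : A[X]) B] [Finite ι] [Finite κ]
    (M : Matrix ι κ B) : ∃ K : ℕ, ∀ m ≥ K, ∃ N : Matrix ι κ A[X],
      N.map (algebraMap A[X] B) = (algebraMap A[X] B X) ^ m • M := by
  obtain ⟨⟨_, K, rfl⟩, h⟩ := IsLocalization.exist_integer_multiples_of_finite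
    (Submonoid.powers (X : A[X])) (fun ij : ι × κ => M ij.1 ij.2)
  choose N hN using h
  refine ⟨K, fun m hm => ⟨Matrix.of fun i j => X ^ (m - K) * N (i, j), ?_⟩⟩
  ext1 i j
  have hN' := hN (i, j)
  rw [Algebra.smul_def] at hN'
  simp only [Matrix.map_apply, Matrix.of_apply, Matrix.smul_apply, map_mul, hN', map_pow,
    smul_eq_mul]
  rw [← mul_assoc, ← pow_add, Nat.sub_add_cancel hm]

theorem map_smul' (φ : A →+* B) (c : A) (M : Matrix ι κ A) :
    (c • M).map φ = φ c • M.map φ := by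
  ext1 i j
  simp

/-- Horrocks' theorem over Laurent polynomial rings. -/
theorem gTriv_laurent [IsDomain A] [IsDomain B] [Algebra A[X] B]
    [IsLocalization.Away (X : A[X]) B] (hA : AllTriv (trivGr A)) [Fintype ι] {p : ι → PUnit}
    {e : Matrix ι ι B} (hee : e * e = e) {g : A[X]} (hg : g.Monic) (hg0 : g.coeff 0 = 1)
    {n : ℕ} {U : Matrix ι (Fin n) B} {V : Matrix (Fin n) ι B}
    (hUV : U * V = algebraMap A[X] B g • e) (hVU : V * U = algebraMap A[X] B g • 1) :
    GTriv (trivGr B) p e := by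
  classical
  let j := algebraMap A[X] B
  have hj : Function.Injective j := IsLocalization.injective B
    (Submonoid.powers_le.mpr (mem_nonZeroDivisors_of_ne_zero X_ne_zero))
  have hjg : j g ≠ 0 := (map_ne_zero_iff j hj).mpr hg.ne_zero
  set T : B := j X with hT
  have hUV' : U * V = j g • e := hUV
  have hVU' : V * U = j g • 1 := hVU
  have hVe : V * e = V := by
    have : j g • (V * e) = j g • V := by
      rw [← Matrix.mul_smul, ← hUV', ← Matrix.mul_assoc, hVU', Matrix.smul_mul, Matrix.one_mul]
    ext1 i k
    exact mul_left_cancel₀ hjg (congrFun (congrFun this i) k)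
  have heU : e * U = U := by
    have : j g • (e * U) = j g • U := by
      rw [← Matrix.smul_mul, ← hUV', Matrix.mul_assoc, hVU', Matrix.mul_smul, Matrix.mul_one]
    ext1 i k
    exact mul_left_cancel₀ hjg (congrFun (congrFun this i) k)
  obtain ⟨K₁, h₁⟩ := exists_away_lift (A := A) V
  obtain ⟨K₂, h₂⟩ := exists_away_lift (A := A) U
  obtain ⟨K₃, h₃⟩ := exists_away_lift (A := A) e
  set K := K₁ + K₂ + K₃ with hK
  obtain ⟨E₁, hE₁⟩ := h₁ K (by lia)
  obtain ⟨E₂, hE₂⟩ := h₂ K (by lia)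
  obtain ⟨E₃, hE₃⟩ := h₃ (2 * K) (by lia)
  change E₁.map j = T ^ K • V at hE₁
  change E₂.map j = T ^ K • U at hE₂
  change E₃.map j = T ^ (2 * K) • e at hE₃
  have hcop : IsCoprime g (X ^ (2 * K)) := by
    refine IsCoprime.pow_right ⟨1, -g.divX, ?_⟩
    have := g.divX_mul_X_add
    rw [hg0, C_1] at this
    linear_combination -this
  obtain ⟨a, b, hab⟩ := hcop
  have hab' : j a * j g + j b * T ^ (2 * K) = 1 := by
    rw [← map_one j, ← hab]
    simp [hT]
  let H : Matrix (Fin n ⊕ ι) ι B := fromRows V (T ^ K • e)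
  let G : Matrix ι (Fin n ⊕ ι) B := fromCols (j a • U) ((j b * T ^ K) • e)
  have hGH : G * H = e := by
    simp only [G, H, fromCols_mul_fromRows, Matrix.smul_mul, Matrix.mul_smul, hUV', hee, smul_smul]
    have : j a * j g + T ^ K * (j b * T ^ K) = 1 := by linear_combination hab'
    rw [← add_smul, this, one_smul]
  have hHe : H * e = H := by
    simp only [H, fromRows_mul, hVe, Matrix.smul_mul, hee]
  have heG : e * G = G := by
    simp only [G, mul_fromCols, Matrix.mul_smul, heU, hee]
  let E : Matrix (Fin n ⊕ ι) (Fin n ⊕ ι) A[X] :=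
    fromBlocks ((a * g) • 1) (b • E₁) (a • E₂) (b • E₃)
  have hE : E.map j = H * G := by
    simp only [G, H, E, fromRows_mul_fromCols, fromBlocks_map, map_smul', hE₁, hE₂, hE₃,
      Matrix.smul_mul, Matrix.mul_smul, hVU', hee, hVe, heU, smul_smul, map_mul]
    congr 1
    · simp
    · congr 1
      ring
  have hEE : E * E = E := by
    apply Matrix.map_injective hj
    change (E * E).map j = E.map j
    rw [Matrix.map_mul, hE, Matrix.mul_assoc, ← Matrix.mul_assoc G, hGH, heG]
  obtain ⟨N₁, k₁⟩ := exists_away_lift (A := A) (H * U)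
  obtain ⟨N₂, k₂⟩ := exists_away_lift (A := A) (V * G)
  obtain ⟨U', hU'⟩ := k₁ (N₁ + N₂) (by lia)
  obtain ⟨V', hV'⟩ := k₂ (N₁ + N₂) (by lia)
  change U'.map j = T ^ (N₁ + N₂) • (H * U) at hU'
  change V'.map j = T ^ (N₁ + N₂) • (V * G) at hV'
  have hf : (X ^ (N₁ + N₂) * X ^ (N₁ + N₂) * g).Monic :=
    ((monic_X_pow _).mul (monic_X_pow _)).mul hg
  have hUV'' : U' * V' = (X ^ (N₁ + N₂) * X ^ (N₁ + N₂) * g) • E := by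
    apply Matrix.map_injective hj
    change (U' * V').map j = Matrix.map (_ • E) j
    rw [Matrix.map_mul, hU', hV', map_smul', hE, Matrix.smul_mul, Matrix.mul_smul, smul_smul,
      Matrix.mul_assoc, ← Matrix.mul_assoc U, hUV', Matrix.smul_mul, Matrix.mul_smul, heG,
      smul_smul]
    simp [hT]
  have hVU'' : V' * U' = (X ^ (N₁ + N₂) * X ^ (N₁ + N₂) * g) • 1 := by
    apply Matrix.map_injective hj
    change (V' * U').map j = Matrix.map (_ • 1) j
    rw [Matrix.map_mul, hU', hV', map_smul', Matrix.smul_mul, Matrix.mul_smul, smul_smul,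
      Matrix.mul_assoc, ← Matrix.mul_assoc G, hGH, heU, hVU', smul_smul]
    simp [hT]
  have h0 : GTriv (trivGr A) (fun _ => PUnit.unit) (E.map constantCoeff) :=
    hA.gTriv (IsHom.trivial _) (by rw [← Matrix.map_mul, hEE])
  have h1 : GTriv (polyGr (trivGr A) PUnit.unit) (fun _ => PUnit.unit) E :=
    gTriv_of_monic hasZeroProj_trivGr (IsHom.poly_trivial _) hEE (w := fun _ => PUnit.unit)
      ⟨hf, mem_polyGr_trivGr _⟩ (IsHom.poly_trivial _) (IsHom.poly_trivial _) hUV'' hVU'' h0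
  have h2 : GTriv (trivGr B) (fun _ => PUnit.unit) (E.map j) :=
    h1.map j fun _ _ _ => mem_trivGr _
  rw [hE] at h2
  exact GTriv.of_gequiv hee ⟨G, H, IsHom.trivial _, IsHom.trivial _, hGH, rfl⟩ h2

end Laurent

section Free

theorem allTriv_trivGr_of_pid (R : Type*) [CommRing R] [IsDomain R] [IsPrincipalIdealRing R] :
    AllTriv (trivGr R) := by
  classical
  intro n p e he hee
  obtain ⟨m, b⟩ := Submodule.basisOfPid (Pi.basisFun R (Fin n)) (LinearMap.range (toLin' e))
  have hid : ∀ x : LinearMap.range (toLin' e), e *ᵥ (x : Fin n → R) = x := by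
    rintro ⟨_, y, rfl⟩
    simp [hee]
  let r : (Fin n → R) →ₗ[R] (Fin m → R) :=
    b.equivFun.toLinearMap ∘ₗ (toLin' e).rangeRestrict
  let s : (Fin m → R) →ₗ[R] (Fin n → R) :=
    (LinearMap.range (toLin' e)).subtype ∘ₗ b.equivFun.symm.toLinearMap
  have hsr : s ∘ₗ r = toLin' e := by
    apply LinearMap.ext
    intro y
    simp [s, r]
  have hrs : r ∘ₗ s = LinearMap.id := by
    apply LinearMap.ext
    intro y
    have : (toLin' e).rangeRestrict (b.equivFun.symm y : Fin n → R) = b.equivFun.symm y := by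
      apply Subtype.ext
      rw [LinearMap.codRestrict_apply, toLin'_apply, hid]
    change b.equivFun ((toLin' e).rangeRestrict (b.equivFun.symm y : Fin n → R)) = y
    rw [this, LinearEquiv.apply_symm_apply]
  refine ⟨m, fun _ => PUnit.unit, LinearMap.toMatrix' s, LinearMap.toMatrix' r,
    IsHom.trivial _, IsHom.trivial _, ?_, ?_⟩
  · rw [← LinearMap.toMatrix'_comp, hsr, LinearMap.toMatrix'_toLin']
  · rw [← LinearMap.toMatrix'_comp, hrs, LinearMap.toMatrix'_id]

variable {A B C : Type*} [CommRing A] [CommRing B] [CommRing C]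

theorem exists_forall_denom {θ : B →+* C} {S : Submonoid B}
    (hS : ∀ z, ∃ s ∈ S, ∃ b, θ s * z = θ b) {ι : Type*} [Finite ι] (z : ι → C) :
    ∃ s ∈ S, ∃ b : ι → B, ∀ i, θ s * z i = θ (b i) := by
  classical
  cases nonempty_fintype ι
  choose s hs b hb using fun i => hS (z i)
  refine ⟨∏ i, s i, S.prod_mem fun i _ => hs i,
    fun i => (∏ j ∈ Finset.univ.erase i, s j) * b i, fun i => ?_⟩
  rw [map_mul, ← hb, ← Finset.prod_erase_mul _ _ (Finset.mem_univ i), map_mul, mul_assoc]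

theorem GTriv.exists_descend {θ : B →+* C} (hθ : Function.Injective θ) {S : Submonoid B}
    (hS : ∀ z, ∃ s ∈ S, ∃ b, θ s * z = θ b) {ι : Type*} [Fintype ι] {p : ι → PUnit}
    {e : Matrix ι ι B} (h : GTriv (trivGr C) p (e.map θ)) :
    ∃ s ∈ S, ∃ (n : ℕ) (U : Matrix ι (Fin n) B) (V : Matrix (Fin n) ι B),
      U * V = s • e ∧ V * U = s • 1 := by
  obtain ⟨n, w, U, V, -, -, hUV, hVU⟩ := h
  obtain ⟨s, hs, U', hU'⟩ := exists_forall_denom hS fun x : ι × Fin n => U x.1 x.2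
  obtain ⟨t, ht, V', hV'⟩ := exists_forall_denom hS fun x : Fin n × ι => V x.1 x.2
  have h1 : (Matrix.of fun i j => U' (i, j)).map θ = θ s • U := by
    ext1 i j
    simp [← hU']
  have h2 : (Matrix.of fun i j => V' (i, j)).map θ = θ t • V := by
    ext1 i j
    simp [← hV']
  refine ⟨s * t, S.mul_mem hs ht, n, Matrix.of fun i j => U' (i, j), Matrix.of fun i j => V' (i, j),
    Matrix.map_injective hθ ?_, Matrix.map_injective hθ ?_⟩
  · change Matrix.map _ θ = Matrix.map _ θ
    rw [Matrix.map_mul, h1, h2, map_smul', Matrix.smul_mul, Matrix.mul_smul, smul_smul, hUV,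
      map_mul]
  · change Matrix.map _ θ = Matrix.map _ θ
    rw [Matrix.map_mul, h1, h2, map_smul', Matrix.smul_mul, Matrix.mul_smul, smul_smul, hVU,
      map_mul, mul_comm]
    simp

theorem commRingEquiv_single_toLaurent {R G : Type*} [CommRing R] [AddCommGroup G] (f : R[X]) :
    (AddMonoidAlgebra.commRingEquiv (AddMonoidAlgebra.single (0 : G) (toLaurent f)) :
      LaurentPolynomial (AddMonoidAlgebra R G)) =
    toLaurent (f.map AddMonoidAlgebra.singleZeroRingHom) := by
  let φ : R[X] →+* LaurentPolynomial (AddMonoidAlgebra R G) :=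
    (AddMonoidAlgebra.commRingEquiv : AddMonoidAlgebra (LaurentPolynomial R) G ≃+* _).toRingHom.comp
      (AddMonoidAlgebra.singleZeroRingHom.comp toLaurent)
  let ψ : R[X] →+* LaurentPolynomial (AddMonoidAlgebra R G) :=
    toLaurent.comp (mapRingHom AddMonoidAlgebra.singleZeroRingHom)
  suffices φ = ψ from RingHom.congr_fun this f
  refine Polynomial.ringHom_ext (fun a => ?_) ?_
  · change AddMonoidAlgebra.commRingEquiv (AddMonoidAlgebra.single (0 : G) (toLaurent (C a))) =
      toLaurent ((C a).map AddMonoidAlgebra.singleZeroRingHom)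
    rw [Polynomial.map_C, toLaurent_C, toLaurent_C]
    exact AddMonoidAlgebra.commRingEquiv_single_single _ _ _
  · change AddMonoidAlgebra.commRingEquiv (AddMonoidAlgebra.single (0 : G) (toLaurent X)) =
      toLaurent (X.map AddMonoidAlgebra.singleZeroRingHom)
    rw [Polynomial.map_X, toLaurent_X, toLaurent_X]
    exact AddMonoidAlgebra.commRingEquiv_single_single _ _ _

section Step

variable {R : Type*} [CommRing R] [IsDomain R] {G : Type*} [AddCommGroup G]

theorem exists_denom_addMonoidAlgebra {φ : B →+* C} {S : Submonoid B}
    (hS : ∀ z, ∃ s ∈ S, ∃ b, φ s * z = φ b) (z : AddMonoidAlgebra C G) :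
    ∃ s ∈ S, ∃ b, AddMonoidAlgebra.mapRingHom G φ (AddMonoidAlgebra.single 0 s) * z =
      AddMonoidAlgebra.mapRingHom G φ b := by
  induction z using AddMonoidAlgebra.induction_linear with
  | zero => exact ⟨1, S.one_mem, 0, by simp⟩
  | single m a =>
    obtain ⟨s, hs, b, hb⟩ := hS a
    exact ⟨s, hs, AddMonoidAlgebra.single m b, by
      simp [AddMonoidAlgebra.single_mul_single, hb]⟩
  | add f g hf hg =>
    obtain ⟨s, hs, b, hb⟩ := hf
    obtain ⟨t, ht, c, hc⟩ := hg
    refine ⟨s * t, S.mul_mem hs ht, AddMonoidAlgebra.single 0 t * b +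
      AddMonoidAlgebra.single 0 s * c, ?_⟩
    rw [map_add, map_mul, map_mul, ← hb, ← hc,
      show (AddMonoidAlgebra.single 0 (s * t) : AddMonoidAlgebra B G) =
        AddMonoidAlgebra.single 0 s * AddMonoidAlgebra.single 0 t by
        simp [AddMonoidAlgebra.single_mul_single], map_mul]
    ring

/-- The localization map `R[T, T⁻¹] → D` at the bimonic polynomials. -/
noncomputable def laurentToBimonic (R D : Type*) [CommRing R] [IsDomain R] [CommRing D]
    [Algebra R[X] D] [IsLocalization (bimonic R) D] : LaurentPolynomial R →+* D :=
  IsLocalization.Away.lift (X : R[X]) (g := algebraMap R[X] D) <|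
    IsLocalization.map_units D (⟨X, monic_X, by
      rw [trailingCoeff, natTrailingDegree_X, coeff_X_one]⟩ : bimonic R)

variable (D : Type*) [CommRing D] [Algebra R[X] D] [IsLocalization (bimonic R) D]

theorem laurentToBimonic_toLaurent (f : R[X]) :
    laurentToBimonic R D (toLaurent f) = algebraMap R[X] D f :=
  IsLocalization.Away.lift_eq _ _ _

theorem laurentToBimonic_injective : Function.Injective (laurentToBimonic R D) := by
  rw [injective_iff_map_eq_zero]
  intro z hz
  obtain ⟨n, f, hf⟩ := z.exists_T_pow
  have h1 : algebraMap R[X] D f = 0 := by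
    rw [← laurentToBimonic_toLaurent, hf, map_mul, hz, zero_mul]
  have h2 : f = 0 := (map_eq_zero_iff _ (IsLocalization.injective D bimonic_le)).mp h1
  rw [h2, map_zero] at hf
  exact ((LaurentPolynomial.isUnit_T (n : ℤ)).mul_left_eq_zero).mp hf.symm

theorem laurentToBimonic_denom (z : D) : ∃ s ∈ (bimonic R).map (toLaurent : R[X] →+* _),
    ∃ b, laurentToBimonic R D s * z = laurentToBimonic R D b := by
  obtain ⟨⟨b, s⟩, h⟩ := IsLocalization.surj (bimonic R) z
  refine ⟨toLaurent s, ⟨s, s.2, rfl⟩, toLaurent b, ?_⟩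
  rw [laurentToBimonic_toLaurent, laurentToBimonic_toLaurent, mul_comm]
  exact h

end Step

end Free

section Free

theorem allTriv_laurent_step {R : Type*} [CommRing R] [IsDomain R] {G : Type*} [AddCommGroup G]
    [UniqueSums G] (D : Type*) [CommRing D] [Algebra R[X] D] [IsLocalization (bimonic R) D]
    (hA : AllTriv (trivGr (AddMonoidAlgebra R G))) (hD : AllTriv (trivGr (AddMonoidAlgebra D G))) :
    AllTriv (trivGr (LaurentPolynomial (AddMonoidAlgebra R G))) := by
  intro n p e he hee
  let ε : AddMonoidAlgebra (LaurentPolynomial R) G ≃+* LaurentPolynomial (AddMonoidAlgebra R G) :=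
    AddMonoidAlgebra.commRingEquiv
  let φ := laurentToBimonic R D
  let θ : LaurentPolynomial (AddMonoidAlgebra R G) →+* AddMonoidAlgebra D G :=
    (AddMonoidAlgebra.mapRingHom G φ).comp ε.symm.toRingHom
  have hθ : Function.Injective θ :=
    (AddMonoidAlgebra.map_injective (φ : LaurentPolynomial R →+ D)
      (laurentToBimonic_injective D)).comp ε.symm.injective
  let S : Submonoid (LaurentPolynomial (AddMonoidAlgebra R G)) :=
    (bimonic R).map (toLaurent.comp (mapRingHom AddMonoidAlgebra.singleZeroRingHom) :
      R[X] →+* LaurentPolynomial (AddMonoidAlgebra R G))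
  have hθε : ∀ y, θ (ε y) = AddMonoidAlgebra.mapRingHom G φ y := fun y =>
    congrArg (AddMonoidAlgebra.mapRingHom G φ) (ε.symm_apply_apply y)
  have key : ∀ f : R[X], θ (toLaurent (f.map AddMonoidAlgebra.singleZeroRingHom)) =
      AddMonoidAlgebra.mapRingHom G φ (AddMonoidAlgebra.single 0 (toLaurent f)) := fun f => by
    rw [← commRingEquiv_single_toLaurent]
    exact hθε _
  have hS : ∀ z, ∃ s ∈ S, ∃ b, θ s * z = θ b := by
    intro z
    obtain ⟨_, ⟨s, hs, rfl⟩, b, hb⟩ := exists_denom_addMonoidAlgebra (laurentToBimonic_denom (R := R) D) z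
    exact ⟨_, ⟨s, hs, rfl⟩, ε b, (congrArg (· * z) (key s)).trans (hb.trans (hθε b).symm)⟩
  have h1 : GTriv (trivGr (AddMonoidAlgebra D G)) p (e.map θ) :=
    hD.gTriv (IsHom.trivial _) (by rw [← Matrix.map_mul, hee])
  obtain ⟨_, ⟨s, hs, rfl⟩, k, U, V, hUV, hVU⟩ := h1.exists_descend hθ hS
  obtain ⟨g, hg⟩ : X ^ s.natTrailingDegree ∣ s :=
    X_pow_dvd_iff.mpr fun d hd => coeff_eq_zero_of_lt_natTrailingDegree hd
  set m := s.natTrailingDegree with hm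
  have hgm : g.Monic := by
    have := hs.1
    rw [hg] at this
    exact (monic_X_pow m).of_mul_monic_left this
  have hg0 : g.coeff 0 = 1 := by
    have h := hs.2
    rw [trailingCoeff, ← hm, hg, coeff_X_pow_mul', if_pos le_rfl, Nat.sub_self] at h
    exact h
  let g' : (AddMonoidAlgebra R G)[X] := g.map AddMonoidAlgebra.singleZeroRingHom
  have hT : toLaurent (s.map (AddMonoidAlgebra.singleZeroRingHom (M := G))) =
      LaurentPolynomial.T m * toLaurent g' := by
    conv_lhs => rw [hg]
    rw [Polynomial.map_mul, Polynomial.map_pow, Polynomial.map_X, map_mul, toLaurent_X_pow]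
  have hT' : (LaurentPolynomial.T (-m) : LaurentPolynomial (AddMonoidAlgebra R G)) *
      toLaurent (s.map (AddMonoidAlgebra.singleZeroRingHom (M := G))) = toLaurent g' := by
    rw [hT, ← mul_assoc, ← LaurentPolynomial.T_add, neg_add_cancel, LaurentPolynomial.T_zero,
      one_mul]
  refine gTriv_laurent (A := AddMonoidAlgebra R G) hA hee (g := g') (hgm.map _)
    (by rw [Polynomial.coeff_map, hg0, map_one]) (n := k)
    (U := (LaurentPolynomial.T (-m) : LaurentPolynomial (AddMonoidAlgebra R G)) • U) (V := V) ?_ ?_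
  · rw [Matrix.smul_mul, hUV, smul_smul]
    exact congrArg (· • e) hT'
  · rw [Matrix.mul_smul, hVU, smul_smul]
    exact congrArg (· • (1 : Matrix (Fin k) (Fin k) (LaurentPolynomial (AddMonoidAlgebra R G)))) hT'

theorem allTriv_fin_int (n : ℕ) : ∀ (R : Type*) [CommRing R] [IsDomain R] [IsPrincipalIdealRing R],
    AllTriv (trivGr (AddMonoidAlgebra R (Fin n → ℤ))) := by
  induction n with
  | zero =>
    intro R _ _ _
    refine (allTriv_trivGr_of_pid R).of_ringEquiv (RingEquiv.ofBijective
      (AddMonoidAlgebra.singleZeroRingHom (M := Fin 0 → ℤ)) ⟨?_, ?_⟩)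
      (fun _ _ _ => mem_trivGr _) (fun _ _ _ => mem_trivGr _)
    · intro a b h
      simpa using congrArg (fun z => z.coeff 0) h
    · intro z
      refine ⟨z.coeff 0, ?_⟩
      apply AddMonoidAlgebra.coeff_injective
      refine Finsupp.ext fun m => ?_
      rw [Subsingleton.elim m 0]
      exact Finsupp.single_eq_same
  | succ n ih =>
    intro R _ _ _
    have := isPrincipalIdealRing_bimonic (R := R) (Localization (bimonic R))
    have := IsLocalization.isDomain_localization (bimonic_le (R := R))
    have h := allTriv_laurent_step (Localization (bimonic R)) (ih R) (ih (Localization (bimonic R)))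
    refine h.of_ringEquiv ((AddMonoidAlgebra.curryRingEquiv (R := R) (M := ℤ)
      (N := Fin n → ℤ)).symm.trans (AddMonoidAlgebra.domCongr R R
        (Fin.consLinearEquiv ℤ (fun _ : Fin (n + 1) => ℤ)).toAddEquiv).toRingEquiv)
      (fun _ _ _ => mem_trivGr _) (fun _ _ _ => mem_trivGr _)

theorem allTriv_free (R : Type*) [CommRing R] [IsDomain R] [IsPrincipalIdealRing R] (G : Type*)
    [AddCommGroup G] [Module.Free ℤ G] [Module.Finite ℤ G] :
    AllTriv (trivGr (AddMonoidAlgebra R G)) := by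
  refine (allTriv_fin_int (Module.finrank ℤ G) R).of_ringEquiv
    (AddMonoidAlgebra.domCongr R R
      (Module.finBasis ℤ G).equivFun.symm.toAddEquiv).toRingEquiv
      (fun _ _ _ => mem_trivGr _) (fun _ _ _ => mem_trivGr _)

end Free

end GradedMatrix

namespace GradedMatrix

open Matrix

section ZeroGrading

variable {P A : Type*} [AddCommGroup P] [CommRing A]

variable (P A) in
/-- The grading concentrated in degree zero. -/
def zeroGr (c : P) : AddSubgroup A where
  carrier := {a | c ≠ 0 → a = 0}
  zero_mem' := fun _ => rfl
  add_mem' := fun ha hb h => by rw [ha h, hb h, add_zero]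
  neg_mem' := fun ha h => by rw [ha h, neg_zero]

theorem AllTriv.zeroGr (h : AllTriv (trivGr A)) : AllTriv (zeroGr P A) := by
  classical
  intro n p e he hee
  have he0 : ∀ i j, p i ≠ p j → e i j = 0 := fun i j hij => he i j (sub_ne_zero.mpr hij)
  let s : Finset P := Finset.univ.image p
  let E : s → Matrix (Fin n) (Fin n) A := fun c => Matrix.of fun i j => if p i = c then e i j else 0
  have hsum : ∑ c, E c = e := by
    ext1 i j
    rw [Matrix.sum_apply, Finset.sum_eq_single ⟨p i, Finset.mem_image_of_mem _ (Finset.mem_univ _)⟩]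
    · simp [E]
    · intro c _ hc
      simp only [E, Matrix.of_apply]
      rw [if_neg fun h => hc (Subtype.ext h.symm)]
    · simp
  have hmul : ∀ c d, E c * E d = if c = d then E c else 0 := by
    intro c d
    ext1 i j
    by_cases hi : p i = c
    · by_cases hcd : c = d
      · subst hcd
        rw [if_pos rfl]
        have h1 := congrFun (congrFun hee i) j
        rw [Matrix.mul_apply] at h1 ⊢
        simp only [E, Matrix.of_apply, if_pos hi]
        rw [← h1]
        refine Finset.sum_congr rfl fun k _ => ?_
        by_cases hk : p k = c
        · rw [if_pos hk]
        · rw [if_neg hk, he0 i k fun h => hk (h.symm.trans hi), zero_mul, zero_mul]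
      · rw [if_neg hcd, Matrix.mul_apply]
        refine Finset.sum_eq_zero fun k _ => ?_
        simp only [E, Matrix.of_apply, if_pos hi]
        by_cases hk : p k = d
        · rw [he0 i k fun h => hcd (Subtype.ext (hi.symm.trans (h.trans hk))), zero_mul]
        · rw [if_neg hk, mul_zero]
    · rw [Matrix.mul_apply]
      have h1 : (if c = d then E c else 0) i j = 0 := by
        split_ifs <;> simp [E, hi]
      rw [h1]
      exact Finset.sum_eq_zero fun k _ => by simp [E, hi]
  have htriv : ∀ c, GTriv (trivGr A) (fun _ : Fin n => PUnit.unit) (E c) := fun c =>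
    h n _ (E c) (IsHom.trivial _) (by rw [hmul, if_pos rfl])
  choose m w U V hU hV hUV hVU using htriv
  have hEU : ∀ c, E c * U c = U c := fun c => by
    rw [← hUV, Matrix.mul_assoc, hVU, Matrix.mul_one]
  have hVE : ∀ c, V c * E c = V c := fun c => by
    rw [← hUV, ← Matrix.mul_assoc, hVU, Matrix.one_mul]
  refine GTriv.of_one (κ := Σ c : s, Fin (m c)) (q := fun x => (x.1 : P))
    ⟨Matrix.of fun i x => U x.1 i x.2, Matrix.of fun x i => V x.1 x.2 i, ?_, ?_, ?_, ?_⟩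
  · rintro i ⟨c, k⟩ hne
    change U c i k = 0
    have hi : p i ≠ c := sub_ne_zero.mp hne
    rw [← hEU, Matrix.mul_apply]
    exact Finset.sum_eq_zero fun j _ => by simp [E, hi]
  · rintro ⟨c, k⟩ i hne
    change V c k i = 0
    have hi : p i ≠ c := fun h => hne (by rw [h, sub_self])
    rw [← hVE, Matrix.mul_apply]
    refine Finset.sum_eq_zero fun j _ => ?_
    simp only [E, Matrix.of_apply]
    split_ifs with hj
    · rw [he0 j i fun h => hi (h.symm.trans hj), mul_zero]
    · rw [mul_zero]
  · rw [← hsum]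
    ext1 i j
    rw [Matrix.mul_apply, Fintype.sum_sigma, Matrix.sum_apply]
    refine Finset.sum_congr rfl fun c _ => ?_
    rw [← hUV, Matrix.mul_apply]
    rfl
  · ext1 ⟨c, k⟩ ⟨d, l⟩
    have h1 : (V c * U d) k l = if h : c = d then (1 : Matrix _ _ A) (h ▸ k) l else 0 := by
      split_ifs with h
      · subst h
        rw [hVU]
      · rw [← hVE, ← hEU, Matrix.mul_assoc, ← Matrix.mul_assoc (E c), hmul, if_neg h,
          Matrix.zero_mul, Matrix.mul_zero, Matrix.zero_apply]
    change (V c * U d) k l = _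
    rw [h1]
    split_ifs with h
    · subst h
      simp only [Matrix.one_apply, Sigma.mk.injEq, heq_eq_eq, true_and]
    · rw [Matrix.one_apply_ne]
      exact fun h' => h (congrArg Sigma.fst h')

end ZeroGrading

section Degree

variable {P : Type*} [AddCommGroup P] (R : Type*) [CommRing R] {M N : Type*} [AddCommMonoid M]
  [AddCommMonoid N]

/-- The grading of a monoid algebra by a degree map. -/
def degGr (deg : M →+ P) (c : P) : AddSubgroup (AddMonoidAlgebra R M) where
  carrier := {a | ∀ m, a.coeff m ≠ 0 → deg m = c}
  zero_mem' := fun m h => (h rfl).elim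
  add_mem' := fun {a b} ha hb m h => by
    by_cases h1 : a.coeff m = 0
    · refine hb m fun h2 => h ?_
      rw [AddMonoidAlgebra.coeff_add, Finsupp.add_apply, h1, h2, add_zero]
    · exact ha m h1
  neg_mem' := fun {a} ha m h => ha m fun h1 => h (by
    rw [AddMonoidAlgebra.coeff_neg, Finsupp.neg_apply, h1, neg_zero])

variable {R} {deg : M →+ P}

theorem mem_degGr {c : P} {a : AddMonoidAlgebra R M} :
    a ∈ degGr R deg c ↔ ∀ m, a.coeff m ≠ 0 → deg m = c := Iff.rfl

theorem degGr_eq_gradeBy (c : P) :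
    degGr R deg c = (AddMonoidAlgebra.gradeBy R deg c).toAddSubgroup := by
  ext a
  rw [mem_degGr, Submodule.mem_toAddSubgroup, AddMonoidAlgebra.mem_gradeBy_iff]
  exact ⟨fun h m hm => h m (Finsupp.mem_support_iff.mp hm),
    fun h m hm => h (Finsupp.mem_support_iff.mpr hm)⟩

theorem single_mem_degGr {c : P} {m : M} (h : deg m = c) (a : R) :
    AddMonoidAlgebra.single m a ∈ degGr R deg c := by
  rw [degGr_eq_gradeBy, ← h]
  exact AddMonoidAlgebra.single_mem_gradeBy _ _ _

instance : SetLike.GradedMonoid (degGr R deg) where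
  one_mem := single_mem_degGr (map_zero deg) 1
  mul_mem := fun i j a b ha hb => by
    rw [degGr_eq_gradeBy] at ha hb ⊢
    exact SetLike.mul_mem_graded (A := AddMonoidAlgebra.gradeBy R deg) ha hb

end Degree

section Degree

variable {P : Type*} [AddCommGroup P] {R : Type*} [CommRing R] {M N : Type*} [AddCommMonoid M]
  [AddCommMonoid N]

theorem exists_mapDomain_eq {f : M →+ N} (hf : Function.Injective f) {a : AddMonoidAlgebra R N}
    (h : ∀ m, a.coeff m ≠ 0 → m ∈ Set.range f) :
    ∃ b, AddMonoidAlgebra.mapDomainRingHom R f b = a := by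
  refine ⟨.ofCoeff (a.coeff.comapDomain f hf.injOn), ?_⟩
  apply AddMonoidAlgebra.coeff_injective
  exact Finsupp.mapDomain_comapDomain f hf a.coeff
    (fun m hm => h m (Finsupp.mem_support_iff.mp hm))

theorem mapDomainRingHom_injective {f : M →+ N} (hf : Function.Injective f) :
    Function.Injective (AddMonoidAlgebra.mapDomainRingHom R f) :=
  AddMonoidAlgebra.mapDomain_injective hf

theorem coeff_mapDomainRingHom {f : M →+ N} (hf : Function.Injective f) (a : AddMonoidAlgebra R M)
    (m : M) : (AddMonoidAlgebra.mapDomainRingHom R f a).coeff (f m) = a.coeff m :=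
  Finsupp.mapDomain_apply hf a.coeff m

theorem exists_of_coeff_mapDomainRingHom {f : M →+ N} {a : AddMonoidAlgebra R M} {n : N}
    (h : (AddMonoidAlgebra.mapDomainRingHom R f a).coeff n ≠ 0) :
    ∃ m, f m = n ∧ a.coeff m ≠ 0 := by
  classical
  have h1 := Finsupp.mapDomain_support (f := f) (s := a.coeff) (Finsupp.mem_support_iff.mpr h)
  obtain ⟨m, hm, rfl⟩ := Finset.mem_image.mp h1
  exact ⟨m, rfl, Finsupp.mem_support_iff.mp hm⟩

theorem single_mul_single_neg {L : Type*} [AddCommGroup L] (z : L) :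
    (AddMonoidAlgebra.single z 1 * AddMonoidAlgebra.single (-z) 1 : AddMonoidAlgebra R L) = 1 := by
  rw [AddMonoidAlgebra.single_mul_single, add_neg_cancel, one_mul]
  rfl

theorem allTriv_degGr_free (R : Type*) [CommRing R] [IsDomain R] [IsPrincipalIdealRing R]
    {L : Type*} [AddCommGroup L] [Module.Free ℤ L] [Module.Finite ℤ L] (ψ : L →+ P) :
    AllTriv (degGr R ψ) := by
  intro n p e he hee
  have hK : AllTriv (zeroGr P (AddMonoidAlgebra R ψ.ker)) := by
    have : Module.Free ℤ ψ.ker :=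
      inferInstanceAs (Module.Free ℤ (AddSubgroup.toIntSubmodule ψ.ker))
    have : Module.Finite ℤ ψ.ker :=
      inferInstanceAs (Module.Finite ℤ (AddSubgroup.toIntSubmodule ψ.ker))
    exact (allTriv_free R ψ.ker).zeroGr
  choose z hz using fun i => (QuotientAddGroup.eq (s := ψ.range)).mp
    (Quotient.out_eq (QuotientAddGroup.mk (s := ψ.range) (p i)))
  set c : Fin n → P := fun i => Quotient.out (QuotientAddGroup.mk (s := ψ.range) (p i)) with hc
  have hpc : ∀ i, p i = c i + ψ (z i) := fun i => by
    rw [hz]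
    exact (add_neg_cancel_left _ _).symm
  have hcc : ∀ i j x, c i - c j = ψ x → c i = c j := by
    intro i j x hx
    have h1 : QuotientAddGroup.mk (s := ψ.range) (p i) = QuotientAddGroup.mk (s := ψ.range) (p j) :=
      QuotientAddGroup.eq.mpr ⟨-x + z j - z i, by
        rw [hpc i, hpc j, map_sub, map_add, map_neg, ← hx]
        abel⟩
    simp only [hc, h1]
  let χ : L → AddMonoidAlgebra R L := fun x => AddMonoidAlgebra.single x 1
  have hχ : ∀ x, χ x ∈ degGr R ψ (ψ x) := fun x => single_mem_degGr rfl 1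
  have hχχ : ∀ x, χ x * χ (-x) = 1 := single_mul_single_neg
  let U : Matrix (Fin n) (Fin n) (AddMonoidAlgebra R L) := Matrix.of fun i j => e i j * χ (z j)
  let V : Matrix (Fin n) (Fin n) (AddMonoidAlgebra R L) := Matrix.of fun i j => χ (-z i) * e i j
  have hUV : U * V = e := by
    ext1 i j
    conv_rhs => rw [← hee]
    rw [Matrix.mul_apply, Matrix.mul_apply]
    refine Finset.sum_congr rfl fun k _ => ?_
    simp only [U, V, Matrix.of_apply]
    linear_combination (e i k * e k j) * hχχ (z k)
  have hU : IsHom (degGr R ψ) p c U := fun i j =>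
    mul_mem_of_eq (he i j) (hχ _) (by rw [hpc j]; abel)
  have hV : IsHom (degGr R ψ) c p V := fun i j =>
    mul_mem_of_eq (hχ _) (he i j) (by rw [hpc i, map_neg]; abel)
  have heU : e * U = U := by
    ext1 i j
    simp only [U, Matrix.of_apply]
    conv_rhs => rw [← hee]
    simp only [Matrix.mul_apply, Matrix.of_apply, Finset.sum_mul, mul_assoc]
  refine GTriv.of_gequiv hee ⟨U, V, hU, hV, hUV, rfl⟩ ?_
  let ι := AddMonoidAlgebra.mapDomainRingHom R ψ.ker.subtype
  have hι : Function.Injective ι := mapDomainRingHom_injective ψ.ker.subtype_injective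
  have hVU := hV.mul hU
  have hdeg : ∀ i j m, ((V * U) i j).coeff m ≠ 0 → c i = c j ∧ m ∈ ψ.ker := by
    intro i j m hm
    have h1 := hVU i j m hm
    have h2 := hcc i j m h1.symm
    exact ⟨h2, by rw [AddMonoidHom.mem_ker, h1, h2, sub_self]⟩
  have hlift : ∀ i j, ∃ b, ι b = (V * U) i j := fun i j =>
    exists_mapDomain_eq ψ.ker.subtype_injective fun m hm => ⟨⟨m, (hdeg i j m hm).2⟩, rfl⟩
  choose f hf using hlift
  have hf' : (Matrix.of f).map ι = V * U := by
    ext1 i j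
    exact hf i j
  have hff : Matrix.of f * Matrix.of f = Matrix.of f := by
    apply Matrix.map_injective hι
    change Matrix.map _ ι = Matrix.map _ ι
    rw [Matrix.map_mul, hf', Matrix.mul_assoc, ← Matrix.mul_assoc U, hUV, heU]
  have hfh : IsHom (zeroGr P _) c c (Matrix.of f) := by
    intro i j hij
    by_contra hne
    refine hij (sub_eq_zero.mpr ?_)
    have h1 : (V * U) i j ≠ 0 := by
      rw [← hf]
      exact (map_ne_zero_iff ι hι).mpr hne
    by_contra hcij
    apply h1
    apply AddMonoidAlgebra.coeff_injective
    refine Finsupp.ext fun m => ?_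
    by_contra hm
    exact hcij (hdeg i j m hm).1
  rw [← hf']
  refine (hK n c _ hfh hff).map ι fun d a ha m hm => ?_
  obtain ⟨x, rfl, hx⟩ := exists_of_coeff_mapDomainRingHom hm
  by_contra hd
  have hd' : d ≠ 0 := fun h => hd (by rw [h]; exact x.2)
  rw [ha hd'] at hx
  exact hx rfl

end Degree

end GradedMatrix

namespace GradedMatrix

open Matrix Polynomial

section Induction

variable {P : Type*} [AddCommGroup P] {R : Type*} [CommRing R] {M N : Type*} [AddCommMonoid M]
  [AddCommMonoid N]

theorem AllTriv.degGr_of_addEquiv (ε : M ≃+ N) {deg : N →+ P}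
    (h : AllTriv (degGr R (deg.comp ε.toAddMonoidHom))) : AllTriv (degGr R deg) := by
  have hε : Function.Injective ε.toAddMonoidHom := ε.injective
  let φ : AddMonoidAlgebra R M ≃+* AddMonoidAlgebra R N := RingEquiv.ofBijective
    (AddMonoidAlgebra.mapDomainRingHom R ε.toAddMonoidHom) ⟨mapDomainRingHom_injective hε,
      fun b => exists_mapDomain_eq hε fun m _ => ε.surjective m⟩
  refine h.of_ringEquiv φ (fun c a ha m hm => ?_) (fun c b hb m hm => ?_)
  · obtain ⟨m, rfl, hm'⟩ := exists_of_coeff_mapDomainRingHom hm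
    exact ha m hm'
  · refine hb (ε m) ?_
    rw [← φ.apply_symm_apply b]
    exact (coeff_mapDomainRingHom hε _ m).trans_ne hm

theorem hasZeroProj_degGr (deg : M →+ P) : HasZeroProj (degGr R deg) := by
  classical
  let 𝒜 := AddMonoidAlgebra.gradeBy R deg
  have h𝒜 : ∀ {c a}, a ∈ degGr R deg c ↔ a ∈ 𝒜 c := fun {c a} => by
    rw [degGr_eq_gradeBy, Submodule.mem_toAddSubgroup]
  refine ⟨GradedRing.proj 𝒜 0, fun a ha => DirectSum.decompose_of_mem_same 𝒜 (h𝒜.mp ha),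
    fun a => h𝒜.mpr (SetLike.coe_mem _), fun c a ha b => ⟨GradedRing.proj 𝒜 (-c) b,
      h𝒜.mpr (SetLike.coe_mem _), ?_⟩⟩
  rw [← add_neg_cancel c]
  exact DirectSum.coe_decompose_mul_add_of_left_mem 𝒜 (h𝒜.mp ha)

variable (R M) in
/-- Polynomials over a monoid algebra form a monoid algebra. -/
noncomputable def polyEquiv : AddMonoidAlgebra R (ℕ × M) ≃+* (AddMonoidAlgebra R M)[X] :=
  AddMonoidAlgebra.curryRingEquiv.trans (toFinsuppIso (AddMonoidAlgebra R M)).symm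

theorem polyEquiv_symm_X_pow (n : ℕ) :
    (polyEquiv R M).symm (X ^ n) = AddMonoidAlgebra.single (n, 0) 1 := by
  rw [RingEquiv.symm_apply_eq, polyEquiv, RingEquiv.trans_apply,
    AddMonoidAlgebra.curryRingEquiv_single, RingEquiv.eq_symm_apply, toFinsuppIso_apply,
    toFinsupp_X_pow]
  rfl

theorem polyEquiv_mem {deg : ℕ × M →+ P} {c : P} {a : AddMonoidAlgebra R (ℕ × M)} :
    polyEquiv R M a ∈ polyGr (degGr R (deg.comp (AddMonoidHom.inr ℕ M))) (deg (1, 0)) c ↔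
      a ∈ degGr R deg c := by
  have hdeg : ∀ n m, deg (n, m) = deg (0, m) + n • deg (1, 0) := fun n m => by
    rw [← map_nsmul, ← map_add]
    simp
  have key : (∀ n m, a.coeff (n, m) ≠ 0 → deg (0, m) = c - n • deg (1, 0)) ↔
      a ∈ degGr R deg c := by
    refine ⟨fun h x hx => ?_, fun h n m hm => ?_⟩
    · rw [← Prod.mk.eta (p := x), hdeg, h x.1 x.2 hx, sub_add_cancel]
    · rw [← h _ hm, hdeg n m, add_sub_cancel_right]
  exact key

variable (M) in
/-- The inclusion of monoids inverting the first coordinate. -/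
def natToInt : ℕ × M →+ ℤ × M := AddMonoidHom.prodMap (Nat.castAddMonoidHom ℤ) (AddMonoidHom.id M)

theorem natToInt_injective : Function.Injective (natToInt M) :=
  Nat.cast_injective.prodMap Function.injective_id

variable (R M) in
/-- The inclusion of polynomials into Laurent polynomials. -/
noncomputable def polyToLaurent : (AddMonoidAlgebra R M)[X] →+* AddMonoidAlgebra R (ℤ × M) :=
  (AddMonoidAlgebra.mapDomainRingHom R (natToInt M)).comp (polyEquiv R M).symm.toRingHom

theorem polyToLaurent_injective : Function.Injective (polyToLaurent R M) :=
  (mapDomainRingHom_injective natToInt_injective).comp (polyEquiv R M).symm.injective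

theorem polyToLaurent_X_pow (n : ℕ) :
    polyToLaurent R M (X ^ n) = AddMonoidAlgebra.single ((n : ℤ), 0) 1 := by
  change AddMonoidAlgebra.mapDomainRingHom R (natToInt M) ((polyEquiv R M).symm (X ^ n)) = _
  rw [polyEquiv_symm_X_pow]
  exact AddMonoidAlgebra.mapDomain_single

theorem polyToLaurent_mem {deg : ℤ × M →+ P} {c : P} {f : (AddMonoidAlgebra R M)[X]} :
    f ∈ polyGr (degGr R (deg.comp (AddMonoidHom.inr ℤ M))) (deg (1, 0)) c ↔
      polyToLaurent R M f ∈ degGr R deg c := by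
  have h1 := polyEquiv_mem (deg := deg.comp (natToInt M)) (c := c) (a := (polyEquiv R M).symm f)
  rw [RingEquiv.apply_symm_apply] at h1
  refine Iff.trans h1 ⟨fun h m hm => ?_, fun h m hm => ?_⟩
  · obtain ⟨m, rfl, hm'⟩ := exists_of_coeff_mapDomainRingHom hm
    exact h m hm'
  · exact h (natToInt M m) ((coeff_mapDomainRingHom natToInt_injective _ m).trans_ne hm)

theorem exists_polyToLaurent_eq (a : AddMonoidAlgebra R (ℤ × M)) : ∃ K : ℕ, ∀ k ≥ K, ∃ f,
    polyToLaurent R M f = polyToLaurent R M (X ^ k) * a := by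
  induction a using AddMonoidAlgebra.induction_linear with
  | zero => exact ⟨0, fun _ _ => ⟨0, by simp⟩⟩
  | single m r =>
    refine ⟨(-m.1).toNat, fun k hk => ⟨polyEquiv R M (AddMonoidAlgebra.single
      ((k + m.1).toNat, m.2) r), ?_⟩⟩
    rw [polyToLaurent_X_pow, AddMonoidAlgebra.single_mul_single, one_mul]
    change AddMonoidAlgebra.mapDomainRingHom R (natToInt M) ((polyEquiv R M).symm _) = _
    rw [RingEquiv.symm_apply_apply]
    refine AddMonoidAlgebra.mapDomain_single.trans (congrArg (AddMonoidAlgebra.single · r) ?_)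
    refine Prod.ext ?_ (zero_add _).symm
    change (((k + m.1).toNat : ℕ) : ℤ) = k + m.1
    lia
  | add a b ha hb =>
    obtain ⟨K, hK⟩ := ha
    obtain ⟨K', hK'⟩ := hb
    refine ⟨K + K', fun k hk => ?_⟩
    obtain ⟨f, hf⟩ := hK k (by lia)
    obtain ⟨g, hg⟩ := hK' k (by lia)
    exact ⟨f + g, by rw [map_add, hf, hg, mul_add]⟩

theorem exists_polyToLaurent_map_eq {ι κ : Type*} [Finite ι] [Finite κ]
    (U : Matrix ι κ (AddMonoidAlgebra R (ℤ × M))) : ∃ K : ℕ, ∀ k ≥ K,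
      ∃ V : Matrix ι κ (AddMonoidAlgebra R M)[X],
        V.map (polyToLaurent R M) = polyToLaurent R M (X ^ k) • U := by
  cases nonempty_fintype ι
  cases nonempty_fintype κ
  choose K hK using fun x : ι × κ => exists_polyToLaurent_eq (U x.1 x.2)
  refine ⟨∑ x, K x, fun k hk => ?_⟩
  choose V hV using fun x => hK x k ((Finset.single_le_sum (fun _ _ => Nat.zero_le _)
    (Finset.mem_univ x)).trans hk)
  refine ⟨Matrix.of fun i j => V (i, j), ?_⟩
  ext1 i j
  exact hV (i, j)

theorem AllTriv.poly_of_laurent [IsDomain R] [UniqueSums M] {deg : ℤ × M →+ P}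
    (h1 : AllTriv (degGr R (deg.comp (AddMonoidHom.inr ℤ M)))) (h2 : AllTriv (degGr R deg)) :
    AllTriv (polyGr (degGr R (deg.comp (AddMonoidHom.inr ℤ M))) (deg (1, 0))) := by
  intro n p e he hee
  set x := deg (1, 0) with hx
  obtain ⟨r, w, U, V, hU, hV, hUV, hVU⟩ := h2 n p (e.map (polyToLaurent R M))
    (he.map _ fun c f hf => polyToLaurent_mem.mp hf) (by rw [← Matrix.map_mul, hee])
  obtain ⟨K₁, h₁⟩ := exists_polyToLaurent_map_eq U
  obtain ⟨K₂, h₂⟩ := exists_polyToLaurent_map_eq V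
  obtain ⟨K, hK₁, hK₂⟩ : ∃ K, K₁ ≤ K ∧ K₂ ≤ K := ⟨K₁ + K₂, by lia, by lia⟩
  obtain ⟨U', hU'⟩ := h₁ K hK₁
  obtain ⟨V', hV'⟩ := h₂ K hK₂
  have hXK : polyToLaurent R M (X ^ K) ∈ degGr R deg (K • x) :=
    polyToLaurent_mem.mp (X_pow_mem K)
  have hnat : ((X ^ (K + K) : (AddMonoidAlgebra R M)[X])).natDegree = K + K := natDegree_X_pow _
  refine gTriv_of_monic (hasZeroProj_degGr _) he hee (w := fun j => w j - K • x)
    (HMonic.X_pow (K + K)) (U := U') (V := V') (fun i j => ?_) (fun i j => ?_)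
    (Matrix.map_injective polyToLaurent_injective ?_)
    (Matrix.map_injective polyToLaurent_injective ?_)
    (h1.gTriv (he.map _ fun c f hf => coeff_zero_mem hf) (by rw [← Matrix.map_mul, hee]))
  · refine polyToLaurent_mem.mpr ?_
    rw [show polyToLaurent R M (U' i j) = _ from congrFun (congrFun hU' i) j]
    exact mul_mem_of_eq hXK (hU i j) (by dsimp only; generalize K • x = y; abel)
  · refine polyToLaurent_mem.mpr ?_
    rw [show polyToLaurent R M (V' i j) = _ from congrFun (congrFun hV' i) j, hnat]
    exact mul_mem_of_eq hXK (hV i j) (by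
      dsimp only; rw [add_smul]; generalize K • x = y; abel)
  · change Matrix.map _ (polyToLaurent R M) = Matrix.map _ (polyToLaurent R M)
    rw [Matrix.map_mul, hU', hV', map_smul', Matrix.smul_mul, Matrix.mul_smul, smul_smul, hUV,
      ← map_mul, pow_add]
  · change Matrix.map _ (polyToLaurent R M) = Matrix.map _ (polyToLaurent R M)
    rw [Matrix.map_mul, hU', hV', map_smul', Matrix.smul_mul, Matrix.mul_smul, smul_smul, hVU,
      ← map_mul, pow_add]
    simp

theorem AllTriv.nat_prod [IsDomain R] [UniqueSums M] (deg : ℕ × M →+ P)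
    (h1 : AllTriv (degGr R (deg.comp (AddMonoidHom.inr ℕ M))))
    (h2 : ∀ deg' : ℤ × M →+ P, AllTriv (degGr R deg')) : AllTriv (degGr R deg) := by
  let deg' : ℤ × M →+ P :=
    (zmultiplesHom P (deg (1, 0))).coprod (deg.comp (AddMonoidHom.inr ℕ M))
  have hinr : deg'.comp (AddMonoidHom.inr ℤ M) = deg.comp (AddMonoidHom.inr ℕ M) := by
    ext m
    simp [deg']
  have h10 : deg' (1, 0) = deg (1, 0) := by
    simp only [deg', AddMonoidHom.coprod_apply, map_zero, add_zero]
    exact one_zsmul _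
  have h3 : AllTriv (polyGr (degGr R (deg'.comp (AddMonoidHom.inr ℤ M))) (deg' (1, 0))) :=
    AllTriv.poly_of_laurent (by rwa [hinr]) (h2 _)
  rw [hinr, h10] at h3
  refine h3.of_ringEquiv (polyEquiv R M).symm (fun c f hf => polyEquiv_mem.mp ?_)
    fun c a ha => polyEquiv_mem.mpr ha
  rwa [RingEquiv.apply_symm_apply]

theorem uniqueSums_of_free (L : Type*) [AddCommGroup L] [Module.Free ℤ L] [Module.Finite ℤ L] :
    UniqueSums L :=
  UniqueSums.of_injective_addHom (Module.finBasis ℤ L).equivFun.toAddEquiv.toAddHom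
    (Module.finBasis ℤ L).equivFun.injective inferInstance

theorem allTriv_degGr_prod (R : Type*) [CommRing R] [IsDomain R] [IsPrincipalIdealRing R]
    (q : ℕ) : ∀ (L : Type*) [AddCommGroup L] [Module.Free ℤ L] [Module.Finite ℤ L]
      (deg : L × (Fin q → ℕ) →+ P), AllTriv (degGr R deg) := by
  induction q with
  | zero =>
    intro L _ _ _ deg
    exact (allTriv_degGr_free R _).degGr_of_addEquiv (AddEquiv.prodUnique (N := Fin 0 → ℕ)).symm
  | succ q ih =>
    intro L _ _ _ deg
    have := uniqueSums_of_free L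
    let ε : ℕ × (L × (Fin q → ℕ)) ≃+ L × (Fin (q + 1) → ℕ) :=
      { toFun := fun x => (x.2.1, Fin.cons x.1 x.2.2)
        invFun := fun y => (y.2 0, y.1, Fin.tail y.2)
        left_inv := fun x => by simp
        right_inv := fun y => by simp
        map_add' := fun x y => by
          refine Prod.ext rfl (funext fun i => ?_)
          refine Fin.cases ?_ (fun i => ?_) i <;> simp }
    refine AllTriv.degGr_of_addEquiv ε (AllTriv.nat_prod _ (ih L _) fun deg' => ?_)
    exact (ih (ℤ × L) _).degGr_of_addEquiv AddEquiv.prodAssoc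

end Induction

end GradedMatrix

namespace GradedMatrix

open Matrix

section Cone

variable {P : Type*} [AddCommGroup P] {R : Type*} [CommRing R] {L : Type*} [AddCommGroup L]
  {S : AddSubmonoid L} {q : ℕ} {l : Fin q → L →+ ℤ}

theorem exists_add_eq_of_coeff_mul {M : Type*} [AddCommMonoid M] {a b : AddMonoidAlgebra R M}
    {m : M} (h : (a * b).coeff m ≠ 0) : ∃ x y, x + y = m ∧ a.coeff x ≠ 0 ∧ b.coeff y ≠ 0 := by
  classical
  obtain ⟨x, hx, y, hy, rfl⟩ := Finset.mem_add.mp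
    (AddMonoidAlgebra.support_coeff_mul_subset a b (Finsupp.mem_support_iff.mpr h))
  exact ⟨x, y, rfl, Finsupp.mem_support_iff.mp hx, Finsupp.mem_support_iff.mp hy⟩

/-- Lattice points of a cone together with their slacks. -/
def slackHom (hS : ∀ m ∈ S, ∀ i, 0 ≤ l i m) : S →+ L × (Fin q → ℕ) where
  toFun z := (z, fun i => (l i z).toNat)
  map_zero' := by
    refine Prod.ext rfl (funext fun i => ?_)
    simp
  map_add' x y := by
    refine Prod.ext rfl (funext fun i => ?_)
    have hx := hS _ x.2 i
    have hy := hS _ y.2 i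
    simp only [AddSubmonoid.coe_add, map_add, Prod.snd_add, Pi.add_apply]
    lia

theorem slackHom_injective (hS : ∀ m ∈ S, ∀ i, 0 ≤ l i m) :
    Function.Injective (slackHom hS) := fun _ _ h => Subtype.ext (congrArg Prod.fst h)

variable (l) in
/-- The degree on `L × ℕ^q` whose component of degree `0` in the second factor consists of the
pairs of a lattice point and its slacks. -/
def slackDeg (ψ : L →+ P) : L × (Fin q → ℕ) →+ P × (Fin q → ℤ) where
  toFun x := (ψ x.1, fun i => x.2 i - l i x.1)
  map_zero' := by
    refine Prod.ext (map_zero ψ) (funext fun i => ?_)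
    simp
  map_add' x y := by
    refine Prod.ext (map_add ψ _ _) (funext fun i => ?_)
    simp only [Prod.fst_add, Prod.snd_add, Pi.add_apply, map_add]
    lia

theorem slackDeg_slackHom (hS : ∀ m ∈ S, ∀ i, 0 ≤ l i m) (ψ : L →+ P) (z : S) :
    slackDeg l ψ (slackHom hS z) = (ψ z, 0) := by
  refine Prod.ext rfl (funext fun i => ?_)
  have hz := hS _ z.2 i
  change (((l i z).toNat : ℕ) : ℤ) - l i z = 0
  lia

theorem mem_degGr_slack (hS : ∀ m ∈ S, ∀ i, 0 ≤ l i m) {ψ : L →+ P} {c : P}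
    {a : AddMonoidAlgebra R S} (ha : a ∈ degGr R (ψ.comp S.subtype) c) :
    AddMonoidAlgebra.mapDomainRingHom R (slackHom hS) a ∈ degGr R (slackDeg l ψ) (c, 0) := by
  intro m hm
  obtain ⟨z, rfl, hz⟩ := exists_of_coeff_mapDomainRingHom hm
  rw [slackDeg_slackHom]
  exact Prod.ext (ha z hz) rfl

theorem exists_mem_degGr_of_slack (hS : ∀ m, m ∈ S ↔ ∀ i, 0 ≤ l i m) {ψ : L →+ P} {c : P}
    {a : AddMonoidAlgebra R (L × (Fin q → ℕ))} (ha : a ∈ degGr R (slackDeg l ψ) (c, 0)) :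
    ∃ b ∈ degGr R (ψ.comp S.subtype) c,
      AddMonoidAlgebra.mapDomainRingHom R (slackHom fun m => (hS m).mp) b = a := by
  obtain ⟨b, rfl⟩ := exists_mapDomain_eq (slackHom_injective fun m => (hS m).mp) (a := a)
    fun m hm => by
      have h1 : ∀ i, (m.2 i : ℤ) - l i m.1 = 0 := fun i =>
        congrFun (congrArg Prod.snd (ha m hm)) i
      refine ⟨⟨m.1, (hS _).mpr fun i => by have := h1 i; lia⟩, Prod.ext rfl (funext fun i => ?_)⟩
      have := h1 i
      change (l i m.1).toNat = m.2 i
      lia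
  refine ⟨b, fun z hz => ?_, rfl⟩
  have := ha (slackHom (fun m => (hS m).mp) z)
    ((coeff_mapDomainRingHom (slackHom_injective _) _ _).trans_ne hz)
  rw [slackDeg_slackHom] at this
  exact congrArg Prod.fst this

theorem allTriv_degGr_cone [IsDomain R] [IsPrincipalIdealRing R] [Module.Free ℤ L]
    [Module.Finite ℤ L] (hS : ∀ m, m ∈ S ↔ ∀ i, 0 ≤ l i m) (ψ : L →+ P) :
    AllTriv (degGr R (ψ.comp S.subtype)) := by
  intro n p e he hee
  set φ := AddMonoidAlgebra.mapDomainRingHom R (slackHom fun m => (hS m).mp) with hφ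
  have hinj : Function.Injective φ := mapDomainRingHom_injective (slackHom_injective _)
  obtain ⟨r, w, U, V, hU, hV, hUV, hVU⟩ := allTriv_degGr_prod R q L (slackDeg l ψ) n
    (fun i => (p i, 0)) (e.map φ) (fun i j => by
      have := mem_degGr_slack (fun m => (hS m).mp) (he i j)
      exact mem_of_eq this (Prod.ext rfl (sub_zero _).symm)) (by rw [← Matrix.map_mul, hee])
  have hz : ∀ j, ∃ z : L, ∀ k, (w j).2 k = l k z := fun j => by
    have h1 : ((V * U) j j).coeff 0 ≠ 0 := by
      rw [hVU, Matrix.one_apply_eq]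
      exact (Finsupp.single_eq_same).trans_ne one_ne_zero
    rw [Matrix.mul_apply, AddMonoidAlgebra.coeff_sum, Finsupp.finsetSum_apply] at h1
    obtain ⟨i, -, hi⟩ := Finset.exists_ne_zero_of_sum_ne_zero h1
    obtain ⟨x, y, hxy, -, hy⟩ := exists_add_eq_of_coeff_mul hi
    refine ⟨y.1, fun k => ?_⟩
    have h2 : (y.2 k : ℤ) - l k y.1 = 0 - (w j).2 k :=
      congrFun (congrArg Prod.snd (hU i j y hy)) k
    have h3 : x.2 k + y.2 k = 0 := congrFun (congrArg Prod.snd hxy) k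
    lia
  choose z hz using hz
  have hdeg : ∀ (t : L), slackDeg l ψ (t, 0) = (ψ t, fun k => - l k t) := fun t =>
    Prod.ext rfl (funext fun k => zero_sub _)
  have hχ : ∀ t : L, (AddMonoidAlgebra.single (t, 0) 1 * AddMonoidAlgebra.single (-t, 0) 1 :
      AddMonoidAlgebra R (L × (Fin q → ℕ))) = 1 := fun t => by
    rw [AddMonoidAlgebra.single_mul_single, one_mul, Prod.mk_add_mk, add_neg_cancel, add_zero]
    rfl
  have hU' : ∀ i j, ∃ b ∈ degGr R (ψ.comp S.subtype) (p i - ((w j).1 + ψ (z j))),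
      φ b = U i j * AddMonoidAlgebra.single (-z j, 0) 1 := fun i j => by
    refine exists_mem_degGr_of_slack hS (mul_mem_of_eq (hU i j)
      (single_mem_degGr (hdeg _) 1) (Prod.ext ?_ (funext fun k => ?_)))
    · change p i - (w j).1 + ψ (-z j) = p i - ((w j).1 + ψ (z j))
      rw [map_neg]
      abel
    · change 0 - (w j).2 k + - l k (-z j) = 0
      rw [hz, map_neg]
      lia
  have hV' : ∀ j i, ∃ b ∈ degGr R (ψ.comp S.subtype) ((w j).1 + ψ (z j) - p i),
      φ b = AddMonoidAlgebra.single (z j, 0) 1 * V j i := fun j i => by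
    refine exists_mem_degGr_of_slack hS (mul_mem_of_eq (single_mem_degGr (hdeg _) 1) (hV j i)
      (Prod.ext ?_ (funext fun k => ?_)))
    · change ψ (z j) + ((w j).1 - p i) = (w j).1 + ψ (z j) - p i
      abel
    · change - l k (z j) + ((w j).2 k - 0) = 0
      rw [hz]
      lia
  choose U' hU' hφU using hU'
  choose V' hV' hφV using hV'
  refine ⟨r, fun j => (w j).1 + ψ (z j), Matrix.of U', Matrix.of V', hU', hV',
    Matrix.map_injective hinj ?_, Matrix.map_injective hinj ?_⟩
  · change Matrix.map _ φ = Matrix.map _ φ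
    rw [← hUV, Matrix.map_mul]
    ext1 i k
    rw [Matrix.mul_apply, Matrix.mul_apply]
    refine Finset.sum_congr rfl fun j _ => ?_
    change φ (U' i j) * φ (V' j k) = _
    rw [hφU, hφV, mul_assoc, ← mul_assoc (AddMonoidAlgebra.single (-z j, 0) 1),
      mul_comm (AddMonoidAlgebra.single (-z j, 0) 1), hχ, one_mul]
  · change Matrix.map _ φ = Matrix.map _ φ
    rw [Matrix.map_mul, Matrix.map_one _ (map_zero φ) (map_one φ)]
    ext1 j k
    have h1 : (Matrix.map (Matrix.of V') φ * Matrix.map (Matrix.of U') φ) j k =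
        AddMonoidAlgebra.single (z j, 0) 1 * (V * U) j k * AddMonoidAlgebra.single (-z k, 0) 1 := by
      simp only [Matrix.mul_apply, Matrix.map_apply, Matrix.of_apply, hφU, hφV, Finset.mul_sum,
        Finset.sum_mul, mul_assoc]
    rw [h1, hVU]
    obtain rfl | hjk := eq_or_ne j k
    · rw [Matrix.one_apply_eq, mul_one, hχ]
    · rw [Matrix.one_apply_ne hjk, mul_zero, zero_mul]

theorem exists_int_forms {L : Type*} [AddCommGroup L] [Module.Finite ℤ L] (l : L →+ ℚ) :
    ∃ l' : L →+ ℤ, ∀ m, 0 ≤ l' m ↔ 0 ≤ l m := by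
  obtain ⟨s, hs⟩ := Module.Finite.fg_top (R := ℤ) (M := L)
  obtain ⟨b, hb⟩ := IsLocalization.exist_integer_multiples_of_finset (nonZeroDivisors ℤ)
    (s.image l)
  have hb0 : (b : ℤ) ≠ 0 := nonZeroDivisors.coe_ne_zero b
  have h1 : ∀ m, ∃ k : ℤ, (k : ℚ) = |(b : ℤ)| * l m := fun m => by
    have hm : m ∈ Submodule.span ℤ (s : Set L) := hs ▸ Submodule.mem_top
    induction hm using Submodule.span_induction with
    | mem x hx =>
      obtain ⟨k, hk⟩ := hb (l x) (Finset.mem_image_of_mem l hx)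
      have hk' : (k : ℚ) = (b : ℤ) * l x := by simpa using hk
      obtain h | h := abs_choice (b : ℤ)
      · exact ⟨k, by rw [h, hk']⟩
      · exact ⟨-k, by rw [h]; push_cast; rw [hk']; ring⟩
    | zero => exact ⟨0, by simp⟩
    | add x y _ _ hx hy =>
      obtain ⟨k, hk⟩ := hx
      obtain ⟨k', hk'⟩ := hy
      exact ⟨k + k', by rw [map_add]; push_cast; rw [hk, hk']; push_cast; ring⟩
    | smul a x _ hx =>
      obtain ⟨k, hk⟩ := hx
      exact ⟨a * k, by rw [map_zsmul]; push_cast; rw [hk]; push_cast; rw [zsmul_eq_mul]; ring⟩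
  choose f hf using h1
  have hpos : (0 : ℚ) < |(b : ℤ)| := by exact_mod_cast abs_pos.mpr hb0
  refine ⟨AddMonoidHom.mk' f fun x y => ?_, fun m => ?_⟩
  · have : (f (x + y) : ℚ) = f x + f y := by rw [hf, hf, hf, map_add, mul_add]
    exact_mod_cast this
  · rw [AddMonoidHom.mk'_apply, ← Int.cast_nonneg_iff (R := ℚ), hf, mul_nonneg_iff_of_pos_left hpos]

end Cone

end GradedMatrix

namespace GradedMatrix

open Matrix
open scoped TensorProduct

section Component

variable {R A P M : Type*} [CommRing R] [CommRing A] [DecidableEq P] [AddCommGroup M]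
  [Module R M] [Module A M] {ℳ : P → Submodule R M} [DirectSum.Decomposition ℳ]

variable (ℳ) in
/-- The homogeneous component of degree `c`. -/
def comp (c : P) : M →+ M :=
  (ℳ c).subtype.toAddMonoidHom.comp
    ((DFinsupp.evalAddMonoidHom c).comp (DirectSum.decomposeAddEquiv ℳ).toAddMonoidHom)

theorem comp_mem (c : P) (m : M) : comp ℳ c m ∈ ℳ c := SetLike.coe_mem _

theorem comp_of_mem {c : P} {m : M} (hm : m ∈ ℳ c) : comp ℳ c m = m :=
  DirectSum.decompose_of_mem_same ℳ hm

theorem comp_of_mem_ne {c d : P} {m : M} (hm : m ∈ ℳ c) (h : c ≠ d) : comp ℳ d m = 0 :=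
  DirectSum.decompose_of_mem_ne ℳ hm h

theorem eq_zero_of_comp {m : M} (h : ∀ c, comp ℳ c m = 0) : m = 0 := by
  classical
  rw [← DirectSum.sum_support_decompose ℳ m]
  exact Finset.sum_eq_zero fun c _ => h c

variable (ℳ) in
theorem exists_homogeneous_generators [Module.Finite A M] :
    ∃ (n : ℕ) (p : Fin n → P) (g : Fin n → M), (∀ i, g i ∈ ℳ (p i)) ∧
      Submodule.span A (Set.range g) = ⊤ := by
  classical
  obtain ⟨s, hs⟩ := Module.Finite.fg_top (R := A) (M := M)
  let t : Finset (P × M) := s.biUnion fun m =>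
    (DirectSum.decompose ℳ m).support.image fun c => (c, comp ℳ c m)
  have ht : ∀ x ∈ t, x.2 ∈ ℳ x.1 := fun x hx => by
    obtain ⟨m, -, hx⟩ := Finset.mem_biUnion.mp hx
    obtain ⟨c, -, rfl⟩ := Finset.mem_image.mp hx
    exact comp_mem c m
  refine ⟨t.card, fun i => (t.equivFin.symm i).1.1, fun i => (t.equivFin.symm i).1.2,
    fun i => ht _ (t.equivFin.symm i).2, top_unique (hs ▸ Submodule.span_le.mpr fun m hm => ?_)⟩
  rw [SetLike.mem_coe, ← DirectSum.sum_support_decompose ℳ m]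
  refine Submodule.sum_mem _ fun c hc => Submodule.subset_span ?_
  have hct : (c, comp ℳ c m) ∈ t :=
    Finset.mem_biUnion.mpr ⟨m, hm, Finset.mem_image_of_mem _ hc⟩
  refine ⟨t.equivFin ⟨_, hct⟩, ?_⟩
  dsimp only
  rw [Equiv.symm_apply_apply]
  rfl

variable [Algebra R A] [AddCommGroup P] {𝒜 : P → Submodule R A}

theorem comp_smul_of_left_mem (hs : ∀ {a b : P} {x : A} {m : M}, x ∈ 𝒜 a → m ∈ ℳ b →
    x • m ∈ ℳ (a + b)) {c d : P} {a : A} (ha : a ∈ 𝒜 d) (m : M) :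
    comp ℳ c (a • m) = a • comp ℳ (c - d) m := by
  induction m using DirectSum.Decomposition.inductionOn ℳ with
  | zero => simp
  | @homogeneous b m =>
    by_cases h : b = c - d
    · subst h
      have h1 := hs ha m.2
      rw [add_sub_cancel] at h1
      rw [comp_of_mem m.2, comp_of_mem h1]
    · rw [comp_of_mem_ne m.2 h, comp_of_mem_ne (hs ha m.2)
        fun h1 => h (eq_sub_of_add_eq' h1), smul_zero]
  | add m m' h h' => rw [smul_add, map_add, map_add, smul_add, h, h']

variable [GradedAlgebra 𝒜]

theorem comp_smul_of_right_mem (hs : ∀ {a b : P} {x : A} {m : M}, x ∈ 𝒜 a → m ∈ ℳ b →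
    x • m ∈ ℳ (a + b)) {c d : P} (a : A) {m : M} (hm : m ∈ ℳ d) :
    comp ℳ c (a • m) = comp 𝒜 (c - d) a • m := by
  induction a using DirectSum.Decomposition.inductionOn 𝒜 with
  | zero => simp
  | @homogeneous b a =>
    by_cases h : b = c - d
    · subst h
      have h1 := hs a.2 hm
      rw [sub_add_cancel] at h1
      rw [comp_of_mem a.2, comp_of_mem h1]
    · rw [comp_of_mem_ne a.2 h, comp_of_mem_ne (hs a.2 hm)
        fun h1 => h (eq_sub_of_add_eq h1), zero_smul]
  | add m m' h h' => rw [add_smul, map_add, map_add, add_smul, h, h']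

theorem comp_mul_of_left_mem {c d : P} {a : A} (ha : a ∈ 𝒜 d) (b : A) :
    comp 𝒜 c (a * b) = a * comp 𝒜 (c - d) b :=
  comp_smul_of_left_mem (ℳ := 𝒜) (fun hx hy => SetLike.mul_mem_graded hx hy) ha b

theorem comp_mul_of_right_mem {c d : P} (a : A) {b : A} (hb : b ∈ 𝒜 d) :
    comp 𝒜 c (a * b) = comp 𝒜 (c - d) a * b :=
  comp_smul_of_right_mem (ℳ := 𝒜) (fun hx hy => SetLike.mul_mem_graded hx hy) a hb

/-- A finite projective graded module is defined by a homogeneous idempotent matrix. -/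
theorem exists_idempotent (hs : ∀ {a b : P} {x : A} {m : M}, x ∈ 𝒜 a → m ∈ ℳ b →
    x • m ∈ ℳ (a + b)) [Module.Projective A M] {n : ℕ} {p : Fin n → P} {g : Fin n → M}
    (hg : ∀ i, g i ∈ ℳ (p i)) (hspan : Submodule.span A (Set.range g) = ⊤) :
    ∃ e : Matrix (Fin n) (Fin n) A, IsHom (fun c => (𝒜 c).toAddSubgroup) p p e ∧ e * e = e ∧
      (∀ i, ∑ j, e i j • g j = g i) ∧ ∀ x : Fin n → A, ∑ i, x i • g i = 0 → x ᵥ* e = 0 := by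
  have hsurj : Function.Surjective (Fintype.linearCombination A g) := by
    rw [← LinearMap.range_eq_top, Fintype.range_linearCombination, hspan]
  obtain ⟨s, hsec⟩ := Module.projective_lifting_property (Fintype.linearCombination A g)
    LinearMap.id hsurj
  have hT : ∀ i, ∑ j, s (g i) j • g j = g i := fun i => by
    simpa [Fintype.linearCombination_apply] using LinearMap.congr_fun hsec (g i)
  have hTK : ∀ x : Fin n → A, ∑ i, x i • g i = 0 → ∀ j, ∑ i, x i * s (g i) j = 0 := by
    intro x hx j
    have := congrFun (congrArg s hx) j
    simpa [map_sum, Finset.sum_apply] using this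
  let e : Matrix (Fin n) (Fin n) A := Matrix.of fun i j => comp 𝒜 (p i - p j) (s (g i) j)
  have he : ∀ i j, e i j = comp 𝒜 (p i - p j) (s (g i) j) := fun i j => rfl
  have heg : ∀ i, ∑ j, e i j • g j = g i := fun i => by
    have := congrArg (comp ℳ (p i)) (hT i)
    rw [map_sum, comp_of_mem (hg i)] at this
    rw [← this]
    exact Finset.sum_congr rfl fun j _ => (comp_smul_of_right_mem (𝒜 := 𝒜) hs _ (hg j)).symm
  have hK : ∀ x : Fin n → A, ∑ i, x i • g i = 0 → x ᵥ* e = 0 := by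
    intro x hx
    refine funext fun j => eq_zero_of_comp (ℳ := 𝒜) fun d => ?_
    have h1 : ∑ i, comp 𝒜 (d + p j - p i) (x i) • g i = 0 := by
      have := congrArg (comp ℳ (d + p j)) hx
      rw [map_sum, map_zero] at this
      rw [← this]
      exact Finset.sum_congr rfl fun i _ => (comp_smul_of_right_mem (𝒜 := 𝒜) hs _ (hg i)).symm
    have h2 := congrArg (comp 𝒜 d) (hTK _ h1 j)
    rw [map_sum, map_zero] at h2
    rw [Matrix.vecMul, dotProduct, map_sum, ← h2]
    refine Finset.sum_congr rfl fun i _ => ?_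
    rw [he, comp_mul_of_right_mem _ (comp_mem _ _), comp_mul_of_left_mem (comp_mem _ _),
      show d - (p i - p j) = d + p j - p i by abel,
      show d - (d + p j - p i) = p i - p j by abel]
  refine ⟨e, fun i j => comp_mem _ _, ?_, heg, hK⟩
  have h0 : (e - 1) * e = 0 := by
    ext1 i j
    refine congrFun (hK (fun k => (e - 1) i k) ?_) j
    simp only [Matrix.sub_apply, sub_smul, Finset.sum_sub_distrib, heg, Matrix.one_apply, ite_smul,
      one_smul, zero_smul, Finset.sum_ite_eq, Finset.mem_univ, if_true, sub_self]
  rwa [sub_mul, one_mul, sub_eq_zero] at h0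

theorem exists_homogeneous_basis (hs : ∀ {a b : P} {x : A} {m : M}, x ∈ 𝒜 a → m ∈ ℳ b →
    x • m ∈ ℳ (a + b)) (h : AllTriv fun c => (𝒜 c).toAddSubgroup) [Module.Finite A M]
    [Module.Projective A M] :
    ∃ (r : ℕ) (w : Fin r → P) (b : Module.Basis (Fin r) A M), ∀ j, b j ∈ ℳ (w j) := by
  obtain ⟨n, p, g, hg, hspan⟩ := exists_homogeneous_generators (A := A) ℳ
  obtain ⟨e, he, hee, heg, hK⟩ := exists_idempotent hs hg hspan
  obtain ⟨r, w, U, V, hU, hV, hUV, hVU⟩ := h n p e he hee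
  let b : Fin r → M := fun j => ∑ k, V j k • g k
  have hlin : ∀ y : Fin r → A, ∑ j, y j • b j = ∑ k, (y ᵥ* V) k • g k := fun y => by
    simp only [b, Matrix.vecMul, dotProduct, Finset.smul_sum, Finset.sum_smul, smul_smul]
    exact Finset.sum_comm
  have hVe : V * e = V := by rw [← hUV, ← Matrix.mul_assoc, hVU, Matrix.one_mul]
  have hind : LinearIndependent A b := by
    rw [Fintype.linearIndependent_iff]
    intro y hy
    have h1 := hK _ ((hlin y).symm.trans hy)
    rw [Matrix.vecMul_vecMul, hVe] at h1
    have h2 : y ᵥ* V ᵥ* U = 0 := by rw [h1, Matrix.zero_vecMul]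
    rw [Matrix.vecMul_vecMul, hVU, Matrix.vecMul_one] at h2
    exact congrFun h2
  have hgen : ⊤ ≤ Submodule.span A (Set.range b) := by
    rw [← hspan, Submodule.span_le]
    rintro _ ⟨i, rfl⟩
    have h1 : ∑ j, U i j • b j = g i := by
      rw [hlin (fun j => U i j), ← heg i]
      exact Finset.sum_congr rfl fun k _ => by rw [← hUV]; rfl
    rw [SetLike.mem_coe, ← h1]
    exact Submodule.sum_mem _ fun j _ => Submodule.smul_mem _ _ (Submodule.subset_span ⟨j, rfl⟩)
  refine ⟨r, w, Module.Basis.mk hind hgen, fun j => ?_⟩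
  rw [Module.Basis.mk_apply]
  refine Submodule.sum_mem _ fun k _ => ?_
  have := hs (hV j k) (hg k)
  rwa [sub_add_cancel] at this

end Component

/-- The grading of a free module in which the `j`-th coordinate has degree `w j`. -/
def piGrading (R : Type*) {P ι : Type*} [CommRing R] (w : ι → P) (c : P) :
    Submodule R (ι → R) where
  carrier := {f | ∀ j, w j ≠ c → f j = 0}
  zero_mem' := fun _ _ => rfl
  add_mem' := fun hf hg j hj => by rw [Pi.add_apply, hf j hj, hg j hj, add_zero]
  smul_mem' := fun a f hf j hj => by rw [Pi.smul_apply, hf j hj, smul_zero]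

theorem single_mem_piGrading {R P ι : Type*} [CommRing R] [DecidableEq ι] (w : ι → P) (j : ι)
    (a : R) : Pi.single j a ∈ piGrading R w (w j) := fun i hi => by
  rw [Pi.single_eq_of_ne]
  rintro rfl
  exact hi rfl

theorem piGrading_isInternal {R P ι : Type*} [CommRing R] [DecidableEq P] [Fintype ι]
    (w : ι → P) : DirectSum.IsInternal (piGrading R w) := by
  classical
  have hev : ∀ (x : DirectSum P fun c => piGrading R w c) (j : ι),
      DirectSum.coeAddMonoidHom (piGrading R w) x j = (x (w j)).1 j := by
    intro x j
    induction x using DirectSum.induction_on with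
    | zero => simp
    | of c f =>
      rw [DirectSum.coeAddMonoidHom_of]
      obtain rfl | h := eq_or_ne (w j) c
      · rw [DirectSum.of_eq_same]
      · rw [DirectSum.of_eq_of_ne _ _ _ h, f.2 j h]
        rfl
    | add x y hx hy => simp [hx, hy]
  refine ⟨(injective_iff_map_eq_zero _).mpr fun x hx => ?_, fun f => ?_⟩
  · refine DFinsupp.ext fun c => Subtype.ext (funext fun j => ?_)
    obtain rfl | h := eq_or_ne (w j) c
    · rw [← hev, hx]
      rfl
    · exact (x c).2 j h
  · refine ⟨∑ j, DirectSum.of (fun c => piGrading R w c) (w j)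
      ⟨Pi.single j (f j), single_mem_piGrading w j _⟩, ?_⟩
    rw [map_sum]
    simp only [DirectSum.coeAddMonoidHom_of]
    exact Finset.univ_sum_single f

section Extended

universe v

variable {R A P M : Type v} [CommRing R] [CommRing A] [Algebra R A] [AddCommGroup P]
  [DecidableEq P] {𝒜 : P → Submodule R A} [GradedAlgebra 𝒜] [AddCommGroup M] [Module R M]
  [Module A M] [IsScalarTower R A M] {ℳ : P → Submodule R M}

theorem isGradedExtendedFrom_of_allTriv (hM : IsGradedModule 𝒜 ℳ)
    (h : AllTriv fun c => (𝒜 c).toAddSubgroup) [Module.Finite A M] [Module.Projective A M] :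
    IsGradedExtendedFrom R 𝒜 M ℳ := by
  let _ := hM.is_internal.chooseDecomposition
  obtain ⟨r, w, b, hb⟩ := exists_homogeneous_basis (ℳ := ℳ) hM.smul_mem h
  let e : M ≃ₗ[A] A ⊗[R] (Fin r → R) :=
    b.equiv ((Pi.basisFun R (Fin r)).baseChange A) (Equiv.refl _)
  have he : ∀ j, e (b j) = 1 ⊗ₜ Pi.single j 1 := fun j => by
    rw [Module.Basis.equiv_apply, Module.Basis.baseChange_apply, Pi.basisFun_apply]
    rfl
  refine ⟨Fin r → R, inferInstance, inferInstance, piGrading R w, piGrading_isInternal w,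
    inferInstance, inferInstance, e, fun c m hm => ?_, fun c z hz => ?_⟩
  · have h1 : m = ∑ j, comp 𝒜 (c - w j) (b.repr m j) • b j := by
      have := congrArg (comp ℳ c) (b.sum_repr m)
      rw [map_sum, comp_of_mem hm] at this
      refine this.symm.trans ?_
      exact Finset.sum_congr rfl fun j _ => comp_smul_of_right_mem (𝒜 := 𝒜) hM.smul_mem _ (hb j)
    rw [h1, map_sum]
    refine Submodule.sum_mem _ fun j _ => Submodule.subset_span ?_
    refine ⟨c - w j, w j, sub_add_cancel _ _, _, comp_mem _ (b.repr m j), _, single_mem_piGrading w j 1, ?_⟩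
    rw [map_smul, he, TensorProduct.smul_tmul', smul_eq_mul, mul_one]
  · refine Submodule.span_induction (p := fun z _ => e.symm z ∈ ℳ c) ?_ ?_ ?_ ?_ hz
    · rintro _ ⟨d, d', rfl, x, hx, f, hf, rfl⟩
      have h1 : x ⊗ₜ[R] f = e (∑ j, f j • x • b j) := by
        rw [map_sum]
        conv_lhs => rw [← Finset.univ_sum_single f, TensorProduct.tmul_sum]
        refine Finset.sum_congr rfl fun j _ => ?_
        rw [← smul_assoc, map_smul, he, TensorProduct.smul_tmul', smul_eq_mul, mul_one,
          TensorProduct.smul_tmul, ← Pi.single_smul, smul_eq_mul, mul_one]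
      rw [h1, LinearEquiv.symm_apply_apply]
      refine Submodule.sum_mem _ fun j _ => ?_
      obtain rfl | hj := eq_or_ne (w j) d'
      · exact Submodule.smul_mem _ _ (hM.smul_mem hx (hb j))
      · rw [hf j hj, zero_smul]
        exact Submodule.zero_mem _
    · rw [map_zero]
      exact Submodule.zero_mem _
    · intro x y _ _ hx hy
      rw [map_add]
      exact Submodule.add_mem _ hx hy
    · intro a x _ hx
      rw [← algebraMap_smul A a x, map_smul, algebraMap_smul]
      exact Submodule.smul_mem _ _ hx

end Extended

theorem monAlgGrading_eq_gradeBy (R : Type*) [CommRing R] {Λ P : Type*} [AddCommMonoid Λ]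
    (deg : Λ → P) : monAlgGrading R deg = AddMonoidAlgebra.gradeBy R deg := by
  refine funext fun c => le_antisymm (Submodule.span_le.mpr ?_) fun a ha => ?_
  · rintro _ ⟨s, rfl, rfl⟩
    exact AddMonoidAlgebra.single_mem_gradeBy _ _ _
  · rw [AddMonoidAlgebra.mem_gradeBy_iff] at ha
    rw [← AddMonoidAlgebra.sum_coeff_single a]
    refine Submodule.sum_mem _ fun s hs => ?_
    have h1 : AddMonoidAlgebra.single s (a.coeff s) =
        a.coeff s • (AddMonoidAlgebra.single s 1 : AddMonoidAlgebra R Λ) := by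
      rw [AddMonoidAlgebra.smul_single, smul_eq_mul, mul_one]
    rw [h1]
    exact Submodule.smul_mem _ _ (Submodule.subset_span ⟨s, ha hs, rfl⟩)

theorem allTriv_gradeBy_cone (R : Type*) [CommRing R] [IsDomain R] [IsPrincipalIdealRing R]
    {P L : Type*} [AddCommGroup P] [AddCommGroup L] [Module.Free ℤ L] [Module.Finite ℤ L] {q : ℕ}
    (l : Fin q → L →+ ℚ) (ψ : L →+ P) : AllTriv fun c => (AddMonoidAlgebra.gradeBy R
      (ψ.comp (coneLatticePoints l).subtype) c).toAddSubgroup := by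
  choose l' hl' using fun i => exists_int_forms (l i)
  have h1 : ∀ m, m ∈ coneLatticePoints l ↔ ∀ i, 0 ≤ l' i m := fun m =>
    forall_congr' fun i => (hl' i m).symm
  simpa only [← degGr_eq_gradeBy] using allTriv_degGr_cone (R := R) h1 ψ

end GradedMatrix

/-!
STATEMENT 1 (Corollary `Main thm 1-0`):
Let `R` be a principal ideal domain, `P` a finitely generated abelian group,
`L` a lattice, `σ ⊆ L_ℚ` a strongly convex rational polyhedral cone, and let
`ψ : L → P` make `A = R[σ ∩ L]` a `P`-graded `R`-algebra.  Then every finitely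
generated `P`-graded `A`-module which is projective as an `A`-module is trivial,
i.e. isomorphic as a `P`-graded `A`-module to `F ⊗_R A` for some `P`-graded
`R`-module `F` which is finitely generated and projective over `R`.
-/
theorem equivariant_bundles_on_affine_toric_schemes_over_PID_are_trivial
    (R : Type u) [CommRing R] [IsDomain R] [IsPrincipalIdealRing R]
    (P : Type u) [AddCommGroup P] [AddGroup.FG P] [DecidableEq P]
    (L : Type u) [AddCommGroup L] [Module.Free ℤ L] [Module.Finite ℤ L]
    (q : ℕ) (l : Fin q → L →+ ℚ) (hlne : ∀ i, l i ≠ 0)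
    (hspan : SpansLattice (coneLatticePoints l))
    (ψ : L →+ P)
    (M : Type u) [AddCommGroup M] [Module R M]
    [Module (AddMonoidAlgebra R ↥(coneLatticePoints l)) M]
    [IsScalarTower R (AddMonoidAlgebra R ↥(coneLatticePoints l)) M]
    (ℳ : P → Submodule R M)
    (hM : IsGradedModule (monAlgGrading R (fun s : ↥(coneLatticePoints l) => ψ (s : L))) ℳ)
    (hfin : Module.Finite (AddMonoidAlgebra R ↥(coneLatticePoints l)) M)
    (hproj : Module.Projective (AddMonoidAlgebra R ↥(coneLatticePoints l)) M) :
    IsGradedExtendedFrom R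
      (monAlgGrading R (fun s : ↥(coneLatticePoints l) => ψ (s : L))) M ℳ := by
  have h : monAlgGrading R (fun s : ↥(coneLatticePoints l) => ψ (s : L)) =
      AddMonoidAlgebra.gradeBy R (ψ.comp (coneLatticePoints l).subtype) :=
    GradedMatrix.monAlgGrading_eq_gradeBy R _
  rw [h] at hM ⊢
  exact GradedMatrix.isGradedExtendedFrom_of_allTriv hM (GradedMatrix.allTriv_gradeBy_cone R l ψ)
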